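/- arXiv:1306.6100 — 2 statements merged into one kernel-verified Lean document; each statement's English description precedes it below -/
import Mathlib

section
/- The cohomology of the total complex of the normalized double complex C^{p,q}(K ⋊ G, ℤ) = normalized Maps(G^p × K^q, ℤ) with differentials δ_G and δ_K is isomorphic to the group cohomology H*(K ⋊ G, ℤ). -/
set_option linter.unusedSectionVars false

namespace Stmt5

/-- Merge the entries at positions `i` and `i+1` of a tuple. -/
def mergeD {α : Type} [Mul α] {n : ℕ} (i : ℕ) (h : Fin (n + 1) → α) : Fin n → α :=
  fun j =>
    if (j : ℕ) < i then h j.castSucc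
    else if (j : ℕ) = i then h j.castSucc * h j.succ
    else h j.succ

variable (G K : Type) [Group G] [Group K] (ρ : G →* MulAut K)
variable (M : Type) [AddCommGroup M]

/-- The `(p,q)` group of the double bar cochain complex: maps `G^p × K^q → M`. -/
abbrev Cpq (p q : ℕ) : Type := ((Fin p → G) × (Fin q → K)) → M

/-- The differential `δ_G : C^{p,q} → C^{p+1,q}`. -/
def dGfun {p q : ℕ} (F : Cpq G K M p q) : Cpq G K M (p + 1) q := fun x =>
  F (fun j => x.1 j.succ, x.2) +
    ∑ i ∈ Finset.range p, ((-1 : ℤ) ^ (i + 1)) • F (mergeD i x.1, x.2) +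
    ((-1 : ℤ) ^ (p + 1)) •
      F (fun j => x.1 j.castSucc, fun j => ρ (x.1 (Fin.last p)) (x.2 j))

/-- The differential `δ_K : C^{p,q} → C^{p,q+1}`. -/
def dKfun {p q : ℕ} (F : Cpq G K M p q) : Cpq G K M p (q + 1) := fun x =>
  F (x.1, fun j => x.2 j.succ) +
    ∑ i ∈ Finset.range q, ((-1 : ℤ) ^ (i + 1)) • F (x.1, mergeD i x.2) +
    ((-1 : ℤ) ^ (q + 1)) • F (x.1, fun j => x.2 j.castSucc)

lemma dGfun_add {p q : ℕ} (F F' : Cpq G K M p q) :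
    dGfun G K ρ M (F + F') = dGfun G K ρ M F + dGfun G K ρ M F' := by
  funext x
  simp only [dGfun, Pi.add_apply, smul_add, Finset.sum_add_distrib]
  abel

lemma dKfun_add {p q : ℕ} (F F' : Cpq G K M p q) :
    dKfun G K M (F + F') = dKfun G K M F + dKfun G K M F' := by
  funext x
  simp only [dKfun, Pi.add_apply, smul_add, Finset.sum_add_distrib]
  abel

/-- `δ_G` as an additive homomorphism. -/
def dGhom (p q : ℕ) : Cpq G K M p q →+ Cpq G K M (p + 1) q :=
  AddMonoidHom.mk' (dGfun G K ρ M) (dGfun_add G K ρ M)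

/-- `δ_K` as an additive homomorphism. -/
def dKhom (p q : ℕ) : Cpq G K M p q →+ Cpq G K M p (q + 1) :=
  AddMonoidHom.mk' (dKfun G K M) (dKfun_add G K M)

/-- Reindexing of bidegrees. -/
def castC {p q p' q' : ℕ} (h1 : p = p') (h2 : q = q') (F : Cpq G K M p q) :
    Cpq G K M p' q' :=
  fun x => F (fun i => x.1 (Fin.cast h1 i), fun i => x.2 (Fin.cast h2 i))

lemma castC_add {p q p' q' : ℕ} (h1 : p = p') (h2 : q = q') (F F' : Cpq G K M p q) :
    castC G K M h1 h2 (F + F') = castC G K M h1 h2 F + castC G K M h1 h2 F' := rfl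

/-- The subgroup of normalized cochains. -/
def nrm (p q : ℕ) : AddSubgroup (Cpq G K M p q) where
  carrier := {F | ∀ x, ((∃ i, x.1 i = 1) ∨ (∃ i, x.2 i = 1)) → F x = 0}
  add_mem' := by
    intro a b ha hb x hx
    simp only [Pi.add_apply, ha x hx, hb x hx, add_zero]
  zero_mem' := by intro x _; rfl
  neg_mem' := by
    intro a ha x hx
    simp only [Pi.neg_apply, ha x hx, neg_zero]

/-- Degree `n` of the total complex of the full double complex `C^{*,*}`. -/
abbrev TotC (n : ℕ) : Type := ∀ p : Fin (n + 1), Cpq G K M (p : ℕ) (n - (p : ℕ))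

/-- Degree `n` of the total complex of `A^{*,*} = C^{*,*>0}` (0-th row removed). -/
abbrev TotA (n : ℕ) : Type := ∀ p : Fin n, Cpq G K M (p : ℕ) (n - (p : ℕ))

/-- Degree `n` of the total complex of `B^{*,*} = C^{*>0,*>0}` (0-th row and column
removed); the component indexed by `p : Fin (n-1)` has bidegree `(p+1, n-(p+1))`. -/
abbrev TotB (n : ℕ) : Type := ∀ p : Fin (n - 1), Cpq G K M ((p : ℕ) + 1) (n - ((p : ℕ) + 1))

/-- The total differential `δ_G ⊕ (-1)^p δ_K` of `C^{*,*}`, as a function. -/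
def totdFun {n : ℕ} (x : TotC G K M n) : TotC G K M (n + 1) := fun p =>
  (if h1 : 1 ≤ (p : ℕ) then
    castC G K M (by omega)
      (by
        show n - ((p : ℕ) - 1) = n + 1 - (p : ℕ)
        have := p.isLt; omega)
      (dGhom G K ρ M ((p : ℕ) - 1) (n - ((p : ℕ) - 1))
        (x ⟨(p : ℕ) - 1, by have := p.isLt; omega⟩))
  else 0) +
  ((-1 : ℤ) ^ (p : ℕ)) •
  (if h2 : (p : ℕ) ≤ n then
    castC G K M rfl (by omega)
      (dKhom G K M (p : ℕ) (n - (p : ℕ)) (x ⟨(p : ℕ), by omega⟩))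
  else 0)

lemma totdFun_add {n : ℕ} (x y : TotC G K M n) :
    totdFun G K ρ M (x + y) = totdFun G K ρ M x + totdFun G K ρ M y := by
  funext p
  by_cases h1 : 1 ≤ (p : ℕ) <;> by_cases h2 : (p : ℕ) ≤ n <;>
    simp only [totdFun, Pi.add_apply, dif_pos, dif_neg, h1, h2, map_add, castC_add,
      smul_add, add_zero, smul_zero, not_true, not_false_iff] <;> abel

/-- The total differential of `C^{*,*}` as an additive homomorphism. -/
def totd (n : ℕ) : TotC G K M n →+ TotC G K M (n + 1) :=
  AddMonoidHom.mk' (totdFun G K ρ M) (totdFun_add G K ρ M)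

/-- The total differential of `A^{*,*}`, as a function. -/
def totdAFun {n : ℕ} (x : TotA G K M n) : TotA G K M (n + 1) := fun p =>
  (if h1 : 1 ≤ (p : ℕ) then
    castC G K M (by omega)
      (by
        show n - ((p : ℕ) - 1) = n + 1 - (p : ℕ)
        have := p.isLt; omega)
      (dGhom G K ρ M ((p : ℕ) - 1) (n - ((p : ℕ) - 1))
        (x ⟨(p : ℕ) - 1, by have := p.isLt; omega⟩))
  else 0) +
  ((-1 : ℤ) ^ (p : ℕ)) •
  (if h2 : (p : ℕ) < n then
    castC G K M rfl (by omega)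
      (dKhom G K M (p : ℕ) (n - (p : ℕ)) (x ⟨(p : ℕ), h2⟩))
  else 0)

lemma totdAFun_add {n : ℕ} (x y : TotA G K M n) :
    totdAFun G K ρ M (x + y) = totdAFun G K ρ M x + totdAFun G K ρ M y := by
  funext p
  by_cases h1 : 1 ≤ (p : ℕ) <;> by_cases h2 : (p : ℕ) < n <;>
    simp only [totdAFun, Pi.add_apply, dif_pos, dif_neg, h1, h2, map_add, castC_add,
      smul_add, add_zero, smul_zero, not_true, not_false_iff] <;> abel

/-- The total differential of `A^{*,*}` as an additive homomorphism. -/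
def totdA (n : ℕ) : TotA G K M n →+ TotA G K M (n + 1) :=
  AddMonoidHom.mk' (totdAFun G K ρ M) (totdAFun_add G K ρ M)

/-- The total differential of `B^{*,*}`, as a function. -/
def totdBFun {n : ℕ} (x : TotB G K M n) : TotB G K M (n + 1) := fun p =>
  (if h1 : 1 ≤ (p : ℕ) then
    castC G K M (by omega)
      (by
        show n - (((p : ℕ) - 1) + 1) = n + 1 - ((p : ℕ) + 1)
        have := p.isLt; omega)
      (dGhom G K ρ M (((p : ℕ) - 1) + 1) (n - (((p : ℕ) - 1) + 1))
        (x ⟨(p : ℕ) - 1, by have := p.isLt; omega⟩))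
  else 0) +
  ((-1 : ℤ) ^ ((p : ℕ) + 1)) •
  (if h2 : (p : ℕ) < n - 1 then
    castC G K M rfl (by omega)
      (dKhom G K M ((p : ℕ) + 1) (n - ((p : ℕ) + 1)) (x ⟨(p : ℕ), h2⟩))
  else 0)

lemma totdBFun_add {n : ℕ} (x y : TotB G K M n) :
    totdBFun G K ρ M (x + y) = totdBFun G K ρ M x + totdBFun G K ρ M y := by
  funext p
  by_cases h1 : 1 ≤ (p : ℕ) <;> by_cases h2 : (p : ℕ) < n - 1 <;>
    simp only [totdBFun, Pi.add_apply, dif_pos, dif_neg, h1, h2, map_add, castC_add,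
      smul_add, add_zero, smul_zero, not_true, not_false_iff] <;> abel

/-- The total differential of `B^{*,*}` as an additive homomorphism. -/
def totdB (n : ℕ) : TotB G K M n →+ TotB G K M (n + 1) :=
  AddMonoidHom.mk' (totdBFun G K ρ M) (totdBFun_add G K ρ M)

/-- Normalized elements of the total complex of `C^{*,*}`. -/
def nrmC (n : ℕ) : AddSubgroup (TotC G K M n) :=
  AddSubgroup.pi Set.univ fun p => nrm G K M (p : ℕ) (n - (p : ℕ))

/-- Normalized elements of the total complex of `A^{*,*}`. -/
def nrmA (n : ℕ) : AddSubgroup (TotA G K M n) :=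
  AddSubgroup.pi Set.univ fun p => nrm G K M (p : ℕ) (n - (p : ℕ))

/-- Normalized elements of the total complex of `B^{*,*}`. -/
def nrmB (n : ℕ) : AddSubgroup (TotB G K M n) :=
  AddSubgroup.pi Set.univ fun p => nrm G K M ((p : ℕ) + 1) (n - ((p : ℕ) + 1))

/-- Normalized cocycles of `Tot^n(C^{*,*})`. -/
def ZC (n : ℕ) : AddSubgroup (TotC G K M n) := nrmC G K M n ⊓ (totd G K ρ M n).ker

/-- Normalized coboundaries of `Tot^n(C^{*,*})`. -/
def BC : ∀ n : ℕ, AddSubgroup (TotC G K M n)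
  | 0 => ⊥
  | n + 1 => AddSubgroup.map (totd G K ρ M n) (nrmC G K M n)

/-- The degree `n` cohomology of `Tot^*(C^{*,*}(K ⋊ G, M))`. -/
abbrev HC (n : ℕ) :=
  ZC G K ρ M n ⧸ (BC G K ρ M n).addSubgroupOf (ZC G K ρ M n)


/-- Normalized cocycles of `Tot^n(A^{*,*})`. -/
def ZA (n : ℕ) : AddSubgroup (TotA G K M n) := nrmA G K M n ⊓ (totdA G K ρ M n).ker

/-- Normalized coboundaries of `Tot^n(A^{*,*})`. -/
def BA : ∀ n : ℕ, AddSubgroup (TotA G K M n)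
  | 0 => ⊥
  | n + 1 => AddSubgroup.map (totdA G K ρ M n) (nrmA G K M n)

/-- The degree `n` cohomology of `Tot^*(A^{*,*}(K ⋊ G, M))`. -/
abbrev HA (n : ℕ) :=
  ZA G K ρ M n ⧸ (BA G K ρ M n).addSubgroupOf (ZA G K ρ M n)


/-- Normalized cocycles of `Tot^n(B^{*,*})`. -/
def ZB (n : ℕ) : AddSubgroup (TotB G K M n) := nrmB G K M n ⊓ (totdB G K ρ M n).ker

/-- Normalized coboundaries of `Tot^n(B^{*,*})`. -/
def BB : ∀ n : ℕ, AddSubgroup (TotB G K M n)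
  | 0 => ⊥
  | n + 1 => AddSubgroup.map (totdB G K ρ M n) (nrmB G K M n)

/-- The degree `n` cohomology of `Tot^*(B^{*,*}(K ⋊ G, M))`. -/
abbrev HB (n : ℕ) :=
  ZB G K ρ M n ⧸ (BB G K ρ M n).addSubgroupOf (ZB G K ρ M n)



section Algebra

/-- A correspondence `R` between subquotients of `A` and `B` that is total on both sides and
matches the denominators induces an isomorphism. -/
theorem nonempty_quotient_addEquiv_of_rel {A B : Type*} [AddCommGroup A] [AddCommGroup B]
    {ZA BA : AddSubgroup A} {ZB BB : AddSubgroup B} (R : AddSubgroup (A × B))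
    (left_total : ∀ a ∈ ZA, ∃ b ∈ ZB, (a, b) ∈ R)
    (right_total : ∀ b ∈ ZB, ∃ a ∈ ZA, (a, b) ∈ R)
    (mem_iff : ∀ a ∈ ZA, ∀ b ∈ ZB, (a, b) ∈ R → (a ∈ BA ↔ b ∈ BB)) :
    Nonempty (ZA ⧸ BA.addSubgroupOf ZA ≃+ ZB ⧸ BB.addSubgroupOf ZB) := by
  choose f hfZ hfR using left_total
  have key : ∀ a (ha : a ∈ ZA) b, b ∈ ZB → (a, b) ∈ R → f a ha - b ∈ BB := by
    intro a ha b hb hab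
    have h : ((0 : A), f a ha - b) ∈ R := by
      simpa using R.sub_mem (hfR a ha) hab
    exact (mem_iff 0 ZA.zero_mem _ (ZB.sub_mem (hfZ a ha) hb) h).1 BA.zero_mem
  let φ : ZA →+ ZB ⧸ BB.addSubgroupOf ZB := AddMonoidHom.mk'
    (fun a => QuotientAddGroup.mk ⟨f a a.2, hfZ a a.2⟩) (by
      intro a a'
      rw [← QuotientAddGroup.mk_add, QuotientAddGroup.eq_iff_sub_mem,
        AddSubgroup.mem_addSubgroupOf]
      exact key _ _ _ (ZB.add_mem (hfZ a a.2) (hfZ a' a'.2))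
        (R.add_mem (hfR a a.2) (hfR a' a'.2)))
  have hker : φ.ker = BA.addSubgroupOf ZA := by
    ext a
    rw [AddMonoidHom.mem_ker, AddSubgroup.mem_addSubgroupOf]
    exact (QuotientAddGroup.eq_zero_iff _).trans
      (mem_iff a a.2 _ (hfZ a a.2) (hfR a a.2)).symm
  have hsurj : Function.Surjective φ := by
    intro b
    induction b using QuotientAddGroup.induction_on with
    | H b =>
      obtain ⟨a, ha, hab⟩ := right_total b b.2
      refine ⟨⟨a, ha⟩, ?_⟩
      refine (QuotientAddGroup.eq_iff_sub_mem).2 ?_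
      exact key a ha b b.2 hab
  exact ⟨(QuotientAddGroup.quotientAddEquivOfEq hker.symm).trans
    (QuotientAddGroup.quotientKerEquivOfSurjective φ hsurj)⟩

/-- A first-quadrant double complex `W (n, m)` of subgroups of one group, for `m ≥ 1`, with
commuting differentials, whose columns are augmented by `W (n, 0)` and whose rows are augmented
by `Y m`, and all of whose augmented rows and columns are exact. -/
structure ExactGrid {Ω Ξ : Type*} [AddCommGroup Ω] [AddCommGroup Ξ] (dh dv : Ω →+ Ω)
    (dY : Ξ →+ Ξ) (η : Ξ →+ Ω) (W : ℕ → ℕ → AddSubgroup Ω) (Y : ℕ → AddSubgroup Ξ) : Prop where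
  dh_mem : ∀ {n m w}, w ∈ W n m → dh w ∈ W (n + 1) m
  dv_mem : ∀ {n m w}, w ∈ W n m → dv w ∈ W n (m + 1)
  dY_mem : ∀ {m y}, y ∈ Y m → dY y ∈ Y (m + 1)
  η_mem : ∀ {m y}, y ∈ Y m → η y ∈ W 0 (m + 1)
  dv_dh : ∀ w, dv (dh w) = dh (dv w)
  dh_dh : ∀ w, dh (dh w) = 0
  dv_dv : ∀ w, dv (dv w) = 0
  dv_η : ∀ y, dv (η y) = η (dY y)
  dh_η : ∀ y, dh (η y) = 0
  eq_zero_of_dv : ∀ {n w}, w ∈ W n 0 → dv w = 0 → w = 0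
  exact_dv : ∀ {n m w}, w ∈ W n (m + 1) → dv w = 0 → ∃ u ∈ W n m, dv u = w
  eq_zero_of_η : ∀ {m y}, y ∈ Y m → η y = 0 → y = 0
  exact_η : ∀ {m w}, w ∈ W 0 (m + 1) → dh w = 0 → ∃ y ∈ Y m, η y = w
  exact_dh : ∀ {n m w}, w ∈ W (n + 1) (m + 1) → dh w = 0 → ∃ u ∈ W n (m + 1), dh u = w

/-- The coboundaries of degree `n` in a graded family of subgroups. -/
def coboundaries {Ω : Type*} [AddCommGroup Ω] (d : Ω →+ Ω) (X : ℕ → AddSubgroup Ω) :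
    ℕ → AddSubgroup Ω
  | 0 => ⊥
  | n + 1 => (X n).map d

namespace ExactGrid

variable {Ω Ξ : Type*} [AddCommGroup Ω] [AddCommGroup Ξ] {dh dv : Ω →+ Ω}
    {dY : Ξ →+ Ξ} {η : Ξ →+ Ω} {W : ℕ → ℕ → AddSubgroup Ω} {Y : ℕ → AddSubgroup Ξ}

/-- Elements `w` of bidegree `(n, m)` with `dv (dh w) = 0`. -/
def diagCocycles (dh dv : Ω →+ Ω) (W : ℕ → ℕ → AddSubgroup Ω) (n m : ℕ) : AddSubgroup Ω :=
  W n m ⊓ (dv.comp dh).ker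

/-- Sums of a horizontal and a vertical cocycle of bidegree `(n, m)`. -/
def diagBoundaries (dh dv : Ω →+ Ω) (W : ℕ → ℕ → AddSubgroup Ω) (n m : ℕ) : AddSubgroup Ω :=
  (W n m ⊓ dh.ker) ⊔ (W n m ⊓ dv.ker)

/-- The subquotient `diagCocycles / diagBoundaries`. -/
abbrev DiagHomology (dh dv : Ω →+ Ω) (W : ℕ → ℕ → AddSubgroup Ω) (n m : ℕ) :=
  diagCocycles dh dv W n m ⧸
    (diagBoundaries dh dv W n m).addSubgroupOf (diagCocycles dh dv W n m)

/-- The subgroup of pairs with equal images. -/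
def eqRel {A B C : Type*} [AddCommGroup A] [AddCommGroup B] [AddCommGroup C]
    (f : A →+ C) (g : B →+ C) : AddSubgroup (A × B) :=
  (f.comp (AddMonoidHom.fst A B)).eqLocus (g.comp (AddMonoidHom.snd A B))

theorem mem_eqRel {A B C : Type*} [AddCommGroup A] [AddCommGroup B] [AddCommGroup C]
    {f : A →+ C} {g : B →+ C} {a : A} {b : B} : (a, b) ∈ eqRel f g ↔ f a = g b := Iff.rfl

theorem mem_diagBoundaries {n m : ℕ} {w : Ω} : w ∈ diagBoundaries dh dv W n m ↔
    ∃ u, (u ∈ W n m ∧ dh u = 0) ∧ ∃ v, (v ∈ W n m ∧ dv v = 0) ∧ u + v = w :=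
  AddSubgroup.mem_sup

theorem diag_step (E : ExactGrid dh dv dY η W Y) (n m : ℕ) :
    Nonempty (DiagHomology dh dv W (n + 1) (m + 1) ≃+ DiagHomology dh dv W n (m + 2)) := by
  refine nonempty_quotient_addEquiv_of_rel (eqRel dv dh) ?_ ?_ ?_
  · rintro w ⟨hw, hw'⟩
    obtain ⟨u, hu, hu'⟩ := E.exact_dh (E.dv_mem hw) ((E.dv_dh w).symm.trans hw')
    exact ⟨u, ⟨hu, by simp [hu', E.dv_dv]⟩, hu'.symm⟩
  · rintro w ⟨hw, hw'⟩
    obtain ⟨u, hu, hu'⟩ := E.exact_dv (E.dh_mem hw) hw'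
    exact ⟨u, ⟨hu, by simp [E.dv_dh, hu', E.dh_dh]⟩, hu'⟩
  · rintro w ⟨hw, -⟩ w' ⟨hw', -⟩ h
    rw [mem_eqRel] at h
    rw [mem_diagBoundaries, mem_diagBoundaries]
    constructor
    · rintro ⟨u, ⟨hu, hu'⟩, v, ⟨hv, hv'⟩, rfl⟩
      obtain ⟨t, ht, rfl⟩ := E.exact_dh hu hu'
      have := E.dv_mem ht
      refine ⟨w' - dv t, ⟨sub_mem hw' this, ?_⟩, dv t, ⟨this, E.dv_dv t⟩, by abel⟩
      rw [map_sub, ← h, map_add, hv', E.dv_dh, add_zero, sub_self]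
    · rintro ⟨u, ⟨hu, hu'⟩, v, ⟨hv, hv'⟩, rfl⟩
      obtain ⟨t, ht, rfl⟩ := E.exact_dv hv hv'
      have := E.dh_mem ht
      refine ⟨dh t, ⟨this, E.dh_dh t⟩, w - dh t, ⟨sub_mem hw this, ?_⟩, by abel⟩
      rw [map_sub, h, map_add, hu', E.dv_dh, zero_add, sub_self]

theorem diag_first (E : ExactGrid dh dv dY η W Y) (n : ℕ) :
    Nonempty (↥(W (n + 1) 0 ⊓ dh.ker) ⧸
      (coboundaries dh (W · 0) (n + 1)).addSubgroupOf (W (n + 1) 0 ⊓ dh.ker) ≃+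
      DiagHomology dh dv W n 1) := by
  refine nonempty_quotient_addEquiv_of_rel (eqRel dv dh) ?_ ?_ ?_
  · rintro w ⟨hw, hw'⟩
    obtain ⟨u, hu, hu'⟩ := E.exact_dh (E.dv_mem hw)
      ((E.dv_dh w).symm.trans (by rw [show dh w = 0 from hw', map_zero]))
    exact ⟨u, ⟨hu, by simp [hu', E.dv_dv]⟩, hu'.symm⟩
  · rintro w ⟨hw, hw'⟩
    obtain ⟨u, hu, hu'⟩ := E.exact_dv (E.dh_mem hw) hw'
    refine ⟨u, ⟨hu, E.eq_zero_of_dv (E.dh_mem hu) ?_⟩, hu'⟩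
    rw [E.dv_dh, hu', E.dh_dh]
  · rintro w ⟨hw, -⟩ w' ⟨hw', -⟩ h
    rw [mem_eqRel] at h
    rw [mem_diagBoundaries]
    constructor
    · rintro ⟨t, ht, rfl⟩
      have := E.dv_mem ht
      refine ⟨w' - dv t, ⟨sub_mem hw' this, ?_⟩, dv t, ⟨this, E.dv_dv t⟩, by abel⟩
      rw [map_sub, ← h, E.dv_dh, sub_self]
    · rintro ⟨u, ⟨hu, hu'⟩, v, ⟨hv, hv'⟩, rfl⟩
      obtain ⟨t, ht, rfl⟩ := E.exact_dv hv hv'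
      refine ⟨t, ht, (sub_eq_zero.1 (E.eq_zero_of_dv (sub_mem hw (E.dh_mem ht)) ?_)).symm⟩
      rw [map_sub, h, map_add, hu', E.dv_dh, zero_add, sub_self]

theorem diag_last (E : ExactGrid dh dv dY η W Y) (m : ℕ) :
    Nonempty (DiagHomology dh dv W 0 (m + 1) ≃+
      ↥(Y (m + 1) ⊓ dY.ker) ⧸
        (coboundaries dY Y (m + 1)).addSubgroupOf (Y (m + 1) ⊓ dY.ker)) := by
  refine nonempty_quotient_addEquiv_of_rel (eqRel dv η) ?_ ?_ ?_
  · rintro w ⟨hw, hw'⟩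
    obtain ⟨y, hy, hy'⟩ := E.exact_η (E.dv_mem hw) ((E.dv_dh w).symm.trans hw')
    refine ⟨y, ⟨hy, E.eq_zero_of_η (E.dY_mem hy) ?_⟩, hy'.symm⟩
    rw [← E.dv_η, hy', E.dv_dv]
  · rintro y ⟨hy, hy'⟩
    obtain ⟨u, hu, hu'⟩ := E.exact_dv (E.η_mem hy)
      (by rw [E.dv_η, show dY y = 0 from hy', map_zero])
    exact ⟨u, ⟨hu, by simp [E.dv_dh, hu', E.dh_η]⟩, hu'⟩
  · rintro w ⟨hw, -⟩ y ⟨hy, -⟩ h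
    rw [mem_eqRel] at h
    rw [mem_diagBoundaries]
    constructor
    · rintro ⟨u, ⟨hu, hu'⟩, v, ⟨hv, hv'⟩, rfl⟩
      obtain ⟨t, ht, rfl⟩ := E.exact_η hu hu'
      refine ⟨t, ht, (sub_eq_zero.1 (E.eq_zero_of_η (sub_mem hy (E.dY_mem ht)) ?_)).symm⟩
      rw [map_sub, ← h, map_add, hv', E.dv_η, add_zero, sub_self]
    · rintro ⟨t, ht, rfl⟩
      have := E.η_mem ht
      refine ⟨η t, ⟨this, E.dh_η t⟩, w - η t, ⟨sub_mem hw this, ?_⟩, by abel⟩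
      rw [map_sub, h, E.dv_η, sub_self]

theorem diag_zero (E : ExactGrid dh dv dY η W Y) :
    Nonempty (↥(W 0 0 ⊓ dh.ker) ⧸
      (coboundaries dh (W · 0) 0).addSubgroupOf (W 0 0 ⊓ dh.ker) ≃+
      ↥(Y 0 ⊓ dY.ker) ⧸ (coboundaries dY Y 0).addSubgroupOf (Y 0 ⊓ dY.ker)) := by
  refine nonempty_quotient_addEquiv_of_rel (eqRel dv η) ?_ ?_ ?_
  · rintro w ⟨hw, hw'⟩
    obtain ⟨y, hy, hy'⟩ := E.exact_η (E.dv_mem hw)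
      ((E.dv_dh w).symm.trans (by rw [show dh w = 0 from hw', map_zero]))
    refine ⟨y, ⟨hy, E.eq_zero_of_η (E.dY_mem hy) ?_⟩, hy'.symm⟩
    rw [← E.dv_η, hy', E.dv_dv]
  · rintro y ⟨hy, hy'⟩
    obtain ⟨u, hu, hu'⟩ := E.exact_dv (E.η_mem hy)
      (by rw [E.dv_η, show dY y = 0 from hy', map_zero])
    refine ⟨u, ⟨hu, E.eq_zero_of_dv (E.dh_mem hu) ?_⟩, hu'⟩
    rw [E.dv_dh, hu', E.dh_η]
  · rintro w ⟨hw, -⟩ y ⟨hy, -⟩ h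
    rw [mem_eqRel] at h
    change w = 0 ↔ y = 0
    constructor
    · rintro rfl
      exact E.eq_zero_of_η hy (by rw [← h, map_zero])
    · rintro rfl
      exact E.eq_zero_of_dv hw (by rw [h, map_zero])

theorem diag_zigzag (E : ExactGrid dh dv dY η W Y) (n : ℕ) : ∀ m,
    Nonempty (DiagHomology dh dv W n (m + 1) ≃+ DiagHomology dh dv W 0 (m + n + 1)) := by
  induction n with
  | zero => exact fun m => ⟨AddEquiv.refl _⟩
  | succ n ih =>
    intro m
    obtain ⟨e⟩ := E.diag_step n m
    have := ih (m + 1)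
    rw [show m + 1 + n + 1 = m + (n + 1) + 1 by ring] at this
    exact this.map e.trans

/-- The two augmenting complexes of an exact grid have isomorphic cohomology. -/
theorem nonempty_addEquiv (E : ExactGrid dh dv dY η W Y) (n : ℕ) :
    Nonempty (↥(W n 0 ⊓ dh.ker) ⧸
      (coboundaries dh (W · 0) n).addSubgroupOf (W n 0 ⊓ dh.ker) ≃+
      ↥(Y n ⊓ dY.ker) ⧸ (coboundaries dY Y n).addSubgroupOf (Y n ⊓ dY.ker)) := by
  cases n with
  | zero => exact E.diag_zero
  | succ n =>
    obtain ⟨e₁⟩ := E.diag_first n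
    have h₂ := E.diag_zigzag n 0
    rw [zero_add, zero_add] at h₂
    obtain ⟨e₂⟩ := h₂
    obtain ⟨e₃⟩ := E.diag_last n
    exact ⟨e₁.trans (e₂.trans e₃)⟩

end ExactGrid

end Algebra

section Faces

variable {P Q R A B : Type*} [AddCommGroup A] [AddCommGroup B]

/-- The alternating sum of a function over the faces (one entry omitted) of a list. -/
def face : (List P → A) → List P → A
  | _, [] => 0
  | F, x :: l => F l - face (fun t => F (x :: t)) l

@[simp] theorem face_nil (F : List P → A) : face F [] = 0 := rfl

theorem face_cons (F : List P → A) (x : P) (l : List P) :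
    face F (x :: l) = F l - face (fun t => F (x :: t)) l := rfl

theorem map_face (φ : A →+ B) (F : List P → A) (l : List P) :
    face (fun t => φ (F t)) l = φ (face F l) := by
  induction l generalizing F with
  | nil => simp
  | cons x l ih => simp only [face_cons, map_sub, ih]

theorem face_apply {ι : Type*} (F : List P → ι → A) (l : List P) (i : ι) :
    face F l i = face (fun t => F t i) l :=
  (map_face (Pi.evalAddMonoidHom (fun _ : ι => A) i) F l).symm

theorem face_add (F F' : List P → A) (l : List P) :
    face (F + F') l = face F l + face F' l := by
  induction l generalizing F F' with
  | nil => simp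
  | cons x l ih =>
    have := ih (fun t => F (x :: t)) (fun t => F' (x :: t))
    simp only [face_cons, Pi.add_apply]
    rw [show (fun t => F (x :: t) + F' (x :: t)) =
      (fun t => F (x :: t)) + fun t => F' (x :: t) from rfl, this]
    abel

/-- `face` as an additive homomorphism. -/
def faceHom (P A : Type*) [AddCommGroup A] : (List P → A) →+ (List P → A) :=
  AddMonoidHom.mk' face fun F F' => funext (face_add F F')

@[simp] theorem faceHom_apply (F : List P → A) : faceHom P A F = face F := rfl

theorem face_zero : face (0 : List P → A) = 0 := map_zero (faceHom P A)

@[simp] theorem face_fun_zero (l : List P) : face (fun _ => (0 : A)) l = 0 := congrFun face_zero l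

theorem face_fun_add (F F' : List P → A) (l : List P) :
    face (fun t => F t + F' t) l = face F l + face F' l := face_add F F' l

theorem face_sub (F F' : List P → A) : face (F - F') = face F - face F' :=
  map_sub (faceHom P A) F F'

theorem face_face (F : List P → A) : face (face F) = 0 := by
  funext l
  induction l generalizing F with
  | nil => rfl
  | cons x l ih =>
    rw [face_cons, show (fun t => face F (x :: t)) = F - face fun t => F (x :: t) from rfl,
      face_sub, Pi.sub_apply, ih]
    simp

theorem face_congr {F F' : List P → A} {l : List P}
    (h : ∀ t : List P, t.length + 1 = l.length → F t = F' t) : face F l = face F' l := by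
  induction l generalizing F F' with
  | nil => rfl
  | cons x l ih =>
    rw [face_cons, face_cons, h l (by simp), ih]
    intro t ht
    exact h _ (by simp [ht])

theorem face_eq_zero {F : List P → A} {l : List P}
    (h : ∀ t : List P, t.length + 1 = l.length → F t = 0) : face F l = 0 :=
  (face_congr (F' := 0) h).trans (congrFun face_zero l)

theorem face_map {P' : Type*} (φ : P → P') (F : List P' → A) (l : List P) :
    face F (l.map φ) = face (fun t => F (t.map φ)) l := by
  induction l generalizing F with
  | nil => rfl
  | cons x l ih => simp only [List.map_cons, face_cons, ih]

theorem face_neg_one_pow_smul (F : List P → A) (l : List P) :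
    face (fun t => (-1 : ℤ) ^ (t.length + 1) • F t) l = (-1 : ℤ) ^ l.length • face F l := by
  rw [← smulAddHom_apply, ← map_face]
  refine face_congr fun t ht => ?_
  rw [ht, smulAddHom_apply]

/-- The faces of a degenerate list cancel for a function vanishing on degenerate lists. -/
theorem face_eq_zero_of_not_isChain {F : List P → A}
    (hF : ∀ t : List P, ¬ t.IsChain (· ≠ ·) → F t = 0) {l : List P}
    (hl : ¬ l.IsChain (· ≠ ·)) : face F l = 0 := by
  induction l generalizing F with
  | nil => rfl
  | cons x l ih =>
    cases l with
    | nil => simp at hl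
    | cons y l =>
      by_cases hy : (y :: l).IsChain (· ≠ ·)
      · obtain rfl : x = y := by
          by_contra hxy
          exact hl (List.isChain_cons_cons.2 ⟨hxy, hy⟩)
        rw [face_cons, face_cons, sub_sub_cancel]
        exact face_eq_zero fun t _ => hF _ (by simp)
      · rw [face_cons, hF _ hy, ih (fun t ht => hF _ ?_) hy, sub_zero]
        exact fun h => ht h.tail

/-- The total differential of functions of two lists; the first list has degree one less than
its length. -/
def cellD (F : List P → List Q → A) : List P → List Q → A := fun xs ys =>
  face F xs ys + (-1 : ℤ) ^ (xs.length + 1) • face (F xs) ys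

theorem cellD_apply (F : List P → List Q → A) (xs : List P) (ys : List Q) :
    cellD F xs ys = face (fun t => F t ys) xs + (-1 : ℤ) ^ (xs.length + 1) • face (F xs) ys := by
  rw [cellD, face_apply]

theorem map_cellD (φ : A →+ B) (F : List P → List Q → A) (xs : List P) (ys : List Q) :
    cellD (fun xs ys => φ (F xs ys)) xs ys = φ (cellD F xs ys) := by
  rw [cellD_apply, cellD_apply, map_face φ, map_face φ, map_add, map_zsmul]

/-- `cellD` as an additive homomorphism. -/
def cellDHom (P Q A : Type*) [AddCommGroup A] :
    (List P → List Q → A) →+ (List P → List Q → A) :=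
  AddMonoidHom.mk' cellD fun F F' => by
    funext xs ys
    simp only [cellD, face_add, Pi.add_apply, smul_add]
    abel

@[simp] theorem cellDHom_apply (F : List P → List Q → A) : cellDHom P Q A F = cellD F := rfl

theorem cellD_cellD (F : List P → List Q → A) : cellD (cellD F) = 0 := by
  have h₁ : ∀ xs, face (cellD F) xs = (-1 : ℤ) ^ xs.length • face (face F xs) := by
    intro xs
    have : cellD F = face F + fun t => (-1 : ℤ) ^ (t.length + 1) • faceHom Q A (F t) := rfl
    rw [this, face_add, face_face, face_neg_one_pow_smul, map_face]
    simp
  have h₂ : ∀ xs, face (cellD F xs) = face (face F xs) := by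
    intro xs
    have : cellD F xs = face F xs + (-1 : ℤ) ^ (xs.length + 1) • face (F xs) := rfl
    rw [this, ← faceHom_apply, map_add, map_zsmul]
    simp [face_face]
  funext xs ys
  rw [cellD, h₁, h₂, pow_succ]
  simp

/-- Contraction of `cellD` by prepending `a` and `b`. -/
def cellH (a : P) (b : Q) (F : List P → List Q → A) : List P → List Q → A
  | [], _ => 0
  | [x], [] => F [a, x] []
  | [x], y :: ys => F [a, x] (y :: ys) + F [a] (b :: y :: ys)
  | x :: x' :: xs, ys => F (a :: x :: x' :: xs) ys

theorem cellD_cellH (a : P) (b : Q) {F : List P → List Q → A} (hF : ∀ ys, F [] ys = 0)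
    (hF' : ∀ xs, F xs [] = 0) (xs : List P) (ys : List Q) :
    cellD (cellH a b F) xs ys + cellH a b (cellD F) xs ys =
      F xs ys - if xs.length = 1 ∧ ys.length = 1 then F [a] [b] else 0 := by
  rcases xs with _ | ⟨x, _ | ⟨x', _ | ⟨x'', xs⟩⟩⟩ <;>
  rcases ys with _ | ⟨y, _ | ⟨y', ys⟩⟩ <;>
  simp [cellD_apply, cellH, face_cons, hF, hF', pow_succ, face_fun_add] <;>
  abel

theorem cellD_const (c : A) :
    cellD (fun (xs : List P) (ys : List Q) =>
      if xs.length = 1 ∧ ys.length = 1 then c else 0) = 0 := by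
  funext xs ys
  rw [cellD_apply]
  rcases xs with _ | ⟨x, _ | ⟨x', _ | ⟨x'', xs⟩⟩⟩ <;>
  rcases ys with _ | ⟨y, _ | ⟨y', _ | ⟨y'', ys⟩⟩⟩ <;>
  simp [face_cons]

end Faces

section Grid

variable {Γ P Q R : Type*} (actP : Γ → P → P) (actQ : Γ → Q → Q) (actR : Γ → R → R)

/-- Invariant functions of three lists, of lengths `p + 1`, `q + 1`, `m` with `p + q = n`,
normalized in the first two. -/
structure IsGridCochain (n m : ℕ) (F : List P → List Q → List R → ℤ) : Prop where
  nilP : ∀ ys ss, F [] ys ss = 0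
  nilQ : ∀ xs ss, F xs [] ss = 0
  length : ∀ xs ys ss, xs.length + ys.length ≠ n + 2 → F xs ys ss = 0
  lengthR : ∀ xs ys ss, ss.length ≠ m → F xs ys ss = 0
  normP : ∀ xs ys ss, ¬ xs.IsChain (· ≠ ·) → F xs ys ss = 0
  normQ : ∀ xs ys ss, ¬ ys.IsChain (· ≠ ·) → F xs ys ss = 0
  invariant : ∀ γ xs ys ss,
    F (xs.map (actP γ)) (ys.map (actQ γ)) (ss.map (actR γ)) = F xs ys ss

/-- The group of grid cochains of bidegree `(n, m)`. -/
def gridCochains (n m : ℕ) : AddSubgroup (List P → List Q → List R → ℤ) where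
  carrier := {F | IsGridCochain actP actQ actR n m F}
  zero_mem' := by constructor <;> intros <;> rfl
  add_mem' {F F'} h h' := by
    constructor <;> intros <;> simp only [Pi.add_apply]
    · rw [h.nilP, h'.nilP, add_zero]
    · rw [h.nilQ, h'.nilQ, add_zero]
    · rw [h.length, h'.length, add_zero] <;> assumption
    · rw [h.lengthR, h'.lengthR, add_zero] <;> assumption
    · rw [h.normP, h'.normP, add_zero] <;> assumption
    · rw [h.normQ, h'.normQ, add_zero] <;> assumption
    · rw [h.invariant, h'.invariant]
  neg_mem' {F} h := by
    constructor <;> intros <;> simp only [Pi.neg_apply]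
    · rw [h.nilP, neg_zero]
    · rw [h.nilQ, neg_zero]
    · rw [h.length, neg_zero]; assumption
    · rw [h.lengthR, neg_zero]; assumption
    · rw [h.normP, neg_zero]; assumption
    · rw [h.normQ, neg_zero]; assumption
    · rw [h.invariant]

theorem mem_gridCochains {n m : ℕ} {F : List P → List Q → List R → ℤ} :
    F ∈ gridCochains actP actQ actR n m ↔ IsGridCochain actP actQ actR n m F := Iff.rfl

/-- Invariant functions of lists of length `m + 1`. -/
def homogeneousCochains (m : ℕ) : AddSubgroup (List R → ℤ) where
  carrier := {y | (∀ ss, ss.length ≠ m + 1 → y ss = 0) ∧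
    ∀ γ ss, y (ss.map (actR γ)) = y ss}
  zero_mem' := ⟨fun _ _ => rfl, fun _ _ => rfl⟩
  add_mem' h h' := ⟨fun ss hs => by rw [Pi.add_apply, h.1 ss hs, h'.1 ss hs, add_zero],
    fun γ ss => by rw [Pi.add_apply, Pi.add_apply, h.2, h'.2]⟩
  neg_mem' h := ⟨fun ss hs => by rw [Pi.neg_apply, h.1 ss hs, neg_zero],
    fun γ ss => by rw [Pi.neg_apply, Pi.neg_apply, h.2]⟩

theorem face_mem_homogeneousCochains {m : ℕ} {y : List R → ℤ}
    (hy : y ∈ homogeneousCochains actR m) : face y ∈ homogeneousCochains actR (m + 1) := by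
  refine ⟨fun ss hs => face_eq_zero fun t ht => hy.1 _ (by omega), fun γ ss => ?_⟩
  rw [face_map]
  exact congrArg (face · ss) (funext (hy.2 γ))

/-- The vertical differential, in the third list. -/
def gridV (P Q R : Type*) :
    (List P → List Q → List R → ℤ) →+ (List P → List Q → List R → ℤ) :=
  AddMonoidHom.mk' (fun F xs ys => face (F xs ys)) fun F F' => by
    funext xs ys ss
    exact face_add _ _ _

theorem gridV_apply (F : List P → List Q → List R → ℤ) (xs : List P) (ys : List Q) :
    gridV P Q R F xs ys = face (F xs ys) := rfl

theorem gridH_apply (F : List P → List Q → List R → ℤ) (xs : List P) (ys : List Q)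
    (ss : List R) : cellDHom P Q (List R → ℤ) F xs ys ss =
      face (fun t => F t ys ss) xs + (-1 : ℤ) ^ (xs.length + 1) • face (fun t => F xs t ss) ys := by
  rw [cellDHom_apply, cellD_apply, Pi.add_apply, Pi.smul_apply, face_apply, face_apply]

/-- The augmentation of the rows. -/
def gridAug (P Q R : Type*) : (List R → ℤ) →+ (List P → List Q → List R → ℤ) :=
  AddMonoidHom.mk' (fun y xs ys => if xs.length = 1 ∧ ys.length = 1 then y else 0)
    fun y y' => by
      funext xs ys
      simp only [Pi.add_apply]
      split_ifs <;> simp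

theorem gridAug_apply (y : List R → ℤ) (xs : List P) (ys : List Q) :
    gridAug P Q R y xs ys = if xs.length = 1 ∧ ys.length = 1 then y else 0 := rfl

variable {actP actQ actR}

theorem gridH_mem {n m : ℕ} {F : List P → List Q → List R → ℤ}
    (h : F ∈ gridCochains actP actQ actR n m) :
    cellDHom P Q (List R → ℤ) F ∈ gridCochains actP actQ actR (n + 1) m := by
  rw [mem_gridCochains] at h ⊢
  constructor
  · intro ys ss
    simp [gridH_apply, h.nilP]
  · intro xs ss
    simp [gridH_apply, h.nilQ]
  · intro xs ys ss hl
    rw [gridH_apply, face_eq_zero fun t ht => h.length _ _ _ (by omega),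
      face_eq_zero fun t ht => h.length _ _ _ (by omega), smul_zero, add_zero]
  · intro xs ys ss hl
    rw [gridH_apply, face_eq_zero fun t ht => h.lengthR _ _ _ hl,
      face_eq_zero fun t ht => h.lengthR _ _ _ hl, smul_zero, add_zero]
  · intro xs ys ss hl
    rw [gridH_apply, face_eq_zero_of_not_isChain (fun t ht => h.normP _ _ _ ht) hl,
      face_eq_zero fun t ht => h.normP _ _ _ hl, smul_zero, add_zero]
  · intro xs ys ss hl
    rw [gridH_apply, face_eq_zero_of_not_isChain (fun t ht => h.normQ _ _ _ ht) hl,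
      face_eq_zero fun t ht => h.normQ _ _ _ hl, smul_zero, add_zero]
  · intro γ xs ys ss
    simp only [gridH_apply, face_map, h.invariant, List.length_map]

theorem gridV_mem {n m : ℕ} {F : List P → List Q → List R → ℤ}
    (h : F ∈ gridCochains actP actQ actR n m) :
    gridV P Q R F ∈ gridCochains actP actQ actR n (m + 1) := by
  rw [mem_gridCochains] at h ⊢
  constructor
  · intro ys ss
    exact face_eq_zero fun t _ => h.nilP _ _
  · intro xs ss
    exact face_eq_zero fun t _ => h.nilQ _ _
  · intro xs ys ss hl
    exact face_eq_zero fun t _ => h.length _ _ _ hl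
  · intro xs ys ss hl
    exact face_eq_zero fun t ht => h.lengthR _ _ _ (by omega)
  · intro xs ys ss hl
    exact face_eq_zero fun t _ => h.normP _ _ _ hl
  · intro xs ys ss hl
    exact face_eq_zero fun t _ => h.normQ _ _ _ hl
  · intro γ xs ys ss
    simp only [gridV_apply, face_map, h.invariant]

theorem gridAug_mem {m : ℕ} {y : List R → ℤ} (h : y ∈ homogeneousCochains actR m) :
    gridAug P Q R y ∈ gridCochains actP actQ actR 0 (m + 1) := by
  rw [mem_gridCochains]
  constructor
  · intro ys ss
    simp [gridAug_apply]
  · intro xs ss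
    simp [gridAug_apply]
  · intro xs ys ss hl
    rw [gridAug_apply, if_neg (by omega), Pi.zero_apply]
  · intro xs ys ss hl
    rw [gridAug_apply]
    split_ifs
    · exact h.1 ss hl
    · rfl
  · intro xs ys ss hl
    rw [gridAug_apply, if_neg, Pi.zero_apply]
    rintro ⟨hx, -⟩
    obtain ⟨x, rfl⟩ := List.length_eq_one_iff.1 hx
    simp at hl
  · intro xs ys ss hl
    rw [gridAug_apply, if_neg, Pi.zero_apply]
    rintro ⟨-, hy⟩
    obtain ⟨y, rfl⟩ := List.length_eq_one_iff.1 hy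
    simp at hl
  · intro γ xs ys ss
    simp only [gridAug_apply, List.length_map]
    split_ifs
    · exact h.2 γ ss
    · rfl

/-- Contraction of the columns: prepend the point `σ x y` of `R` determined by the first entries
of the other two lists. -/
def gridVContraction (σ : P → Q → R) (F : List P → List Q → List R → ℤ) :
    List P → List Q → List R → ℤ
  | x :: xs, y :: ys, ss => F (x :: xs) (y :: ys) (σ x y :: ss)
  | _, _, _ => 0

theorem gridVContraction_mem {σ : P → Q → R}
    (hσ : ∀ γ x y, actR γ (σ x y) = σ (actP γ x) (actQ γ y))
    {n m : ℕ} {F : List P → List Q → List R → ℤ}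
    (h : F ∈ gridCochains actP actQ actR n (m + 1)) :
    gridVContraction σ F ∈ gridCochains actP actQ actR n m := by
  rw [mem_gridCochains] at h ⊢
  constructor
  · intro ys ss
    rfl
  · rintro (_ | ⟨x, xs⟩) ss <;> rfl
  · rintro (_ | ⟨x, xs⟩) (_ | ⟨y, ys⟩) ss hl <;> try rfl
    exact h.length _ _ _ hl
  · rintro (_ | ⟨x, xs⟩) (_ | ⟨y, ys⟩) ss hl <;> try rfl
    exact h.lengthR _ _ _ (by simpa using hl)
  · rintro (_ | ⟨x, xs⟩) (_ | ⟨y, ys⟩) ss hl <;> try rfl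
    exact h.normP _ _ _ hl
  · rintro (_ | ⟨x, xs⟩) (_ | ⟨y, ys⟩) ss hl <;> try rfl
    exact h.normQ _ _ _ hl
  · rintro γ (_ | ⟨x, xs⟩) (_ | ⟨y, ys⟩) ss <;> try rfl
    have := h.invariant γ (x :: xs) (y :: ys) (σ x y :: ss)
    simpa [hσ, gridVContraction] using this

theorem gridV_gridVContraction (σ : P → Q → R) {n m : ℕ} {F : List P → List Q → List R → ℤ}
    (h : F ∈ gridCochains actP actQ actR n m) (hF : gridV P Q R F = 0) :
    gridV P Q R (gridVContraction σ F) = F := by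
  rw [mem_gridCochains] at h
  funext xs ys ss
  rw [gridV_apply]
  rcases xs with _ | ⟨x, xs⟩
  · rw [h.nilP]
    exact face_eq_zero fun _ _ => rfl
  rcases ys with _ | ⟨y, ys⟩
  · rw [h.nilQ]
    exact face_eq_zero fun _ _ => rfl
  have := congrFun (congrFun (congrFun hF (x :: xs)) (y :: ys)) (σ x y :: ss)
  rw [gridV_apply, face_cons] at this
  exact (sub_eq_zero.1 this).symm

/-- Contraction of the rows: prepend the points `α r`, `β r` determined by the first entry `r` of
the third list. -/
def gridHContraction (α : R → P) (β : R → Q) (F : List P → List Q → List R → ℤ) :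
    List P → List Q → List R → ℤ
  | _, _, [] => 0
  | xs, ys, r :: ss => cellH (α r) (β r) (fun xs ys => F xs ys (r :: ss)) xs ys

theorem gridHContraction_mem {α : R → P} {β : R → Q} (hα : ∀ γ r, actP γ (α r) = α (actR γ r))
    (hβ : ∀ γ r, actQ γ (β r) = β (actR γ r)) {n m : ℕ} {F : List P → List Q → List R → ℤ}
    (h : F ∈ gridCochains actP actQ actR (n + 1) m) :
    gridHContraction α β F ∈ gridCochains actP actQ actR n m := by
  rw [mem_gridCochains] at h ⊢
  constructor
  · rintro ys (_ | ⟨r, ss⟩) <;> rfl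
  · rintro (_ | ⟨x, _ | ⟨x', xs⟩⟩) (_ | ⟨r, ss⟩) <;>
    simp [gridHContraction, cellH, h.nilQ]
  · rintro (_ | ⟨x, _ | ⟨x', xs⟩⟩) (_ | ⟨y, ys⟩) (_ | ⟨r, ss⟩) hl <;>
    simp only [gridHContraction, cellH, h.nilQ] <;>
    simp only [List.length_cons, List.length_nil] at hl
    · rw [h.length _ _ _ (by simp; omega), h.length _ _ _ (by simp; omega), add_zero]
    · exact h.length _ _ _ (by simp; omega)
  · rintro (_ | ⟨x, _ | ⟨x', xs⟩⟩) (_ | ⟨y, ys⟩) (_ | ⟨r, ss⟩) hl <;>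
    simp only [gridHContraction, cellH, h.lengthR _ _ _ hl, add_zero]
  · rintro (_ | ⟨x, _ | ⟨x', xs⟩⟩) (_ | ⟨y, ys⟩) (_ | ⟨r, ss⟩) hl <;>
    simp only [gridHContraction, cellH, h.nilQ]
    · simp at hl
    · exact h.normP _ _ _ fun hc => hl hc.tail
  · rintro (_ | ⟨x, _ | ⟨x', xs⟩⟩) (_ | ⟨y, ys⟩) (_ | ⟨r, ss⟩) hl <;>
    simp only [gridHContraction, cellH, h.nilQ]
    · rw [h.normQ _ _ _ hl, h.normQ _ (β r :: y :: ys) _ fun hc => hl hc.tail, add_zero]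
    · exact h.normQ _ _ _ hl
  · rintro γ (_ | ⟨x, _ | ⟨x', xs⟩⟩) (_ | ⟨y, ys⟩) (_ | ⟨r, ss⟩) <;>
    simp only [gridHContraction, cellH, h.nilQ, List.map_cons, List.map_nil, ← hα, ← hβ]
    · rw [← h.invariant γ [α r, x], ← h.invariant γ [α r]]
      rfl
    · rw [← h.invariant γ (α r :: x :: x' :: xs)]
      rfl

theorem gridH_gridHContraction (α : R → P) (β : R → Q) {n m : ℕ}
    {F : List P → List Q → List R → ℤ} (h : F ∈ gridCochains actP actQ actR n (m + 1))
    (hF : cellDHom P Q (List R → ℤ) F = 0) (xs : List P) (ys : List Q) (r : R) (ss : List R) :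
    cellDHom P Q (List R → ℤ) (gridHContraction α β F) xs ys (r :: ss) =
      F xs ys (r :: ss) -
        if xs.length = 1 ∧ ys.length = 1 then F [α r] [β r] (r :: ss) else 0 := by
  rw [mem_gridCochains] at h
  have hD : cellD (fun xs ys => F xs ys (r :: ss)) = 0 := by
    funext xs ys
    rw [show (fun xs ys => F xs ys (r :: ss)) = fun xs ys =>
      Pi.evalAddMonoidHom (fun _ : List R => ℤ) (r :: ss) (F xs ys) from rfl, map_cellD]
    exact congrFun (congrFun (congrFun hF xs) ys) (r :: ss)
  have hH : cellH (α r) (β r) (0 : List P → List Q → ℤ) xs ys = 0 := by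
    rcases xs with _ | ⟨x, _ | ⟨x', xs⟩⟩ <;> rcases ys with _ | ⟨y, ys⟩ <;> simp [cellH]
  have := cellD_cellH (α r) (β r) (F := fun xs ys => F xs ys (r :: ss))
    (fun ys => h.nilP ys _) (fun xs => h.nilQ xs _) xs ys
  rw [hD, hH, add_zero] at this
  rw [← this]
  exact (map_cellD (Pi.evalAddMonoidHom (fun _ : List R => ℤ) (r :: ss))
    (gridHContraction α β F) xs ys).symm

theorem exactGrid {σ : P → Q → R} {α : R → P} {β : R → Q}
    (hσ : ∀ γ x y, actR γ (σ x y) = σ (actP γ x) (actQ γ y))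
    (hα : ∀ γ r, actP γ (α r) = α (actR γ r)) (hβ : ∀ γ r, actQ γ (β r) = β (actR γ r)) :
    ExactGrid (cellDHom P Q (List R → ℤ)) (gridV P Q R) (faceHom R ℤ) (gridAug P Q R)
      (gridCochains actP actQ actR) (homogeneousCochains actR) where
  dh_mem := gridH_mem
  dv_mem := gridV_mem
  dY_mem := face_mem_homogeneousCochains actR
  η_mem := gridAug_mem
  dv_dh F := by
    funext xs ys
    exact (map_cellD (faceHom R ℤ) F xs ys).symm
  dh_dh F := cellD_cellD F
  dv_dv F := by
    funext xs ys
    exact face_face _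
  dv_η y := by
    funext xs ys
    rw [gridV_apply, gridAug_apply, gridAug_apply]
    split_ifs
    · rfl
    · exact face_zero
  dh_η y := cellD_const y
  eq_zero_of_dv {n F} h hF := by
    rw [← gridV_gridVContraction σ h hF]
    suffices gridVContraction σ F = 0 by rw [this, map_zero]
    funext xs ys ss
    rcases xs with _ | ⟨x, xs⟩
    · rfl
    rcases ys with _ | ⟨y, ys⟩
    · rfl
    exact ((mem_gridCochains ..).1 h).lengthR _ _ _ (by simp)
  exact_dv h hF := ⟨_, gridVContraction_mem hσ h, gridV_gridVContraction σ h hF⟩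
  eq_zero_of_η {m y} h hy := by
    funext ss
    rcases ss with _ | ⟨r, ss⟩
    · exact h.1 _ (by simp)
    · exact congrFun (congrFun (congrFun hy [α r]) [β r]) (r :: ss)
  exact_η {m F} h hF := by
    have h' := (mem_gridCochains ..).1 h
    have hH : gridHContraction α β F = 0 := by
      funext xs ys ss
      rcases xs with _ | ⟨x, _ | ⟨x', xs⟩⟩ <;> rcases ys with _ | ⟨y, ys⟩ <;>
      rcases ss with _ | ⟨r, ss⟩ <;> simp only [gridHContraction, cellH, h'.nilQ] <;> try rfl
      · rw [h'.length _ _ _ (by simp), h'.length _ _ _ (by simp; omega)]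
        rfl
      · exact h'.length _ _ _ (by simp; omega)
    refine ⟨fun ss => match ss with
      | [] => 0
      | r :: ss => F [α r] [β r] (r :: ss), ⟨?_, ?_⟩, ?_⟩
    · rintro (_ | ⟨r, ss⟩) hl
      · rfl
      · exact h'.lengthR _ _ _ hl
    · rintro γ (_ | ⟨r, ss⟩)
      · rfl
      · simp only [List.map_cons, ← hα, ← hβ]
        exact h'.invariant γ [α r] [β r] (r :: ss)
    · funext xs ys ss
      rw [gridAug_apply]
      rcases ss with _ | ⟨r, ss⟩
      · rw [h'.lengthR _ _ _ (by simp)]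
        split_ifs <;> rfl
      · have := gridH_gridHContraction α β h hF xs ys r ss
        rw [hH, map_zero] at this
        rw [sub_eq_zero.1 this.symm]
        split_ifs <;> rfl
  exact_dh {n m F} h hF := by
    have h' := (mem_gridCochains ..).1 h
    refine ⟨_, gridHContraction_mem hα hβ h, ?_⟩
    funext xs ys ss
    rcases ss with _ | ⟨r, ss⟩
    · rw [h'.lengthR _ _ _ (by simp)]
      exact ((mem_gridCochains ..).1 (gridH_mem (gridHContraction_mem hα hβ h))).lengthR _ _ _
        (by simp)
    · rw [gridH_gridHContraction α β h hF, sub_eq_self]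
      split_ifs with hl
      · exact h'.length _ _ _ (by simp)
      · rfl

end Grid

section Paths

variable {H A : Type} [Group H] [AddCommGroup A]

/-- The list of vertices of the path starting at `s` with the given increments. -/
def pathFrom : H → List H → List H
  | s, [] => [s]
  | s, g :: gs => s :: pathFrom (s * g) gs

/-- The list of increments of a list of vertices. -/
def steps : List H → List H
  | [] => []
  | [_] => []
  | x :: y :: l => x⁻¹ * y :: steps (y :: l)

theorem length_pathFrom (s : H) (l : List H) : (pathFrom s l).length = l.length + 1 := by
  induction l generalizing s with
  | nil => rfl
  | cons g l ih => simp [pathFrom, ih]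

theorem pathFrom_eq_cons (s : H) (l : List H) : ∃ t, pathFrom s l = s :: t := by
  cases l with
  | nil => exact ⟨_, rfl⟩
  | cons g l => exact ⟨_, rfl⟩

theorem map_mul_left_pathFrom (a s : H) (l : List H) :
    (pathFrom s l).map (a * ·) = pathFrom (a * s) l := by
  induction l generalizing s with
  | nil => rfl
  | cons g l ih => simp [pathFrom, ih, mul_assoc]

theorem map_pathFrom {H' : Type} [Group H'] (φ : H →* H') (s : H) (l : List H) :
    (pathFrom s l).map φ = pathFrom (φ s) (l.map φ) := by
  induction l generalizing s with
  | nil => rfl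
  | cons g l ih => simp [pathFrom, ih]

theorem steps_pathFrom (s : H) (l : List H) : steps (pathFrom s l) = l := by
  induction l generalizing s with
  | nil => rfl
  | cons g l ih =>
    obtain ⟨t, ht⟩ := pathFrom_eq_cons (s * g) l
    have := ih (s * g)
    rw [ht] at this
    rw [pathFrom, ht, steps, this, inv_mul_cancel_left]

theorem pathFrom_steps (x : H) (l : List H) : pathFrom x (steps (x :: l)) = x :: l := by
  induction l generalizing x with
  | nil => rfl
  | cons y l ih => simp [steps, pathFrom, ih]

theorem length_steps (l : List H) : (steps l).length = l.length - 1 := by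
  cases l with
  | nil => rfl
  | cons x l =>
    have := length_pathFrom x (steps (x :: l))
    rw [pathFrom_steps] at this
    omega

theorem isChain_pathFrom (s : H) (l : List H) :
    (pathFrom s l).IsChain (· ≠ ·) ↔ 1 ∉ l := by
  induction l generalizing s with
  | nil => simp [pathFrom]
  | cons g l ih =>
    obtain ⟨t, ht⟩ := pathFrom_eq_cons (s * g) l
    have := ih (s * g)
    rw [ht] at this
    rw [pathFrom, ht, List.isChain_cons_cons, this, List.mem_cons, not_or, ne_eq, left_eq_mul,
      eq_comm]

theorem one_mem_steps {l : List H} (h : ¬ l.IsChain (· ≠ ·)) : 1 ∈ steps l := by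
  cases l with
  | nil => simp at h
  | cons x l =>
    rw [← pathFrom_steps x l, isChain_pathFrom, not_not] at h
    exact h

theorem steps_map {H' : Type} [Group H'] (φ : H →* H') (a : H') (l : List H) :
    steps (l.map fun x => a * φ x) = (steps l).map φ := by
  cases l with
  | nil => rfl
  | cons x l =>
    have h : (fun x => a * φ x) = (a * ·) ∘ φ := rfl
    conv_lhs => rw [← pathFrom_steps x l, h, ← List.map_map, map_pathFrom,
      map_mul_left_pathFrom, steps_pathFrom]

theorem steps_map_mul_left (a : H) (l : List H) : steps (l.map (a * ·)) = steps l := by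
  simpa using steps_map (MonoidHom.id H) a l

/-- The alternating sum over the contractions of adjacent entries, ending with the deletion of
the last entry. -/
def mergeSum : (List H → A) → List H → A
  | _, [] => 0
  | φ, [_] => -φ []
  | φ, g :: h :: t => -φ (g * h :: t) - mergeSum (fun l => φ (g :: l)) (h :: t)

theorem face_pathFrom (F : List H → A) (s g : H) (gs : List H) :
    face F (pathFrom s (g :: gs)) =
      F (pathFrom (s * g) gs) + mergeSum (fun l => F (pathFrom s l)) (g :: gs) := by
  rw [pathFrom, face_cons, sub_eq_add_neg]
  congr 1
  induction gs generalizing F s g with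
  | nil => simp [pathFrom, face_cons, mergeSum]
  | cons h t ih =>
    have := ih (fun l => F (s :: l)) (s * g) h
    rw [pathFrom, face_cons, mergeSum]
    simp only [pathFrom, ← mul_assoc] at this ⊢
    rw [← this]
    abel

theorem ofFn_mergeD_zero {n : ℕ} (g : Fin (n + 2) → H) :
    List.ofFn (mergeD 0 g) = g 0 * g 1 :: List.ofFn fun i : Fin n => g i.succ.succ := by
  rw [List.ofFn_succ]
  congr 1

theorem ofFn_mergeD_succ {n : ℕ} (i : ℕ) (g : Fin (n + 2) → H) :
    List.ofFn (mergeD (i + 1) g) = g 0 :: List.ofFn (mergeD i fun j => g j.succ) := by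
  rw [List.ofFn_succ]
  congr 1
  congr 1
  funext j
  simp [mergeD]

theorem mergeSum_ofFn {n : ℕ} (φ : List H → A) (g : Fin (n + 1) → H) :
    mergeSum φ (List.ofFn g) =
      ∑ i ∈ Finset.range (n + 1), (-1 : ℤ) ^ (i + 1) • φ (List.ofFn (mergeD i g)) := by
  induction n generalizing φ with
  | zero => simp [mergeSum]
  | succ n ih =>
    have h : mergeSum φ (List.ofFn g) = -φ (g 0 * g 1 :: List.ofFn fun i : Fin n => g i.succ.succ) -
        mergeSum (fun l => φ (g 0 :: l)) (List.ofFn fun i => g i.succ) := by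
      rw [List.ofFn_succ, List.ofFn_succ, mergeSum]
      rfl
    rw [Finset.sum_range_succ', h, ih, ofFn_mergeD_zero]
    simp only [ofFn_mergeD_succ, pow_succ (-1 : ℤ) (_ + 1)]
    simp [sub_eq_add_neg, add_comm]

theorem mergeD_last {n : ℕ} (g : Fin (n + 1) → H) : mergeD n g = fun j => g j.castSucc := by
  funext j
  simp [mergeD]

theorem prod_ofFn_mergeD {n i : ℕ} (hi : i < n) (g : Fin (n + 1) → H) :
    (List.ofFn (mergeD i g)).prod = (List.ofFn g).prod := by
  induction n generalizing i with
  | zero => omega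
  | succ n ih =>
    cases i with
    | zero => rw [ofFn_mergeD_zero]; simp [List.ofFn_succ, mul_assoc]
    | succ i => rw [ofFn_mergeD_succ, List.prod_cons, ih (by omega)]; simp [List.ofFn_succ]

/-- The faces of a path, in terms of its increments. -/
theorem face_pathFrom_ofFn {n : ℕ} (F : List H → A) (s : H) (g : Fin (n + 1) → H) :
    face F (pathFrom s (List.ofFn g)) = F (pathFrom (s * g 0) (List.ofFn fun j => g j.succ)) +
      ∑ i ∈ Finset.range (n + 1), (-1 : ℤ) ^ (i + 1) •
        F (pathFrom s (List.ofFn (mergeD i g))) := by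
  rw [← mergeSum_ofFn (fun l => F (pathFrom s l)), List.ofFn_succ, face_pathFrom]

end Paths

section GroupCohomology

open CategoryTheory

theorem homologyπ_eq_zero_iff {k : Type} [CommRing k] (C : CochainComplex (ModuleCat.{0} k) ℕ)
    (i j : ℕ) (hi : (ComplexShape.up ℕ).prev j = i) (z : C.cycles j) :
    C.homologyπ j z = 0 ↔ ∃ x : C.X i, C.toCycles i j x = z := by
  have h := ShortComplex.exact_of_g_is_cokernel
    (ShortComplex.mk (C.toCycles i j) (C.homologyπ j) (C.toCycles_comp_homologyπ i j))
    (C.homologyIsCokernel i j hi)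
  rw [ShortComplex.moduleCat_exact_iff] at h
  constructor
  · exact h z
  · rintro ⟨x, rfl⟩
    exact congrArg (fun f => f.hom x) (C.toCycles_comp_homologyπ i j)

variable {H : Type} [Group H] (A : Rep.{0} ℤ H)

theorem groupCohomology_π_zero_eq_zero_iff (z : groupCohomology.cocycles A 0) :
    groupCohomology.π A 0 z = 0 ↔ groupCohomology.iCocycles A 0 z = 0 := by
  refine (homologyπ_eq_zero_iff (groupCohomology.inhomogeneousCochains A) 0 0 (by simp) z).trans ?_
  have h : (groupCohomology.inhomogeneousCochains A).toCycles 0 0 = 0 :=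
    HomologicalComplex.toCycles_eq_zero _ (by simp)
  have hi : Function.Injective (groupCohomology.iCocycles A 0) :=
    (ModuleCat.mono_iff_injective _).1 inferInstance
  rw [h]
  constructor
  · rintro ⟨x, rfl⟩
    simp
  · intro hz
    exact ⟨0, hi (by simpa using hz.symm)⟩

theorem groupCohomology_π_succ_eq_zero_iff (n : ℕ) (z : groupCohomology.cocycles A (n + 1)) :
    groupCohomology.π A (n + 1) z = 0 ↔
      ∃ x : (Fin n → H) → A, inhomogeneousCochains.d A n x =
        groupCohomology.iCocycles A (n + 1) z := by
  refine (homologyπ_eq_zero_iff (groupCohomology.inhomogeneousCochains A) n (n + 1) (by simp)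
    z).trans ?_
  have hi : Function.Injective (groupCohomology.iCocycles A (n + 1)) :=
    (ModuleCat.mono_iff_injective _).1 inferInstance
  have h : ∀ x : (Fin n → H) → A, groupCohomology.iCocycles A (n + 1)
      (groupCohomology.toCocycles A n (n + 1) x) = inhomogeneousCochains.d A n x := by
    intro x
    rw [← groupCohomology.inhomogeneousCochains.d_def]
    exact congrArg (fun f => f.hom x)
      ((groupCohomology.inhomogeneousCochains A).toCycles_i n (n + 1))
  refine exists_congr fun x => ?_
  rw [← h, hi.eq_iff]

theorem iCocycles_comp_d (n : ℕ) (z : groupCohomology.cocycles A n) :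
    inhomogeneousCochains.d A n (groupCohomology.iCocycles A n z) = 0 := by
  rw [← groupCohomology.inhomogeneousCochains.d_def]
  exact congrArg (fun f => f.hom z)
    ((groupCohomology.inhomogeneousCochains A).iCycles_d n (n + 1))

section Homogeneous

/-- Extend a function of `n`-tuples to lists by zero. -/
def onList {H : Type} [One H] {n : ℕ} (c : (Fin n → H) → ℤ) : List H → ℤ := fun l =>
  if l.length = n then c fun i => l.getD i 1 else 0

theorem onList_ofFn {n : ℕ} (c : (Fin n → H) → ℤ) (g : Fin n → H) :
    onList c (List.ofFn g) = c g := by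
  rw [onList, if_pos (List.length_ofFn)]
  congr 1
  funext i
  simp

theorem onList_eq_zero {n : ℕ} (c : (Fin n → H) → ℤ) {l : List H} (h : l.length ≠ n) :
    onList c l = 0 := if_neg h

/-- Homogeneous integer cochains of a group acting on itself by left translation. -/
abbrev homogeneous (H : Type) [Group H] (n : ℕ) : AddSubgroup (List H → ℤ) :=
  homogeneousCochains (fun s t : H => s * t) n

theorem homogeneous_pathFrom {n : ℕ} {y : List H → ℤ} (hy : y ∈ homogeneous H n) (s t : H)
    (l : List H) : y (pathFrom s l) = y (pathFrom t l) := by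
  have h := hy.2 (s * t⁻¹) (pathFrom t l)
  rwa [map_mul_left_pathFrom, inv_mul_cancel_right] at h

theorem homogeneous_ext {n : ℕ} {y y' : List H → ℤ} (hy : y ∈ homogeneous H n)
    (hy' : y' ∈ homogeneous H n)
    (h : ∀ g : Fin n → H, y (pathFrom 1 (List.ofFn g)) = y' (pathFrom 1 (List.ofFn g))) :
    y = y' := by
  funext l
  by_cases hl : l.length = n + 1
  · cases l with
    | nil => simp at hl
    | cons x l =>
      have hs : (steps (x :: l)).length = n := by rw [length_steps, hl]; rfl
      obtain ⟨g, hg⟩ : ∃ g : Fin n → H, List.ofFn g = steps (x :: l) := by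
        subst hs
        exact ⟨_, List.ofFn_get _⟩
      rw [← pathFrom_steps x l, ← hg, homogeneous_pathFrom hy x 1, homogeneous_pathFrom hy' x 1, h]
  · rw [hy.1 l hl, hy'.1 l hl]

theorem exists_homogeneous {n : ℕ} (c : (Fin n → H) → ℤ) :
    ∃ y ∈ homogeneous H n, ∀ g, y (pathFrom 1 (List.ofFn g)) = c g := by
  refine ⟨fun l => if l = [] then 0 else onList c (steps l), ⟨fun l hl => ?_, fun s l => ?_⟩, fun g => ?_⟩
  · dsimp only
    split_ifs with h
    · rfl
    · refine onList_eq_zero _ ?_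
      rw [length_steps]
      have := List.length_pos_iff.2 h
      omega
  · simp [steps_map_mul_left]
  · obtain ⟨t, ht⟩ := pathFrom_eq_cons 1 (List.ofFn g)
    dsimp only
    rw [if_neg (by simp [ht]), steps_pathFrom, onList_ofFn]

theorem d_trivial_pathFrom {n : ℕ} {y : List H → ℤ} (hy : y ∈ homogeneous H n)
    (g : Fin (n + 1) → H) :
    inhomogeneousCochains.d (Rep.trivial ℤ H ℤ) n
      (fun g => y (pathFrom 1 (List.ofFn g))) g = face y (pathFrom 1 (List.ofFn g)) := by
  rw [inhomogeneousCochains.d_hom_apply, face_pathFrom_ofFn, homogeneous_pathFrom hy (1 * g 0) 1,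
    Finset.sum_range]
  rfl

/-- The correspondence between homogeneous cocycles and cohomology classes. -/
def homogeneousRel (H : Type) [Group H] (n : ℕ) :
    AddSubgroup ((List H → ℤ) × groupCohomology (Rep.trivial ℤ H ℤ) n) where
  carrier := {w | ∃ z : groupCohomology.cocycles (Rep.trivial ℤ H ℤ) n,
    (groupCohomology.iCocycles (Rep.trivial ℤ H ℤ) n z : (Fin n → H) → ℤ) =
      (fun g => w.1 (pathFrom 1 (List.ofFn g))) ∧ groupCohomology.π _ n z = w.2}
  zero_mem' := ⟨0, map_zero _, map_zero _⟩
  add_mem' := by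
    rintro _ _ ⟨z, hz, hz'⟩ ⟨t, ht, ht'⟩
    refine ⟨z + t, (map_add _ _ _).trans ?_, (map_add _ _ _).trans ?_⟩
    · exact congrArg₂ (fun a b : (Fin n → H) → ℤ => a + b) hz ht
    · rw [hz', ht']; rfl
  neg_mem' := by
    rintro _ ⟨z, hz, hz'⟩
    refine ⟨-z, (map_neg _ _).trans ?_, (map_neg _ _).trans ?_⟩
    · exact congrArg (fun a : (Fin n → H) → ℤ => -a) hz
    · rw [hz']; rfl

theorem nonempty_homogeneous_addEquiv (H : Type) [Group H] (n : ℕ) :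
    Nonempty (↥(homogeneous H n ⊓ (faceHom H ℤ).ker) ⧸
      (coboundaries (faceHom H ℤ) (homogeneous H) n).addSubgroupOf
        (homogeneous H n ⊓ (faceHom H ℤ).ker) ≃+ groupCohomology (Rep.trivial ℤ H ℤ) n) := by
  suffices h : Nonempty (↥(homogeneous H n ⊓ (faceHom H ℤ).ker) ⧸
      (coboundaries (faceHom H ℤ) (homogeneous H) n).addSubgroupOf
        (homogeneous H n ⊓ (faceHom H ℤ).ker) ≃+
      (⊤ : AddSubgroup (groupCohomology (Rep.trivial ℤ H ℤ) n)) ⧸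
        (⊥ : AddSubgroup (groupCohomology (Rep.trivial ℤ H ℤ) n)).addSubgroupOf ⊤) by
    obtain ⟨e⟩ := h
    exact ⟨e.trans (((QuotientAddGroup.quotientAddEquivOfEq (by simp)).trans
      QuotientAddGroup.quotientBot).trans AddSubgroup.topEquiv)⟩
  refine nonempty_quotient_addEquiv_of_rel (homogeneousRel H n) ?_ ?_ ?_
  · rintro y ⟨hy, hy'⟩
    have h : inhomogeneousCochains.d (Rep.trivial ℤ H ℤ) n
        (fun g => y (pathFrom 1 (List.ofFn g))) = 0 := by
      funext g
      rw [d_trivial_pathFrom hy]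
      exact congrFun hy' _
    exact ⟨_, trivial, groupCohomology.cocyclesMk _ h, groupCohomology.iCocycles_mk _ h, rfl⟩
  · rintro b -
    induction b using groupCohomology_induction_on with
    | h z =>
    obtain ⟨y, hy, hyz⟩ := exists_homogeneous (groupCohomology.iCocycles (Rep.trivial ℤ H ℤ) n z)
    have hyz := funext hyz
    refine ⟨y, ⟨hy, ?_⟩, z, hyz.symm, rfl⟩
    refine homogeneous_ext (face_mem_homogeneousCochains _ hy) (zero_mem _) fun g => ?_
    rw [faceHom_apply, ← d_trivial_pathFrom hy, hyz, iCocycles_comp_d]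
    rfl
  · rintro y ⟨hy, hy'⟩ _ - ⟨z, hz, rfl⟩
    rw [AddSubgroup.mem_bot]
    dsimp only at hz ⊢
    cases n with
    | zero =>
      rw [groupCohomology_π_zero_eq_zero_iff, hz]
      refine ⟨?_, fun h => homogeneous_ext hy (zero_mem _) fun g => congrFun h g⟩
      rintro rfl
      rfl
    | succ n =>
      rw [groupCohomology_π_succ_eq_zero_iff, hz]
      constructor
      · rintro ⟨x, hx, rfl⟩
        exact ⟨_, funext fun g => d_trivial_pathFrom hx g⟩
      · rintro ⟨c, hc⟩
        obtain ⟨x, hx, hxc⟩ := exists_homogeneous c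
        refine ⟨x, hx, homogeneous_ext (face_mem_homogeneousCochains _ hx) hy fun g => ?_⟩
        rw [faceHom_apply, ← d_trivial_pathFrom hx, funext hxc, hc]

end Homogeneous

end GroupCohomology

section SemidirectProduct

variable {G K : Type} [Group G] [Group K] {ρ : G →* MulAut K}

/-- The cochains on `G × K` that are invariant under the affine action of `K ⋊[ρ] G`. -/
abbrev affineCochains (ρ : G →* MulAut K) (n m : ℕ) :
    AddSubgroup (List G → List K → List (K ⋊[ρ] G) → ℤ) :=
  gridCochains (fun s x => s.right * x) (fun s y => s.left * ρ s.right y) (fun s t => s * t) n m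

theorem exactGrid_affineCochains (ρ : G →* MulAut K) :
    ExactGrid (cellDHom G K (List (K ⋊[ρ] G) → ℤ)) (gridV G K (K ⋊[ρ] G))
      (faceHom (K ⋊[ρ] G) ℤ) (gridAug G K (K ⋊[ρ] G)) (affineCochains ρ)
      (homogeneous (K ⋊[ρ] G)) :=
  exactGrid (σ := fun x y => ⟨y, x⟩) (α := fun s => s.right) (β := fun s => s.left)
    (fun _ _ _ => rfl) (fun _ _ => rfl) (fun _ _ => rfl)

/-- The value of a cochain on the cell with the given increments whose last `G`-vertex and
first `K`-vertex are trivial. -/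
def cellValue (f : List G → List K → List (K ⋊[ρ] G) → ℤ) (gs : List G) (ks : List K) : ℤ :=
  f (pathFrom gs.prod⁻¹ gs) (pathFrom 1 ks) []

section Invariance

variable {n : ℕ} {f : List G → List K → List (K ⋊[ρ] G) → ℤ}

theorem affineCochains_translate (hf : f ∈ affineCochains ρ n 0)
    (k t : K) (s : G) (gs : List G) (ks : List K) :
    f (pathFrom s gs) (pathFrom (k * t) ks) [] = f (pathFrom s gs) (pathFrom t ks) [] := by
  rw [← (mem_gridCochains _ _ _).1 hf |>.invariant ⟨k, 1⟩ (pathFrom s gs) (pathFrom t ks) []]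
  simp [map_mul_left_pathFrom]

theorem affineCochains_rotate (hf : f ∈ affineCochains ρ n 0)
    (g s : G) (gs : List G) (ks : List K) :
    f (pathFrom (g * s) gs) (pathFrom 1 (ks.map (ρ g))) [] =
      f (pathFrom s gs) (pathFrom 1 ks) [] := by
  rw [← (mem_gridCochains _ _ _).1 hf |>.invariant ⟨1, g⟩ (pathFrom s gs) (pathFrom 1 ks) []]
  have h := map_pathFrom (ρ g).toMonoidHom 1 ks
  rw [map_one] at h
  simp only [one_mul, List.map_nil, map_mul_left_pathFrom]
  exact congrArg (f _ · []) h.symm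

theorem affineCochains_apply_cons (hf : f ∈ affineCochains ρ n 0)
    (x : G) (xs : List G) (y : K) (ys : List K) :
    f (x :: xs) (y :: ys) [] = cellValue f (steps (x :: xs))
      ((steps (y :: ys)).map (ρ (x * (steps (x :: xs)).prod)⁻¹)) := by
  have h := affineCochains_rotate hf (x * (steps (x :: xs)).prod)⁻¹ x (steps (x :: xs))
    (steps (y :: ys))
  rw [← affineCochains_translate hf y 1 x, mul_one, pathFrom_steps, pathFrom_steps] at h
  rw [← h, cellValue, mul_inv_rev, inv_mul_cancel_right]

theorem dGfun_cellValue (hf : f ∈ affineCochains ρ n 0)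
    {p q : ℕ} (x : (Fin (p + 1) → G) × (Fin q → K)) :
    dGfun G K ρ ℤ (fun x => cellValue f (List.ofFn x.1) (List.ofFn x.2)) x =
      face (fun t => f t (pathFrom 1 (List.ofFn x.2)) [])
        (pathFrom (List.ofFn x.1).prod⁻¹ (List.ofFn x.1)) := by
  obtain ⟨g, k⟩ := x
  rw [face_pathFrom_ofFn, Finset.sum_range_succ, ← add_assoc]
  refine congrArg₂ (· + ·) (congrArg₂ (· + ·) ?_ (Finset.sum_congr rfl fun i hi => ?_)) ?_
  · have h : (List.ofFn g).prod⁻¹ * g 0 = (List.ofFn fun j => g j.succ).prod⁻¹ := by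
      simp [List.ofFn_succ]
    rw [h]
    rfl
  · dsimp only
    rw [cellValue, prod_ofFn_mergeD (Finset.mem_range.1 hi)]
  · have h : (List.ofFn fun j => g j.castSucc).prod⁻¹ =
        g (Fin.last p) * (List.ofFn g).prod⁻¹ := by
      rw [List.ofFn_succ' g]
      simp
    dsimp only
    rw [mergeD_last, cellValue, h,
      ← affineCochains_rotate hf (g (Fin.last p)) (List.ofFn g).prod⁻¹, List.map_ofFn]
    rfl

theorem dKfun_cellValue (hf : f ∈ affineCochains ρ n 0)
    {p q : ℕ} (x : (Fin p → G) × (Fin (q + 1) → K)) :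
    dKfun G K ℤ (fun x => cellValue f (List.ofFn x.1) (List.ofFn x.2)) x =
      face (fun t => f (pathFrom (List.ofFn x.1).prod⁻¹ (List.ofFn x.1)) t [])
        (pathFrom 1 (List.ofFn x.2)) := by
  obtain ⟨g, k⟩ := x
  rw [face_pathFrom_ofFn, Finset.sum_range_succ, ← add_assoc]
  refine congrArg₂ (· + ·) (congrArg₂ (· + ·) ?_ (Finset.sum_congr rfl fun i hi => rfl)) ?_
  · dsimp only
    rw [one_mul, ← mul_one (k 0), affineCochains_translate hf]
    rfl
  · rw [mergeD_last]
    rfl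

theorem castC_dGhom_cellValue (hf : f ∈ affineCochains ρ n 0)
    {p q p' q' : ℕ} (h₁ : p + 1 = p') (h₂ : q = q')
    (x : (Fin p' → G) × (Fin q' → K)) :
    castC G K ℤ h₁ h₂ (dGhom G K ρ ℤ p q fun x => cellValue f (List.ofFn x.1) (List.ofFn x.2)) x =
      face (fun t => f t (pathFrom 1 (List.ofFn x.2)) [])
        (pathFrom (List.ofFn x.1).prod⁻¹ (List.ofFn x.1)) := by
  subst h₁ h₂
  exact dGfun_cellValue hf x

theorem castC_dKhom_cellValue (hf : f ∈ affineCochains ρ n 0)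
    {p q p' q' : ℕ} (h₁ : p = p') (h₂ : q + 1 = q')
    (x : (Fin p' → G) × (Fin q' → K)) :
    castC G K ℤ h₁ h₂ (dKhom G K ℤ p q fun x => cellValue f (List.ofFn x.1) (List.ofFn x.2)) x =
      face (fun t => f (pathFrom (List.ofFn x.1).prod⁻¹ (List.ofFn x.1)) t [])
        (pathFrom 1 (List.ofFn x.2)) := by
  subst h₁ h₂
  exact dKfun_cellValue hf x

end Invariance

/-- Restriction of cochains to the components of the total complex. -/
def toTot (ρ : G →* MulAut K) (n : ℕ) :
    (List G → List K → List (K ⋊[ρ] G) → ℤ) →+ TotC G K ℤ n :=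
  AddMonoidHom.mk' (fun f _ x => cellValue f (List.ofFn x.1) (List.ofFn x.2)) fun _ _ => rfl

theorem toTot_apply {n : ℕ} (f : List G → List K → List (K ⋊[ρ] G) → ℤ) :
    toTot ρ n f = fun _ x => cellValue f (List.ofFn x.1) (List.ofFn x.2) := rfl

theorem totd_toTot {n : ℕ} {f : List G → List K → List (K ⋊[ρ] G) → ℤ}
    (hf : f ∈ affineCochains ρ n 0) :
    totd G K ρ ℤ n (toTot ρ n f) = toTot ρ (n + 1) (cellDHom G K _ f) := by
  funext p x
  have h := (mem_gridCochains _ _ _).1 hf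
  change totdFun G K ρ ℤ (toTot ρ n f) p x = cellDHom G K _ f _ _ _
  rw [gridH_apply, totdFun, Pi.add_apply, Pi.smul_apply, length_pathFrom, List.length_ofFn,
    pow_succ, pow_succ, mul_assoc, neg_one_mul, neg_neg, mul_one]
  refine congrArg₂ (· + ·) ?_ ?_
  · split_ifs with hp
    · exact castC_dGhom_cellValue hf _ _ x
    · refine (face_eq_zero fun t ht => ?_).symm
      rw [length_pathFrom, List.length_ofFn] at ht
      rw [List.length_eq_zero_iff.1 (show t.length = 0 by omega), h.nilP]
  · congr 1
    split_ifs with hp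
    · exact castC_dKhom_cellValue hf _ _ x
    · refine (face_eq_zero fun t ht => ?_).symm
      rw [length_pathFrom, List.length_ofFn] at ht
      rw [List.length_eq_zero_iff.1 (show t.length = 0 by omega), h.nilQ]

theorem toTot_mem {n : ℕ} {f : List G → List K → List (K ⋊[ρ] G) → ℤ}
    (hf : f ∈ affineCochains ρ n 0) : toTot ρ n f ∈ nrmC G K ℤ n := by
  rintro p - x hx
  rcases hx with ⟨i, hi⟩ | ⟨i, hi⟩
  · refine ((mem_gridCochains _ _ _).1 hf).normP _ _ _ fun h => (isChain_pathFrom _ _).1 h ?_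
    exact (List.mem_ofFn' _ _).2 ⟨i, hi⟩
  · refine ((mem_gridCochains _ _ _).1 hf).normQ _ _ _ fun h => (isChain_pathFrom _ _).1 h ?_
    exact (List.mem_ofFn' _ _).2 ⟨i, hi⟩

/-- The value of an element of the total complex on lists of increments. -/
def totValue {n : ℕ} (F : TotC G K ℤ n) (gs : List G) (ks : List K) : ℤ :=
  if h : gs.length + ks.length = n then
    F ⟨gs.length, by omega⟩ (fun i => gs.getD i 1, fun i => ks.getD i 1)
  else 0

theorem ofFn_getD {H : Type} [One H] {n : ℕ} {l : List H} (h : l.length = n) :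
    List.ofFn (fun i : Fin n => l.getD i 1) = l := by
  subst h
  refine List.ext_getElem (by simp) fun i _ _ => by simp

theorem totValue_ofFn {n : ℕ} (F : TotC G K ℤ n) (p : Fin (n + 1))
    (x : (Fin (p : ℕ) → G) × (Fin (n - (p : ℕ)) → K)) :
    totValue F (List.ofFn x.1) (List.ofFn x.2) = F p x := by
  have key : ∀ (gs : List G) (ks : List K), gs.length = p → ks.length = n - p →
      totValue F gs ks = F p (fun i => gs.getD i 1, fun i => ks.getD i 1) := by
    obtain ⟨p, hp⟩ := p
    rintro gs ks rfl hk
    exact dif_pos (by simp only at hk; omega)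
  rw [key _ _ List.length_ofFn List.length_ofFn]
  congr 1
  ext i <;> simp

theorem totValue_toTot {n : ℕ} (f : List G → List K → List (K ⋊[ρ] G) → ℤ) {gs : List G}
    {ks : List K} (h : gs.length + ks.length = n) :
    totValue (toTot ρ n f) gs ks = cellValue f gs ks := by
  rw [totValue, dif_pos h, toTot_apply]
  dsimp only
  rw [ofFn_getD rfl, ofFn_getD (by omega)]

theorem totValue_eq_zero {n : ℕ} {F : TotC G K ℤ n} (hF : F ∈ nrmC G K ℤ n) {gs : List G}
    {ks : List K} (h : 1 ∈ gs ∨ 1 ∈ ks) : totValue F gs ks = 0 := by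
  rw [totValue]
  split_ifs with hn
  · refine hF _ trivial _ (h.imp (fun h => ?_) fun h => ?_)
    · obtain ⟨i, hi, h⟩ := List.mem_iff_getElem.1 h
      exact ⟨⟨i, hi⟩, by simp [hi, h]⟩
    · obtain ⟨i, hi, h⟩ := List.mem_iff_getElem.1 h
      exact ⟨⟨i, by simp only; omega⟩, by simp [hi, h]⟩
  · rfl

theorem toTot_injective {n : ℕ} {f f' : List G → List K → List (K ⋊[ρ] G) → ℤ}
    (hf : f ∈ affineCochains ρ n 0) (hf' : f' ∈ affineCochains ρ n 0)
    (h : toTot ρ n f = toTot ρ n f') : f = f' := by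
  have e := (mem_gridCochains _ _ _).1 hf
  have e' := (mem_gridCochains _ _ _).1 hf'
  funext xs ys ss
  rcases ss with _ | ⟨s, ss⟩
  · rcases xs with _ | ⟨x, xs⟩
    · rw [e.nilP, e'.nilP]
    rcases ys with _ | ⟨y, ys⟩
    · rw [e.nilQ, e'.nilQ]
    by_cases hl : (x :: xs).length + (y :: ys).length = n + 2
    · rw [List.length_cons, List.length_cons] at hl
      have hl' : (steps (x :: xs)).length +
          ((steps (y :: ys)).map (ρ (x * (steps (x :: xs)).prod)⁻¹)).length = n := by
        rw [List.length_map, length_steps, length_steps, List.length_cons, List.length_cons]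
        omega
      rw [affineCochains_apply_cons hf, affineCochains_apply_cons hf', ← totValue_toTot f hl',
        ← totValue_toTot f' hl', h]
    · rw [e.length _ _ _ hl, e'.length _ _ _ hl]
  · rw [e.lengthR _ _ _ (by simp), e'.lengthR _ _ _ (by simp)]

/-- The invariant extension of an element of the total complex. -/
def ofTot (ρ : G →* MulAut K) {n : ℕ} (F : TotC G K ℤ n) :
    List G → List K → List (K ⋊[ρ] G) → ℤ
  | x :: xs, y :: ys, [] => totValue F (steps (x :: xs))
      ((steps (y :: ys)).map (ρ (x * (steps (x :: xs)).prod)⁻¹))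
  | _, _, _ => 0

theorem ofTot_mem {n : ℕ} {F : TotC G K ℤ n} (hF : F ∈ nrmC G K ℤ n) :
    ofTot ρ F ∈ affineCochains ρ n 0 := by
  rw [mem_gridCochains]
  constructor
  · intro ys ss
    rfl
  · rintro (_ | ⟨x, xs⟩) ss <;> rfl
  · rintro (_ | ⟨x, xs⟩) (_ | ⟨y, ys⟩) (_ | ⟨s, ss⟩) h <;> try rfl
    refine dif_neg ?_
    rw [List.length_cons, List.length_cons] at h
    rw [List.length_map, length_steps, length_steps, List.length_cons, List.length_cons]
    omega
  · rintro (_ | ⟨x, xs⟩) (_ | ⟨y, ys⟩) (_ | ⟨s, ss⟩) h <;> first | rfl | simp at h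
  · rintro (_ | ⟨x, xs⟩) (_ | ⟨y, ys⟩) (_ | ⟨s, ss⟩) h <;> try rfl
    exact totValue_eq_zero hF (Or.inl (one_mem_steps h))
  · rintro (_ | ⟨x, xs⟩) (_ | ⟨y, ys⟩) (_ | ⟨s, ss⟩) h <;> try rfl
    exact totValue_eq_zero hF (Or.inr (List.mem_map.2 ⟨1, one_mem_steps h, map_one _⟩))
  · rintro γ (_ | ⟨x, xs⟩) (_ | ⟨y, ys⟩) (_ | ⟨s, ss⟩) <;> try rfl
    have h₁ := steps_map_mul_left γ.right (x :: xs)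
    have h₂ := steps_map (ρ γ.right).toMonoidHom γ.left (y :: ys)
    simp only [List.map_cons, List.map_nil, ofTot] at h₁ h₂ ⊢
    rw [h₁]
    refine congrArg _ ((congrArg _ h₂).trans ?_)
    rw [List.map_map]
    congr 1
    funext k
    simp [mul_assoc]

theorem toTot_ofTot {n : ℕ} (F : TotC G K ℤ n) : toTot ρ n (ofTot ρ F) = F := by
  funext p x
  rw [← totValue_ofFn F p x, toTot_apply]
  dsimp only
  rw [cellValue]
  obtain ⟨t, ht⟩ := pathFrom_eq_cons (List.ofFn x.1).prod⁻¹ (List.ofFn x.1)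
  obtain ⟨u, hu⟩ := pathFrom_eq_cons 1 (List.ofFn x.2)
  rw [ht, hu, ofTot, ← ht, ← hu, steps_pathFrom, steps_pathFrom]
  simp

theorem nonempty_HC_addEquiv (ρ : G →* MulAut K) (n : ℕ) :
    Nonempty (HC G K ρ ℤ n ≃+
      ↥(affineCochains ρ n 0 ⊓ (cellDHom G K (List (K ⋊[ρ] G) → ℤ)).ker) ⧸
        (coboundaries (cellDHom G K _) (affineCochains ρ · 0) n).addSubgroupOf
          (affineCochains ρ n 0 ⊓ (cellDHom G K _).ker)) := by
  refine nonempty_quotient_addEquiv_of_rel (ExactGrid.eqRel (AddMonoidHom.id _) (toTot ρ n)) ?_ ?_ ?_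
  · rintro F ⟨hF, hF'⟩
    refine ⟨ofTot ρ F, ⟨ofTot_mem hF, ?_⟩, (toTot_ofTot F).symm⟩
    refine toTot_injective (gridH_mem (ofTot_mem hF)) (zero_mem _) ?_
    rw [← totd_toTot (ofTot_mem hF), toTot_ofTot, map_zero]
    exact hF'
  · rintro f ⟨hf, hf'⟩
    refine ⟨toTot ρ n f, ⟨toTot_mem hf, ?_⟩, rfl⟩
    change totd G K ρ ℤ n _ = 0
    rw [totd_toTot hf, show cellDHom G K _ f = 0 from hf', map_zero]
  · rintro F - f ⟨hf, -⟩ h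
    obtain rfl : F = toTot ρ n f := h
    cases n with
    | zero =>
      refine ⟨fun h => toTot_injective hf (zero_mem _) (h.trans (map_zero _).symm), ?_⟩
      rintro rfl
      exact map_zero _
    | succ n =>
      constructor
      · rintro ⟨F, hF, h⟩
        refine ⟨ofTot ρ F, ofTot_mem hF, toTot_injective (gridH_mem (ofTot_mem hF)) hf ?_⟩
        rw [← totd_toTot (ofTot_mem hF), toTot_ofTot, h]
      · rintro ⟨u, hu, rfl⟩
        exact ⟨toTot ρ n u, toTot_mem hu, totd_toTot hu⟩

end SemidirectProduct

/-- The cohomology of the total complex of the normalized double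
complex `C^{p,q}(K ⋊ G, ℤ) = Maps(G^p × K^q, ℤ)` with the differentials `δ_G` and
`(-1)^p δ_K` is isomorphic to the group cohomology `H^*(K ⋊ G, ℤ)`. -/
theorem stmt_5 : ∀ n : ℕ,
    Nonempty (HC G K ρ ℤ n ≃+ (groupCohomology (Rep.trivial ℤ (K ⋊[ρ] G) ℤ) n)) := by
  intro n
  obtain ⟨e₁⟩ := nonempty_HC_addEquiv ρ n
  obtain ⟨e₂⟩ := (exactGrid_affineCochains ρ).nonempty_addEquiv n
  obtain ⟨e₃⟩ := nonempty_homogeneous_addEquiv (K ⋊[ρ] G) n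
  exact ⟨e₁.trans (e₂.trans e₃)⟩

end Stmt5
end

section
/- There is a canonical direct sum decomposition of double complexes C^{*,*}(K ⋊ G, ℤ) ≅ A^{*,*}(K ⋊ G, ℤ) ⊕ C^*(G, ℤ), inducing a canonical isomorphism in cohomology H^*(K ⋊ G, ℤ) ≅ H^*(Tot^*(A^{*,*}(K ⋊ G, ℤ))) ⊕ H^*(G, ℤ), and similarly with coefficients in the circle group 𝕋. -/
set_option linter.unusedSectionVars false

namespace Stmt6

/-- Merge the entries at positions `i` and `i+1` of a tuple. -/
def mergeD {α : Type} [Mul α] {n : ℕ} (i : ℕ) (h : Fin (n + 1) → α) : Fin n → α :=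
  fun j =>
    if (j : ℕ) < i then h j.castSucc
    else if (j : ℕ) = i then h j.castSucc * h j.succ
    else h j.succ

variable (G K : Type) [Group G] [Group K] (ρ : G →* MulAut K)
variable (M : Type) [AddCommGroup M]

/-- The `(p,q)` group of the double bar cochain complex: maps `G^p × K^q → M`. -/
abbrev Cpq (p q : ℕ) : Type := ((Fin p → G) × (Fin q → K)) → M

/-- The differential `δ_G : C^{p,q} → C^{p+1,q}`. -/
def dGfun {p q : ℕ} (F : Cpq G K M p q) : Cpq G K M (p + 1) q := fun x =>
  F (fun j => x.1 j.succ, x.2) +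
    ∑ i ∈ Finset.range p, ((-1 : ℤ) ^ (i + 1)) • F (mergeD i x.1, x.2) +
    ((-1 : ℤ) ^ (p + 1)) •
      F (fun j => x.1 j.castSucc, fun j => ρ (x.1 (Fin.last p)) (x.2 j))

/-- The differential `δ_K : C^{p,q} → C^{p,q+1}`. -/
def dKfun {p q : ℕ} (F : Cpq G K M p q) : Cpq G K M p (q + 1) := fun x =>
  F (x.1, fun j => x.2 j.succ) +
    ∑ i ∈ Finset.range q, ((-1 : ℤ) ^ (i + 1)) • F (x.1, mergeD i x.2) +
    ((-1 : ℤ) ^ (q + 1)) • F (x.1, fun j => x.2 j.castSucc)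

lemma dGfun_add {p q : ℕ} (F F' : Cpq G K M p q) :
    dGfun G K ρ M (F + F') = dGfun G K ρ M F + dGfun G K ρ M F' := by
  funext x
  simp only [dGfun, Pi.add_apply, smul_add, Finset.sum_add_distrib]
  abel

lemma dKfun_add {p q : ℕ} (F F' : Cpq G K M p q) :
    dKfun G K M (F + F') = dKfun G K M F + dKfun G K M F' := by
  funext x
  simp only [dKfun, Pi.add_apply, smul_add, Finset.sum_add_distrib]
  abel

/-- `δ_G` as an additive homomorphism. -/
def dGhom (p q : ℕ) : Cpq G K M p q →+ Cpq G K M (p + 1) q :=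
  AddMonoidHom.mk' (dGfun G K ρ M) (dGfun_add G K ρ M)

/-- `δ_K` as an additive homomorphism. -/
def dKhom (p q : ℕ) : Cpq G K M p q →+ Cpq G K M p (q + 1) :=
  AddMonoidHom.mk' (dKfun G K M) (dKfun_add G K M)

/-- Reindexing of bidegrees. -/
def castC {p q p' q' : ℕ} (h1 : p = p') (h2 : q = q') (F : Cpq G K M p q) :
    Cpq G K M p' q' :=
  fun x => F (fun i => x.1 (Fin.cast h1 i), fun i => x.2 (Fin.cast h2 i))

lemma castC_add {p q p' q' : ℕ} (h1 : p = p') (h2 : q = q') (F F' : Cpq G K M p q) :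
    castC G K M h1 h2 (F + F') = castC G K M h1 h2 F + castC G K M h1 h2 F' := rfl

/-- The subgroup of normalized cochains. -/
def nrm (p q : ℕ) : AddSubgroup (Cpq G K M p q) where
  carrier := {F | ∀ x, ((∃ i, x.1 i = 1) ∨ (∃ i, x.2 i = 1)) → F x = 0}
  add_mem' := by
    intro a b ha hb x hx
    simp only [Pi.add_apply, ha x hx, hb x hx, add_zero]
  zero_mem' := by intro x _; rfl
  neg_mem' := by
    intro a ha x hx
    simp only [Pi.neg_apply, ha x hx, neg_zero]

/-- Degree `n` of the total complex of the full double complex `C^{*,*}`. -/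
abbrev TotC (n : ℕ) : Type := ∀ p : Fin (n + 1), Cpq G K M (p : ℕ) (n - (p : ℕ))

/-- Degree `n` of the total complex of `A^{*,*} = C^{*,*>0}` (0-th row removed). -/
abbrev TotA (n : ℕ) : Type := ∀ p : Fin n, Cpq G K M (p : ℕ) (n - (p : ℕ))

/-- Degree `n` of the total complex of `B^{*,*} = C^{*>0,*>0}` (0-th row and column
removed); the component indexed by `p : Fin (n-1)` has bidegree `(p+1, n-(p+1))`. -/
abbrev TotB (n : ℕ) : Type := ∀ p : Fin (n - 1), Cpq G K M ((p : ℕ) + 1) (n - ((p : ℕ) + 1))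

/-- The total differential `δ_G ⊕ (-1)^p δ_K` of `C^{*,*}`, as a function. -/
def totdFun {n : ℕ} (x : TotC G K M n) : TotC G K M (n + 1) := fun p =>
  (if h1 : 1 ≤ (p : ℕ) then
    castC G K M (by omega)
      (by
        show n - ((p : ℕ) - 1) = n + 1 - (p : ℕ)
        have := p.isLt; omega)
      (dGhom G K ρ M ((p : ℕ) - 1) (n - ((p : ℕ) - 1))
        (x ⟨(p : ℕ) - 1, by have := p.isLt; omega⟩))
  else 0) +
  ((-1 : ℤ) ^ (p : ℕ)) •
  (if h2 : (p : ℕ) ≤ n then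
    castC G K M rfl (by omega)
      (dKhom G K M (p : ℕ) (n - (p : ℕ)) (x ⟨(p : ℕ), by omega⟩))
  else 0)

lemma totdFun_add {n : ℕ} (x y : TotC G K M n) :
    totdFun G K ρ M (x + y) = totdFun G K ρ M x + totdFun G K ρ M y := by
  funext p
  by_cases h1 : 1 ≤ (p : ℕ) <;> by_cases h2 : (p : ℕ) ≤ n <;>
    simp only [totdFun, Pi.add_apply, dif_pos, dif_neg, h1, h2, map_add, castC_add,
      smul_add, add_zero, smul_zero, not_true, not_false_iff] <;> abel

/-- The total differential of `C^{*,*}` as an additive homomorphism. -/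
def totd (n : ℕ) : TotC G K M n →+ TotC G K M (n + 1) :=
  AddMonoidHom.mk' (totdFun G K ρ M) (totdFun_add G K ρ M)

/-- The total differential of `A^{*,*}`, as a function. -/
def totdAFun {n : ℕ} (x : TotA G K M n) : TotA G K M (n + 1) := fun p =>
  (if h1 : 1 ≤ (p : ℕ) then
    castC G K M (by omega)
      (by
        show n - ((p : ℕ) - 1) = n + 1 - (p : ℕ)
        have := p.isLt; omega)
      (dGhom G K ρ M ((p : ℕ) - 1) (n - ((p : ℕ) - 1))
        (x ⟨(p : ℕ) - 1, by have := p.isLt; omega⟩))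
  else 0) +
  ((-1 : ℤ) ^ (p : ℕ)) •
  (if h2 : (p : ℕ) < n then
    castC G K M rfl (by omega)
      (dKhom G K M (p : ℕ) (n - (p : ℕ)) (x ⟨(p : ℕ), h2⟩))
  else 0)

lemma totdAFun_add {n : ℕ} (x y : TotA G K M n) :
    totdAFun G K ρ M (x + y) = totdAFun G K ρ M x + totdAFun G K ρ M y := by
  funext p
  by_cases h1 : 1 ≤ (p : ℕ) <;> by_cases h2 : (p : ℕ) < n <;>
    simp only [totdAFun, Pi.add_apply, dif_pos, dif_neg, h1, h2, map_add, castC_add,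
      smul_add, add_zero, smul_zero, not_true, not_false_iff] <;> abel

/-- The total differential of `A^{*,*}` as an additive homomorphism. -/
def totdA (n : ℕ) : TotA G K M n →+ TotA G K M (n + 1) :=
  AddMonoidHom.mk' (totdAFun G K ρ M) (totdAFun_add G K ρ M)

/-- The total differential of `B^{*,*}`, as a function. -/
def totdBFun {n : ℕ} (x : TotB G K M n) : TotB G K M (n + 1) := fun p =>
  (if h1 : 1 ≤ (p : ℕ) then
    castC G K M (by omega)
      (by
        show n - (((p : ℕ) - 1) + 1) = n + 1 - ((p : ℕ) + 1)
        have := p.isLt; omega)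
      (dGhom G K ρ M (((p : ℕ) - 1) + 1) (n - (((p : ℕ) - 1) + 1))
        (x ⟨(p : ℕ) - 1, by have := p.isLt; omega⟩))
  else 0) +
  ((-1 : ℤ) ^ ((p : ℕ) + 1)) •
  (if h2 : (p : ℕ) < n - 1 then
    castC G K M rfl (by omega)
      (dKhom G K M ((p : ℕ) + 1) (n - ((p : ℕ) + 1)) (x ⟨(p : ℕ), h2⟩))
  else 0)

lemma totdBFun_add {n : ℕ} (x y : TotB G K M n) :
    totdBFun G K ρ M (x + y) = totdBFun G K ρ M x + totdBFun G K ρ M y := by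
  funext p
  by_cases h1 : 1 ≤ (p : ℕ) <;> by_cases h2 : (p : ℕ) < n - 1 <;>
    simp only [totdBFun, Pi.add_apply, dif_pos, dif_neg, h1, h2, map_add, castC_add,
      smul_add, add_zero, smul_zero, not_true, not_false_iff] <;> abel

/-- The total differential of `B^{*,*}` as an additive homomorphism. -/
def totdB (n : ℕ) : TotB G K M n →+ TotB G K M (n + 1) :=
  AddMonoidHom.mk' (totdBFun G K ρ M) (totdBFun_add G K ρ M)

/-- Normalized elements of the total complex of `C^{*,*}`. -/
def nrmC (n : ℕ) : AddSubgroup (TotC G K M n) :=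
  AddSubgroup.pi Set.univ fun p => nrm G K M (p : ℕ) (n - (p : ℕ))

/-- Normalized elements of the total complex of `A^{*,*}`. -/
def nrmA (n : ℕ) : AddSubgroup (TotA G K M n) :=
  AddSubgroup.pi Set.univ fun p => nrm G K M (p : ℕ) (n - (p : ℕ))

/-- Normalized elements of the total complex of `B^{*,*}`. -/
def nrmB (n : ℕ) : AddSubgroup (TotB G K M n) :=
  AddSubgroup.pi Set.univ fun p => nrm G K M ((p : ℕ) + 1) (n - ((p : ℕ) + 1))

/-- Normalized cocycles of `Tot^n(C^{*,*})`. -/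
def ZC (n : ℕ) : AddSubgroup (TotC G K M n) := nrmC G K M n ⊓ (totd G K ρ M n).ker

/-- Normalized coboundaries of `Tot^n(C^{*,*})`. -/
def BC : ∀ n : ℕ, AddSubgroup (TotC G K M n)
  | 0 => ⊥
  | n + 1 => AddSubgroup.map (totd G K ρ M n) (nrmC G K M n)

/-- The degree `n` cohomology of `Tot^*(C^{*,*}(K ⋊ G, M))`. -/
abbrev HC (n : ℕ) :=
  ZC G K ρ M n ⧸ (BC G K ρ M n).addSubgroupOf (ZC G K ρ M n)


/-- Normalized cocycles of `Tot^n(A^{*,*})`. -/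
def ZA (n : ℕ) : AddSubgroup (TotA G K M n) := nrmA G K M n ⊓ (totdA G K ρ M n).ker

/-- Normalized coboundaries of `Tot^n(A^{*,*})`. -/
def BA : ∀ n : ℕ, AddSubgroup (TotA G K M n)
  | 0 => ⊥
  | n + 1 => AddSubgroup.map (totdA G K ρ M n) (nrmA G K M n)

/-- The degree `n` cohomology of `Tot^*(A^{*,*}(K ⋊ G, M))`. -/
abbrev HA (n : ℕ) :=
  ZA G K ρ M n ⧸ (BA G K ρ M n).addSubgroupOf (ZA G K ρ M n)


/-- Normalized cocycles of `Tot^n(B^{*,*})`. -/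
def ZB (n : ℕ) : AddSubgroup (TotB G K M n) := nrmB G K M n ⊓ (totdB G K ρ M n).ker

/-- Normalized coboundaries of `Tot^n(B^{*,*})`. -/
def BB : ∀ n : ℕ, AddSubgroup (TotB G K M n)
  | 0 => ⊥
  | n + 1 => AddSubgroup.map (totdB G K ρ M n) (nrmB G K M n)

/-- The degree `n` cohomology of `Tot^*(B^{*,*}(K ⋊ G, M))`. -/
abbrev HB (n : ℕ) :=
  ZB G K ρ M n ⧸ (BB G K ρ M n).addSubgroupOf (ZB G K ρ M n)




/-- The canonical splitting map `Tot^n(A^{*,*}) ⊕ C^n(G, M) → Tot^n(C^{*,*})` that puts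
the second summand in the 0-th row (bidegree `(n,0)`). -/
def splitMap (n : ℕ) (ac : TotA G K M n × Cpq G K M n 0) : TotC G K M n := fun p =>
  if h : (p : ℕ) < n then ac.1 ⟨(p : ℕ), h⟩
  else castC G K M (by have := p.isLt; omega) (by have := p.isLt; omega) ac.2

section Helpers

set_option maxSynthPendingDepth 3

section ListChains

open TensorProduct

variable (k : Type) [CommRing k] {α : Type}

/-- The simplicial boundary of a tuple, valued in the free module on tuples. -/
noncomputable def bdry : List α → (List α →₀ k)
  | [] => 0
  | x :: l => Finsupp.single l 1 - Finsupp.mapDomain (List.cons x) (bdry l)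

/-- The boundary as an endomorphism of the augmented complex of tuples. -/
noncomputable def bdryMap (α : Type) : (List α →₀ k) →ₗ[k] (List α →₀ k) :=
  Finsupp.lift _ k _ (bdry k)

/-- Linear extension of prepending `x`. -/
noncomputable def consMap (x : α) : (List α →₀ k) →ₗ[k] (List α →₀ k) :=
  Finsupp.lmapDomain k k (List.cons x)

/-- The degree sign `(-1)^(|l|+1)`. -/
noncomputable def signMap (α : Type) : (List α →₀ k) →ₗ[k] (List α →₀ k) :=
  Finsupp.lift _ k _ fun l => (-1 : ℤ) ^ (l.length + 1) • Finsupp.single l 1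

/-- The projection annihilating the empty tuple. -/
noncomputable def dropNil (α : Type) : (List α →₀ k) →ₗ[k] (List α →₀ k) :=
  Finsupp.lift _ k _ fun l => if l = [] then 0 else Finsupp.single l 1

/-- The contracting homotopy, prepending `e` to nonempty tuples. -/
noncomputable def coneMap (e : α) : (List α →₀ k) →ₗ[k] (List α →₀ k) :=
  Finsupp.lift _ k _ fun l => if l = [] then 0 else Finsupp.single (e :: l) 1

/-- The augmentation, counting tuples with one entry. -/
noncomputable def augMap (α : Type) : (List α →₀ k) →ₗ[k] k :=
  Finsupp.lift _ k _ fun l => if l.length = 1 then 1 else 0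

/-- The augmentation followed by the inclusion of the vertex `e`. -/
noncomputable def vertexMap (e : α) : (List α →₀ k) →ₗ[k] (List α →₀ k) :=
  (LinearMap.toSpanSingleton k _ (Finsupp.single [e] 1)) ∘ₗ augMap k α

variable {k}

@[simp] lemma bdryMap_single (l : List α) : bdryMap k α (Finsupp.single l 1) = bdry k l := by
  simp [bdryMap]

lemma consMap_single (x : α) (l : List α) (n : k) :
    consMap k x (Finsupp.single l n) = Finsupp.single (x :: l) n := by
  simp [consMap]

lemma bdry_cons (x : α) (l : List α) :
    bdry k (x :: l) = Finsupp.single l 1 - consMap k x (bdry k l) := rfl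

@[simp] lemma signMap_single (l : List α) :
    signMap k α (Finsupp.single l 1) = (-1 : ℤ) ^ (l.length + 1) • Finsupp.single l 1 := by
  simp [signMap, -Finsupp.smul_single]

@[simp] lemma dropNil_single (l : List α) :
    dropNil k α (Finsupp.single l 1) = if l = [] then 0 else Finsupp.single l 1 := by
  simp [dropNil]

@[simp] lemma coneMap_single (e : α) (l : List α) :
    coneMap k e (Finsupp.single l 1) = if l = [] then 0 else Finsupp.single (e :: l) 1 := by
  simp [coneMap]

@[simp] lemma augMap_single (l : List α) :
    augMap k α (Finsupp.single l 1) = if l.length = 1 then 1 else 0 := by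
  simp [augMap]

@[simp] lemma vertexMap_single (e : α) (l : List α) :
    vertexMap k e (Finsupp.single l 1) = if l.length = 1 then Finsupp.single [e] 1 else 0 := by
  simp [vertexMap]

lemma listHom_ext {A : Type*} [AddCommGroup A] [Module k A] {f g : (List α →₀ k) →ₗ[k] A}
    (h : ∀ l, f (Finsupp.single l 1) = g (Finsupp.single l 1)) : f = g :=
  Finsupp.lhom_ext' fun l => LinearMap.ext_ring (h l)

lemma eq_of_mem_supported {A : Type*} [AddCommGroup A] [Module k A]
    {f g : (List α →₀ k) →ₗ[k] A} {s : Set (List α)}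
    (h : ∀ l ∈ s, f (Finsupp.single l 1) = g (Finsupp.single l 1)) {z : List α →₀ k}
    (hz : z ∈ Finsupp.supported k k s) : f z = g z := by
  rw [Finsupp.supported_eq_span_single] at hz
  refine LinearMap.eqOn_span (s := Set.image (fun l => Finsupp.single l (1 : k)) s) ?_ hz
  rintro _ ⟨a, ha, rfl⟩
  exact h a ha

lemma bdryMap_consMap (x : α) (z : List α →₀ k) :
    bdryMap k α (consMap k x z) = z - consMap k x (bdryMap k α z) := by
  have : bdryMap k α ∘ₗ consMap k x = LinearMap.id - consMap k x ∘ₗ bdryMap k α :=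
    listHom_ext fun l => by simp [consMap_single, bdry_cons]
  exact LinearMap.congr_fun this z

lemma bdryMap_bdry (l : List α) : bdryMap k α (bdry k l) = 0 := by
  induction l with
  | nil => simp [bdry]
  | cons x l ih => simp [bdry_cons, bdryMap_consMap, ih]

lemma bdryMap_comp_bdryMap : bdryMap k α ∘ₗ bdryMap k α = 0 :=
  listHom_ext fun l => by simp [bdryMap_bdry]

lemma bdryMap_comp_lmapDomain {β : Type} (f : α → β) :
    bdryMap k β ∘ₗ Finsupp.lmapDomain k k (List.map f) =
      Finsupp.lmapDomain k k (List.map f) ∘ₗ bdryMap k α := by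
  refine listHom_ext fun l => ?_
  induction l with
  | nil => simp [bdry]
  | cons x l ih =>
    have hc : ∀ z, Finsupp.lmapDomain k k (List.map f) (consMap k x z) =
        consMap k (f x) (Finsupp.lmapDomain k k (List.map f) z) := fun z => by
      have : Finsupp.lmapDomain k k (List.map f) ∘ₗ consMap k x =
          consMap k (f x) ∘ₗ Finsupp.lmapDomain k k (List.map f) :=
        listHom_ext fun l => by simp [consMap_single]
      exact LinearMap.congr_fun this z
    simp only [LinearMap.comp_apply, bdryMap_single, bdry_cons, map_sub, hc] at ih ⊢
    rw [← ih]
    simp [bdry_cons]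

lemma consMap_mem_supported (x : α) {s t : Set (List α)} {z : List α →₀ k}
    (hz : z ∈ Finsupp.supported k k s) (hst : ∀ l ∈ s, x :: l ∈ t) :
    consMap k x z ∈ Finsupp.supported k k t := by
  have := Submodule.mem_map_of_mem (f := consMap k x) hz
  rw [consMap, Finsupp.lmapDomain_supported] at this
  exact Finsupp.supported_mono (by rintro _ ⟨l, hl, rfl⟩; exact hst l hl) this

lemma bdry_mem_supported_length (l : List α) :
    bdry k l ∈ Finsupp.supported k k {l' : List α | l'.length + 1 = l.length} := by
  induction l with
  | nil => exact Submodule.zero_mem _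
  | cons x l ih =>
    rw [bdry_cons]
    exact Submodule.sub_mem _ (Finsupp.single_mem_supported _ _ (by simp))
      (consMap_mem_supported x ih fun a ha => by simpa using ha)

lemma bdry_mem_supported_degenerate (l : List α) (hl : ¬ l.IsChain (· ≠ ·)) :
    bdry k l ∈ Finsupp.supported k k {l' : List α | ¬ l'.IsChain (· ≠ ·)} := by
  induction l with
  | nil => exact Submodule.zero_mem _
  | cons x l ih =>
    by_cases hc : l.IsChain (· ≠ ·)
    · match l with
      | [] => simp at hl
      | y :: l' =>
        obtain rfl : x = y := by
          by_contra hxy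
          exact hl (List.isChain_cons_cons.2 ⟨hxy, hc⟩)
        have : bdry k (x :: x :: l') = consMap k x (consMap k x (bdry k l')) := by
          simp [bdry_cons, consMap_single]
        rw [this]
        refine consMap_mem_supported x (s := {a | ∃ b, a = x :: b})
          (consMap_mem_supported x (s := Set.univ) (by simp) fun a _ => ⟨a, rfl⟩) ?_
        rintro _ ⟨b, rfl⟩
        simp
    · rw [bdry_cons]
      exact Submodule.sub_mem _ (Finsupp.single_mem_supported _ _ hc)
        (consMap_mem_supported x (ih hc) fun a ha h => ha h.tail)

lemma bdry_mem_supported (l : List α) :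
    bdry k l ∈ Finsupp.supported k k {l' : List α | l'.length + 1 = l.length ∧
      (¬ l.IsChain (· ≠ ·) → ¬ l'.IsChain (· ≠ ·))} := by
  by_cases hl : l.IsChain (· ≠ ·)
  · refine Finsupp.supported_mono ?_ (bdry_mem_supported_length l)
    exact fun a ha => ⟨ha, fun h => absurd hl h⟩
  · have := Submodule.mem_inf.2
      ⟨bdry_mem_supported_length (k := k) l, bdry_mem_supported_degenerate l hl⟩
    rw [← Finsupp.supported_inter] at this
    refine Finsupp.supported_mono ?_ this
    exact fun a ha => ⟨ha.1, fun _ => ha.2⟩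

lemma bdry_ofFn (n : ℕ) (x : Fin n → α) :
    bdry k (List.ofFn x) = ∑ i : Fin n, (-1 : ℤ) ^ (i : ℕ) •
      Finsupp.single ((List.ofFn x).eraseIdx i) 1 := by
  induction n with
  | zero => simp [bdry]
  | succ n ih =>
    rw [List.ofFn_succ, bdry_cons, ih, Fin.sum_univ_succ, map_sum, sub_eq_add_neg,
      ← Finset.sum_neg_distrib]
    congr 1
    · simp
    · refine Finset.sum_congr rfl fun i _ => ?_
      rw [map_zsmul, consMap_single, Fin.val_succ, pow_succ, mul_neg_one, neg_smul,
        List.eraseIdx_cons_succ]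

lemma bdryMap_comp_coneMap (e : α) :
    bdryMap k α ∘ₗ coneMap k e + coneMap k e ∘ₗ bdryMap k α = dropNil k α - vertexMap k e := by
  refine listHom_ext fun l => ?_
  match l with
  | [] => simp [bdry]
  | [x] => simp [bdry]
  | x :: y :: l =>
    have hb : coneMap k e (bdry k (x :: y :: l)) = consMap k e (bdry k (x :: y :: l)) :=
      eq_of_mem_supported
        (fun a (ha : a.length + 1 = (x :: y :: l).length) => by
          have : a ≠ [] := by rintro rfl; simp at ha
          simp [consMap_single, this])
        (bdry_mem_supported_length _)
    simp [hb, bdry_cons e]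

lemma augMap_comp_bdryMap : augMap k α ∘ₗ bdryMap k α = 0 := by
  refine listHom_ext fun l => ?_
  match l with
  | [] => simp [bdry]
  | [x] => simp [bdry]
  | [x, y] => simp [bdry]
  | x :: y :: z :: l =>
    have := eq_of_mem_supported (f := augMap k α) (g := 0)
      (fun a (ha : a.length + 1 = (x :: y :: z :: l).length) => by simp_all)
      (bdry_mem_supported_length (x :: y :: z :: l))
    simpa using this

lemma signMap_comp_coneMap (e : α) :
    signMap k α ∘ₗ coneMap k e = - (coneMap k e ∘ₗ signMap k α) :=
  listHom_ext fun l => by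
    by_cases h : l = [] <;> simp [h, pow_succ, -Finsupp.smul_single, -zsmul_eq_mul]

lemma signMap_comp_vertexMap (e : α) : signMap k α ∘ₗ vertexMap k e = vertexMap k e :=
  listHom_ext fun l => by
    by_cases h : l.length = 1 <;> simp [h, -Finsupp.smul_single]

lemma vertexMap_comp_signMap (e : α) : vertexMap k e ∘ₗ signMap k α = vertexMap k e :=
  listHom_ext fun l => by
    by_cases h : l.length = 1 <;> simp [h, -Finsupp.smul_single]

lemma bdryMap_comp_signMap : bdryMap k α ∘ₗ signMap k α = - (signMap k α ∘ₗ bdryMap k α) := by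
  have hs : ∀ (x : α) z, signMap k α (consMap k x z) = - consMap k x (signMap k α z) := by
    intro x z
    have : signMap k α ∘ₗ consMap k x = - (consMap k x ∘ₗ signMap k α) :=
      listHom_ext fun l => by simp [consMap_single, pow_succ]
    exact LinearMap.congr_fun this z
  refine listHom_ext fun l => ?_
  induction l with
  | nil => simp [bdry]
  | cons x l ih =>
    simp only [LinearMap.comp_apply, signMap_single, bdryMap_single, map_zsmul, bdry_cons,
      map_sub, LinearMap.neg_apply, hs] at ih ⊢
    rw [← neg_eq_iff_eq_neg.2 ih]
    simp only [pow_succ, mul_neg_one, neg_neg, List.length_cons, smul_sub, neg_smul, map_zsmul]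
    abel

lemma signMap_comp_lmapDomain {β : Type} (f : α → β) :
    signMap k β ∘ₗ Finsupp.lmapDomain k k (List.map f) =
      Finsupp.lmapDomain k k (List.map f) ∘ₗ signMap k α :=
  listHom_ext fun l => by simp

end ListChains

section PairChains

open TensorProduct

variable (k : Type) [CommRing k]

/-- The free module on pairs of tuples, as a tensor product. -/
abbrev PairChains (α β : Type) : Type := (List α →₀ k) ⊗[k] (List β →₀ k)

variable {α β : Type}

/-- The generator attached to a pair of tuples. -/
noncomputable def cell (l : List α) (m : List β) : PairChains k α β :=
  Finsupp.single l 1 ⊗ₜ Finsupp.single m 1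

variable {k}

lemma pairHom_ext {A : Type*} [AddCommGroup A] [Module k A] {f g : PairChains k α β →ₗ[k] A}
    (h : ∀ l m, f (cell k l m) = g (cell k l m)) : f = g :=
  TensorProduct.ext <| listHom_ext fun l => listHom_ext fun m => h l m

/-- The pairs of tuples which vanish in the normalized complex with `N` entries in total. -/
def IsBad (N : ℕ) (l : List α) (m : List β) : Prop :=
  l = [] ∨ m = [] ∨ l.length + m.length ≠ N ∨ ¬ l.IsChain (· ≠ ·) ∨ ¬ m.IsChain (· ≠ ·)

variable (k) in
/-- The span of the bad pairs. -/
noncomputable def badSpan (α β : Type) (N : ℕ) : Submodule k (PairChains k α β) :=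
  Submodule.span k {z | ∃ l m, IsBad N l m ∧ z = cell k l m}

lemma cell_mem_badSpan {N : ℕ} {l : List α} {m : List β} (h : IsBad N l m) :
    cell k l m ∈ badSpan k α β N :=
  Submodule.subset_span ⟨l, m, h, rfl⟩

lemma badSpan_le_comap {N : ℕ} {A : Type*} [AddCommGroup A] [Module k A]
    {f : PairChains k α β →ₗ[k] A} {p : Submodule k A}
    (h : ∀ l m, IsBad N l m → f (cell k l m) ∈ p) : badSpan k α β N ≤ p.comap f := by
  refine Submodule.span_le.2 ?_
  rintro _ ⟨l, m, hb, rfl⟩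
  exact h l m hb

lemma tmul_mem_badSpan {N : ℕ} {s : Set (List α)} {t : Set (List β)}
    {a : List α →₀ k} {b : List β →₀ k} (ha : a ∈ Finsupp.supported k k s)
    (hb : b ∈ Finsupp.supported k k t) (h : ∀ l ∈ s, ∀ m ∈ t, IsBad N l m) :
    a ⊗ₜ b ∈ badSpan k α β N := by
  rw [Finsupp.supported_eq_span_single] at ha hb
  have := Submodule.apply_mem_map₂ (TensorProduct.mk k _ _) ha hb
  rw [Submodule.map₂_span_span] at this
  refine Submodule.span_le.2 ?_ this
  rintro _ ⟨_, ⟨l, hl, rfl⟩, _, ⟨m, hm, rfl⟩, rfl⟩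
  exact cell_mem_badSpan (h l hl m hm)

lemma badSpan_eq_top {N : ℕ} (hN : N < 2) : badSpan k α β N = ⊤ := by
  refine Submodule.eq_top_iff'.2 fun z => ?_
  have hz : (Submodule.mkQ (badSpan k α β N)) = 0 := by
    refine pairHom_ext fun l m => (Submodule.Quotient.mk_eq_zero _).2 (cell_mem_badSpan ?_)
    by_cases hl : l = []
    · exact .inl hl
    by_cases hm : m = []
    · exact .inr (.inl hm)
    refine .inr (.inr (.inl ?_))
    have := List.length_pos_iff.2 hl
    have := List.length_pos_iff.2 hm
    omega
  exact (Submodule.Quotient.mk_eq_zero _).1 (LinearMap.congr_fun hz z)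

variable (k)

/-- The boundary in the first variable. -/
noncomputable def pairBdryLeft (α β : Type) : PairChains k α β →ₗ[k] PairChains k α β :=
  map (bdryMap k α) LinearMap.id

/-- The signed boundary in the second variable. -/
noncomputable def pairBdryRight (α β : Type) : PairChains k α β →ₗ[k] PairChains k α β :=
  map (signMap k α) (bdryMap k β)

/-- The total boundary. -/
noncomputable def pairBdry (α β : Type) : PairChains k α β →ₗ[k] PairChains k α β :=
  pairBdryLeft k α β + pairBdryRight k α β

/-- The contracting homotopy of the total complex. -/
noncomputable def pairCone (e : α) (e' : β) : PairChains k α β →ₗ[k] PairChains k α β :=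
  map (coneMap k e) LinearMap.id + map (vertexMap k e) (coneMap k e')

/-- The augmentation of the total complex. -/
noncomputable def pairAug (α β : Type) : PairChains k α β →ₗ[k] k :=
  LinearMap.mul' k k ∘ₗ map (augMap k α) (augMap k β)

variable {k}

lemma pairBdryLeft_cell (l : List α) (m : List β) :
    pairBdryLeft k α β (cell k l m) = bdry k l ⊗ₜ Finsupp.single m 1 := by
  simp [pairBdryLeft, cell]

lemma pairBdryRight_cell (l : List α) (m : List β) :
    pairBdryRight k α β (cell k l m) =
      (-1 : ℤ) ^ (l.length + 1) • (Finsupp.single l 1 ⊗ₜ[k] bdry k m) := by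
  simp [pairBdryRight, cell, -Finsupp.smul_single, smul_tmul']

lemma pairAug_cell (l : List α) (m : List β) :
    pairAug k α β (cell k l m) = if l.length = 1 ∧ m.length = 1 then 1 else 0 := by
  by_cases h : l.length = 1 <;> by_cases h' : m.length = 1 <;> simp [pairAug, cell, h, h']

lemma pairBdry_comp_pairBdry : pairBdry k α β ∘ₗ pairBdry k α β = 0 := by
  simp only [pairBdry, pairBdryLeft, pairBdryRight, LinearMap.add_comp, LinearMap.comp_add,
    ← map_comp, bdryMap_comp_bdryMap, bdryMap_comp_signMap, LinearMap.id_comp, LinearMap.comp_id,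
    map_zero_left, map_zero_right]
  ext
  simp [neg_tmul]

lemma pairBdry_mem_badSpan {N : ℕ} {z : PairChains k α β} (hz : z ∈ badSpan k α β (N + 1)) :
    pairBdry k α β z ∈ badSpan k α β N := by
  refine badSpan_le_comap (f := pairBdry k α β) (p := badSpan k α β N) (fun l m hb => ?_) hz
  refine Submodule.add_mem _ ?_ ?_
  · rw [pairBdryLeft_cell]
    refine tmul_mem_badSpan (bdry_mem_supported l)
      (Finsupp.single_mem_supported k 1 (Set.mem_singleton m)) ?_
    rintro l' ⟨h1, h2⟩ _ rfl
    rcases hb with rfl | h | h | h | h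
    · simp at h1
    · exact .inr (.inl h)
    · exact .inr (.inr (.inl (by omega)))
    · exact .inr (.inr (.inr (.inl (h2 h))))
    · exact .inr (.inr (.inr (.inr h)))
  · rw [pairBdryRight_cell]
    refine zsmul_mem (tmul_mem_badSpan
      (Finsupp.single_mem_supported k 1 (Set.mem_singleton l)) (bdry_mem_supported m) ?_) _
    rintro _ rfl m' ⟨h1, h2⟩
    rcases hb with h | rfl | h | h | h
    · exact .inl h
    · simp at h1
    · exact .inr (.inr (.inl (by omega)))
    · exact .inr (.inr (.inr (.inl h)))
    · exact .inr (.inr (.inr (.inr (h2 h))))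

lemma pairCone_mem_badSpan (e : α) (e' : β) {N : ℕ} {z : PairChains k α β}
    (hz : z ∈ badSpan k α β N) : pairCone k e e' z ∈ badSpan k α β (N + 1) := by
  refine badSpan_le_comap (f := pairCone k e e') (p := badSpan k α β (N + 1)) (fun l m hb => ?_) hz
  refine Submodule.add_mem _ ?_ ?_
  · by_cases hl : l = []
    · simp [cell, hl]
    · have : map (coneMap k e) LinearMap.id (cell k l m) = cell k (e :: l) m := by simp [cell, hl]
      rw [this]
      refine cell_mem_badSpan ?_
      rcases hb with h | h | h | h | h
      · exact absurd h hl
      · exact .inr (.inl h)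
      · exact .inr (.inr (.inl (by simp; omega)))
      · exact .inr (.inr (.inr (.inl fun hc => h hc.tail)))
      · exact .inr (.inr (.inr (.inr h)))
  · by_cases hl : l.length = 1
    · by_cases hm : m = []
      · simp [cell, hm]
      · have : map (vertexMap k e) (coneMap k e') (cell k l m) = cell k [e] (e' :: m) := by
          simp [cell, hl, hm]
        rw [this]
        refine cell_mem_badSpan ?_
        obtain ⟨x, rfl⟩ := List.length_eq_one_iff.1 hl
        rcases hb with h | h | h | h | h
        · simp at h
        · exact absurd h hm
        · refine .inr (.inr (.inl ?_))
          simp at h ⊢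
          omega
        · simp at h
        · exact .inr (.inr (.inr (.inr fun hc => h hc.tail)))
    · simp [cell, hl]

lemma pairCone_homotopy (e : α) (e' : β) (N : ℕ) (z : PairChains k α β) :
    pairBdry k α β (pairCone k e e' z) + pairCone k e e' (pairBdry k α β z) -
      (z - pairAug k α β z • cell k [e] [e']) ∈ badSpan k α β N := by
  have key : pairBdry k α β ∘ₗ pairCone k e e' + pairCone k e e' ∘ₗ pairBdry k α β =
      map (dropNil k α - vertexMap k e) LinearMap.id +
      map (vertexMap k e) (dropNil k β - vertexMap k e') +
      map (bdryMap k α ∘ₗ vertexMap k e) (coneMap k e') := by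
    have hv : vertexMap k e ∘ₗ bdryMap k α = 0 := by
      rw [vertexMap, LinearMap.comp_assoc, augMap_comp_bdryMap, LinearMap.comp_zero]
    rw [← bdryMap_comp_coneMap, ← bdryMap_comp_coneMap]
    simp only [pairBdry, pairBdryLeft, pairBdryRight, pairCone, LinearMap.add_comp,
      LinearMap.comp_add, ← map_comp, LinearMap.id_comp, LinearMap.comp_id, hv,
      signMap_comp_coneMap, signMap_comp_vertexMap, vertexMap_comp_signMap, map_add_left,
      map_add_right, map_zero_left]
    have hneg : map (-(coneMap k e ∘ₗ signMap k α)) (bdryMap k β) =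
        - map (coneMap k e ∘ₗ signMap k α) (bdryMap k β) := by
      ext; simp [neg_tmul]
    rw [hneg]
    abel
  have key' := LinearMap.congr_fun key z
  simp only [LinearMap.add_apply, LinearMap.comp_apply] at key'
  rw [key', ← Submodule.Quotient.mk_eq_zero]
  have : (badSpan k α β N).mkQ ∘ₗ (map (dropNil k α - vertexMap k e) LinearMap.id +
      map (vertexMap k e) (dropNil k β - vertexMap k e') +
      map (bdryMap k α ∘ₗ vertexMap k e) (coneMap k e') -
      (LinearMap.id - LinearMap.toSpanSingleton k _ (cell k [e] [e']) ∘ₗ pairAug k α β)) = 0 := by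
    refine pairHom_ext fun l m => (Submodule.Quotient.mk_eq_zero _).2 ?_
    by_cases hl0 : l = []
    · simpa [hl0, cell, pairAug] using cell_mem_badSpan (.inl rfl)
    by_cases hm0 : m = []
    · by_cases hl : l.length = 1
      · have h1 : cell k [e] m ∈ badSpan k α β N := cell_mem_badSpan (.inr (.inl hm0))
        simpa [cell, hl, hl0, hm0, pairAug, sub_tmul] using h1
      · simp [cell, hl, hl0, pairAug]
    by_cases hl : l.length = 1
    · have h1 : cell k [] (e' :: m) ∈ badSpan k α β N := cell_mem_badSpan (.inl rfl)
      by_cases hm : m.length = 1 <;>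
        simpa [cell, hl, hl0, hm0, hm, pairAug, sub_tmul, tmul_sub, bdry] using h1
    · simp [cell, hl, hl0, pairAug]
  exact LinearMap.congr_fun this z

end PairChains

section Resolution

open TensorProduct CategoryTheory

variable {k : Type} [CommRing k]

/-- The linear map on pairs of tuples with prescribed values on generators. -/
noncomputable def pairLift {α β A : Type} [AddCommGroup A] [Module k A]
    (f : List α → List β → A) : PairChains k α β →ₗ[k] A :=
  TensorProduct.lift (Finsupp.lift _ k _ fun l => Finsupp.lift _ k _ (f l))

@[simp] lemma pairLift_cell {α β A : Type} [AddCommGroup A] [Module k A]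
    (f : List α → List β → A) (l : List α) (m : List β) :
    pairLift f (cell k l m) = f l m := by
  simp [pairLift, cell]

variable {G K ρ} {S : Type} [Group S] (θ : S ≃* K ⋊[ρ] G)

/-- The action of the semidirect product on `G` through its quotient. -/
def actG (s : S) (x : G) : G := (θ s).right * x

/-- The affine action of the semidirect product on `K`. -/
def actK (s : S) (y : K) : K := (θ s).left * ρ (θ s).right y

lemma actG_injective (s : S) : Function.Injective (actG θ s) := mul_right_injective _

lemma actK_injective (s : S) : Function.Injective (actK θ s) :=
  (mul_right_injective _).comp (ρ (θ s).right).injective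

@[simp] lemma actG_one : actG θ 1 = id := by ext; simp [actG]

@[simp] lemma actK_one : actK θ 1 = id := by ext; simp [actK]

@[simp] lemma actG_mul (s t : S) : actG θ (s * t) = actG θ s ∘ actG θ t := by
  ext; simp [actG, mul_assoc]

@[simp] lemma actK_mul (s t : S) : actK θ (s * t) = actK θ s ∘ actK θ t := by
  ext; simp [actK, mul_assoc]

lemma isBad_map (s : S) {N : ℕ} {l : List G} {m : List K} :
    IsBad N (l.map (actG θ s)) (m.map (actK θ s)) ↔ IsBad N l m := by
  simp [IsBad, List.isChain_map, (actG_injective θ s).eq_iff, (actK_injective θ s).eq_iff]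

variable (k) in
/-- The diagonal representation on pairs of tuples. -/
noncomputable def pairRep : Representation k S (PairChains k G K) where
  toFun s := map (Finsupp.lmapDomain k k (List.map (actG θ s)))
    (Finsupp.lmapDomain k k (List.map (actK θ s)))
  map_one' := pairHom_ext fun l m => by simp [cell]
  map_mul' s t := pairHom_ext fun l m => by simp [cell]

@[simp] lemma pairRep_cell (s : S) (l : List G) (m : List K) :
    pairRep k θ s (cell k l m) = cell k (l.map (actG θ s)) (m.map (actK θ s)) := by
  simp [pairRep, cell]

lemma pairBdry_comp_pairRep (s : S) :
    pairBdry k G K ∘ₗ pairRep k θ s = pairRep k θ s ∘ₗ pairBdry k G K := by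
  simp only [pairRep, MonoidHom.coe_mk, OneHom.coe_mk, pairBdry, pairBdryLeft, pairBdryRight,
    LinearMap.add_comp, LinearMap.comp_add, ← map_comp, bdryMap_comp_lmapDomain,
    signMap_comp_lmapDomain, LinearMap.id_comp, LinearMap.comp_id]

variable (k) in
/-- The degree `n` part of the normalized double complex of tuples. -/
noncomputable abbrev quotRep (n : ℕ) : Rep k S :=
  Rep.of ((pairRep k θ).quotient (badSpan k G K (n + 2)) fun s =>
    badSpan_le_comap fun l m h => by
      rw [pairRep_cell]; exact cell_mem_badSpan ((isBad_map θ s).2 h))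

/-- A morphism out of the normalized double complex of tuples is determined by an equivariant
function vanishing on the bad pairs. -/
noncomputable def quotHom {n : ℕ} {A : Rep k S} (f : PairChains k G K →ₗ[k] A)
    (hbad : ∀ l m, IsBad (n + 2) l m → f (cell k l m) = 0)
    (heq : ∀ s l m, f (cell k (l.map (actG θ s)) (m.map (actK θ s))) = A.ρ s (f (cell k l m))) :
    quotRep k θ n ⟶ A :=
  Rep.ofHom (σ := A.ρ) ⟨Submodule.liftQ _ f
    (fun z hz => by
      simpa using badSpan_le_comap (f := f) (p := ⊥) (fun l m h => by simpa using hbad l m h) hz),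
    fun s => Submodule.linearMap_qext _ (pairHom_ext fun l m => by
      simpa using heq s l m)⟩

lemma quotHom_mk {n : ℕ} {A : Rep k S} (f : PairChains k G K →ₗ[k] A)
    (hbad : ∀ l m, IsBad (n + 2) l m → f (cell k l m) = 0)
    (heq : ∀ s l m, f (cell k (l.map (actG θ s)) (m.map (actK θ s))) = A.ρ s (f (cell k l m)))
    (z : PairChains k G K) :
    (quotHom θ f hbad heq).hom (Submodule.Quotient.mk z) = f z := rfl

variable {θ} in
lemma quotRep_hom_ext {n : ℕ} {A : Rep k S} {f g : quotRep k θ n ⟶ A}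
    (h : ∀ l m, f.hom (Submodule.Quotient.mk (cell k l m)) =
      g.hom (Submodule.Quotient.mk (cell k l m))) : f = g :=
  Rep.hom_ext <| Representation.IntertwiningMap.ext <| Submodule.linearMap_qext _ <|
    pairHom_ext fun l m => h l m

variable {θ} in
lemma hom_bad {n : ℕ} {A : Rep k S} (f : quotRep k θ n ⟶ A) {l : List G} {m : List K}
    (h : IsBad (n + 2) l m) : f.hom (Submodule.Quotient.mk (cell k l m)) = 0 := by
  have : (Submodule.Quotient.mk (cell k l m) : PairChains k G K ⧸ badSpan k G K (n + 2)) = 0 :=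
    (Submodule.Quotient.mk_eq_zero _).2 (cell_mem_badSpan h)
  exact (congrArg f.hom this).trans (map_zero f.hom)

variable (k) in
/-- The differential of the normalized double complex of tuples. -/
noncomputable def quotD (n : ℕ) : quotRep k θ (n + 1) ⟶ quotRep k θ n :=
  quotHom θ ((badSpan k G K (n + 2)).mkQ ∘ₗ pairBdry k G K)
    (fun l m h => by
      simpa using pairBdry_mem_badSpan (cell_mem_badSpan h))
    (fun s l m => by
      have := LinearMap.congr_fun (pairBdry_comp_pairRep (k := k) θ s) (cell k l m)
      simp only [LinearMap.comp_apply, pairRep_cell] at this ⊢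
      rw [this]
      rfl)

lemma quotD_mk (n : ℕ) (z : PairChains k G K) :
    (quotD k θ n).hom (Submodule.Quotient.mk z) = Submodule.Quotient.mk (pairBdry k G K z) := rfl

variable (k) in
/-- The normalized double complex of tuples. -/
noncomputable def quotComplex : ChainComplex (Rep k S) ℕ :=
  ChainComplex.of (quotRep k θ) (quotD k θ) fun n => quotRep_hom_ext fun l m => by
    rw [Rep.hom_comp, Representation.IntertwiningMap.comp_apply, quotD_mk, quotD_mk]
    have := LinearMap.congr_fun (pairBdry_comp_pairBdry (k := k) (α := G) (β := K)) (cell k l m)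
    rw [LinearMap.comp_apply] at this
    rw [this]
    rfl

variable (k) in
/-- The augmentation of the normalized double complex of tuples. -/
noncomputable def quotAug : quotRep k θ 0 ⟶ Rep.trivial k S k :=
  quotHom θ (A := Rep.trivial k S k) (pairAug k G K)
    (fun l m h => by
      rw [pairAug_cell, if_neg]
      rintro ⟨h1, h2⟩
      obtain ⟨x, rfl⟩ := List.length_eq_one_iff.1 h1
      obtain ⟨y, rfl⟩ := List.length_eq_one_iff.1 h2
      simp [IsBad] at h)
    (fun s l m => by simp [pairAug_cell])

lemma quotAug_mk (z : PairChains k G K) :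
    (quotAug k θ).hom (Submodule.Quotient.mk z) = pairAug k G K z := rfl

instance quotRep_projective (n : ℕ) : Projective (quotRep k θ n) where
  factors {E X} f e he := by
    classical
    have hs := (Rep.epi_iff_surjective e).1 he
    choose r hr using hs
    let base : List G → List K → S := fun l m => θ.symm ⟨m.headD 1, l.headD 1⟩
    have hbase : ∀ (s : S) l m, l ≠ [] → m ≠ [] →
        base (l.map (actG θ s)) (m.map (actK θ s)) = s * base l m := by
      intro s l m hl hm
      obtain ⟨x, l, rfl⟩ := List.exists_cons_of_ne_nil hl
      obtain ⟨y, m, rfl⟩ := List.exists_cons_of_ne_nil hm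
      apply θ.injective
      simp only [base, map_mul, MulEquiv.apply_symm_apply, List.map_cons, List.headD_cons]
      ext <;> simp [actG, actK]
    let v : List G → List K → E := fun l m => if IsBad (n + 2) l m then 0 else
      E.ρ (base l m) (r (f.hom (Submodule.Quotient.mk
        (cell k (l.map (actG θ (base l m)⁻¹)) (m.map (actK θ (base l m)⁻¹))))))
    refine ⟨quotHom θ (pairLift v) (fun l m h => by simp [v, h]) (fun s l m => ?_),
      quotRep_hom_ext fun l m => ?_⟩
    · by_cases h : IsBad (n + 2) l m
      · simp [v, h, isBad_map]
      · have hl : l ≠ [] := fun hl => h (.inl hl)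
        have hm : m ≠ [] := fun hm => h (.inr (.inl hm))
        simp [v, h, isBad_map, hbase s l m hl hm, ← actG_mul, ← actK_mul,
          mul_assoc]
    · rw [Rep.hom_comp, Representation.IntertwiningMap.comp_apply, quotHom_mk, pairLift_cell]
      by_cases h : IsBad (n + 2) l m
      · rw [hom_bad f h]
        simp [v, h]
      · simp only [v, h, if_false]
        rw [Rep.hom_comm_apply, hr, ← Rep.hom_comm_apply]
        congr 1
        change Submodule.Quotient.mk (pairRep k θ _ _) = _
        rw [pairRep_cell, List.map_map, List.map_map, ← actG_mul, ← actK_mul]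
        simp

end Resolution

section ProjectiveResolution

open TensorProduct CategoryTheory

variable {k : Type} [CommRing k] {G K ρ} {S : Type} [Group S] (θ : S ≃* K ⋊[ρ] G)

lemma quotComplex_d (n : ℕ) : (quotComplex k θ).d (n + 1) n = quotD k θ n :=
  ChainComplex.of_d _ _ _

lemma quotD_comp_quotAug : quotD k θ 0 ≫ quotAug k θ = 0 := quotRep_hom_ext fun l m => by
  rw [Rep.hom_comp, Representation.IntertwiningMap.comp_apply, quotD_mk, quotAug_mk]
  have h : pairAug k G K ∘ₗ pairBdry k G K = 0 := by
    simp only [pairAug, pairBdry, pairBdryLeft, pairBdryRight, LinearMap.comp_assoc,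
      LinearMap.comp_add, ← map_comp, augMap_comp_bdryMap, map_zero_left, map_zero_right,
      LinearMap.comp_zero, add_zero]
  exact LinearMap.congr_fun h (cell k l m)

variable (k) in
/-- The augmentation as a morphism of complexes. -/
noncomputable def quotπ :
    quotComplex k θ ⟶ (ChainComplex.single₀ (Rep k S)).obj (Rep.trivial k S k) :=
  ((quotComplex k θ).toSingle₀Equiv _).symm
    ⟨quotAug k θ, by rw [quotComplex_d]; exact quotD_comp_quotAug θ⟩

lemma mk_pairBdry_pairCone {N : ℕ} {z : PairChains k G K}
    (hz : pairAug k G K z • cell k [1] [1] ∈ badSpan k G K N)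
    (hx : pairCone k 1 1 (pairBdry k G K z) ∈ badSpan k G K N) :
    (Submodule.Quotient.mk (pairBdry k G K (pairCone k 1 1 z)) :
      PairChains k G K ⧸ badSpan k G K N) = Submodule.Quotient.mk z := by
  have := Submodule.sub_mem _
    (Submodule.sub_mem _ (pairCone_homotopy (1 : G) (1 : K) N z) hx) hz
  rw [Submodule.Quotient.eq]
  convert this using 1
  abel

lemma exists_quotD_succ {n : ℕ} (y : quotRep k θ (n + 1)) (hy : (quotD k θ n).hom y = 0) :
    ∃ x, (quotD k θ (n + 1)).hom x = y := by
  obtain ⟨z, rfl⟩ := Submodule.Quotient.mk_surjective _ y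
  refine ⟨Submodule.Quotient.mk (pairCone k 1 1 z), mk_pairBdry_pairCone ?_ ?_⟩
  · exact Submodule.smul_mem _ _ (cell_mem_badSpan (.inr (.inr (.inl (by simp)))))
  · exact pairCone_mem_badSpan 1 1 ((Submodule.Quotient.mk_eq_zero _).1 hy)

lemma exists_quotD_zero (y : quotRep k θ 0) (hy : (quotAug k θ).hom y = 0) :
    ∃ x, (quotD k θ 0).hom x = y := by
  obtain ⟨z, rfl⟩ := Submodule.Quotient.mk_surjective _ y
  refine ⟨Submodule.Quotient.mk (pairCone k 1 1 z), mk_pairBdry_pairCone ?_ ?_⟩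
  · rw [quotAug_mk] at hy
    rw [hy, zero_smul]
    exact Submodule.zero_mem _
  · refine pairCone_mem_badSpan 1 1 ?_
    rw [badSpan_eq_top (by simp)]
    trivial

lemma quotAug_surjective : Function.Surjective (quotAug k θ).hom := fun x =>
  ⟨Submodule.Quotient.mk (x • cell k [1] [1]), by
    rw [quotAug_mk, map_smul, pairAug_cell, if_pos (by simp), smul_eq_mul, mul_one]⟩

lemma quotπ_f_zero : (quotπ k θ).f 0 = quotAug k θ :=
  ChainComplex.toSingle₀Equiv_symm_apply_f_zero _ _

lemma quotπ_quasiIso : QuasiIso (quotπ k θ) where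
  quasiIsoAt m := by
    cases m with
    | zero =>
      rw [ChainComplex.quasiIsoAt₀_iff, ShortComplex.quasiIso_iff_of_zeros' _ rfl rfl rfl]
      constructor
      · apply (forget₂ _ (ModuleCat k)).reflects_exact_of_faithful
        rw [ShortComplex.moduleCat_exact_iff]
        intro y hy
        have hy' : (quotAug k θ).hom y = 0 := by
          rw [← quotπ_f_zero]
          exact hy
        obtain ⟨x, hx⟩ := exists_quotD_zero θ y hy'
        refine ⟨x, ?_⟩
        rw [← hx, ← quotComplex_d]
        rfl
      · rw [Rep.epi_iff_surjective]
        intro x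
        obtain ⟨y, hy⟩ := quotAug_surjective θ x
        refine ⟨y, Eq.trans ?_ hy⟩
        rw [← quotπ_f_zero]
        rfl
    | succ m =>
      rw [quasiIsoAt_iff_exactAt' (hL := ChainComplex.exactAt_succ_single_obj ..),
          HomologicalComplex.exactAt_iff' _ (m + 2) (m + 1) m (by simp) (by simp)]
      apply (forget₂ _ (ModuleCat k)).reflects_exact_of_faithful
      rw [ShortComplex.moduleCat_exact_iff]
      intro y hy
      have hy' : (quotD k θ m).hom y = 0 := by
        rw [← quotComplex_d]
        exact hy
      obtain ⟨x, hx⟩ := exists_quotD_succ θ y hy'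
      refine ⟨x, ?_⟩
      rw [← hx, ← quotComplex_d]
      rfl

variable (k) in
/-- The normalized double complex of tuples is a projective resolution of `k`. -/
noncomputable def quotResolution : ProjectiveResolution (Rep.trivial k S k) where
  complex := quotComplex k θ
  projective n := quotRep_projective θ n
  π := quotπ k θ
  quasiIso := quotπ_quasiIso θ

end ProjectiveResolution

section BarCells

open TensorProduct

variable {k : Type} [CommRing k] {G K} {M}

lemma eraseIdx_ofFn {α : Type} {n : ℕ} (x : Fin (n + 1) → α) (i : Fin (n + 1)) :
    (List.ofFn x).eraseIdx i = List.ofFn (x ∘ i.succAbove) := by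
  have hi := i.isLt
  refine List.ext_getElem (by simp [List.length_eraseIdx]; omega) fun j h1 h2 => ?_
  simp only [List.length_ofFn] at h2
  rw [List.getElem_eraseIdx]
  split_ifs with h
  · simp only [List.getElem_ofFn, Function.comp_apply]
    rw [Fin.succAbove_of_castSucc_lt _ _ (by simpa [Fin.lt_def] using h)]
    rfl
  · simp only [List.getElem_ofFn, Function.comp_apply]
    rw [Fin.succAbove_of_le_castSucc _ _ (by simpa [Fin.le_def] using h)]
    rfl

lemma map_partialProd {A B : Type} [Monoid A] [Monoid B] (f : A →* B) {n : ℕ} (x : Fin n → A)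
    (j : Fin (n + 1)) : f (Fin.partialProd x j) = Fin.partialProd (f ∘ x) j := by
  induction j using Fin.induction with
  | zero => simp
  | succ i ih => rw [Fin.partialProd_succ, Fin.partialProd_succ, map_mul, ih]; rfl

lemma partialProd_castSucc_eq_succ {A : Type} [Monoid A] {n : ℕ} {x : Fin n → A} {i : Fin n}
    (h : x i = 1) : Fin.partialProd x i.castSucc = Fin.partialProd x i.succ := by
  rw [Fin.partialProd_succ, h, mul_one]

lemma mergeD_eq_contractNth {α : Type} [Mul α] {n : ℕ} (i : Fin (n + 1)) (h : Fin (n + 1) → α) :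
    mergeD (i : ℕ) h = i.contractNth (· * ·) h := rfl

/-- The vertices in `K` of the pair of simplices attached to a pair of tuples of group elements. -/
def barK {p q : ℕ} (g : Fin p → G) (κ : Fin q → K) (j : Fin (q + 1)) : K :=
  ρ (Fin.partialProd g (Fin.last p)) (Fin.partialProd κ j)

variable (k) in
/-- The pair of simplices attached to a pair of tuples of group elements. -/
noncomputable def barCell {p q : ℕ} (x : (Fin p → G) × (Fin q → K)) : PairChains k G K :=
  cell k (List.ofFn (Fin.partialProd x.1)) (List.ofFn (barK ρ x.1 x.2))

variable [Module k M]

/-- The cochain in bidegree `(p, q)` underlying a linear map on pairs of tuples. -/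
noncomputable def bicochain (φ : PairChains k G K →ₗ[k] M) (p q : ℕ) : Cpq G K M p q :=
  fun x => φ (barCell ρ k x)

lemma castC_bicochain (φ : PairChains k G K →ₗ[k] M) {p q p' q' : ℕ} (h1 : p = p')
    (h2 : q = q') : castC G K M h1 h2 (bicochain ρ φ p q) = bicochain ρ φ p' q' := by
  subst h1 h2; rfl

lemma bicochain_pairBdryLeft_apply (φ : PairChains k G K →ₗ[k] M) {p q : ℕ}
    (x : (Fin p → G) × (Fin q → K)) :
    bicochain ρ (φ ∘ₗ pairBdryLeft k G K) p q x =
      ∑ i : Fin (p + 1), (-1 : ℤ) ^ (i : ℕ) •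
        φ (cell k (List.ofFn (Fin.partialProd x.1 ∘ i.succAbove))
          (List.ofFn (barK ρ x.1 x.2))) := by
  rw [bicochain, LinearMap.comp_apply, barCell, pairBdryLeft_cell, bdry_ofFn,
    TensorProduct.sum_tmul, map_sum]
  refine Finset.sum_congr rfl fun i _ => ?_
  rw [← TensorProduct.smul_tmul', map_zsmul, eraseIdx_ofFn]
  rfl

lemma bicochain_pairBdryRight_apply (φ : PairChains k G K →ₗ[k] M) {p q : ℕ}
    (x : (Fin p → G) × (Fin q → K)) :
    bicochain ρ (φ ∘ₗ pairBdryRight k G K) p q x =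
      (-1 : ℤ) ^ p • ∑ i : Fin (q + 1), (-1 : ℤ) ^ (i : ℕ) •
        φ (cell k (List.ofFn (Fin.partialProd x.1))
          (List.ofFn (barK ρ x.1 x.2 ∘ i.succAbove))) := by
  rw [bicochain, LinearMap.comp_apply, barCell, pairBdryRight_cell, bdry_ofFn,
    TensorProduct.tmul_sum, map_zsmul, map_sum, List.length_ofFn]
  congr 1
  · ring
  refine Finset.sum_congr rfl fun i _ => ?_
  rw [TensorProduct.tmul_smul, map_zsmul, eraseIdx_ofFn]
  rfl

lemma barK_succ {p q : ℕ} (g : Fin p → G) (κ : Fin (q + 1) → K) (j : Fin (q + 1)) :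
    barK ρ g κ j.succ = ρ (Fin.partialProd g (Fin.last p)) (κ 0) * barK ρ g (Fin.tail κ) j := by
  rw [barK, Fin.partialProd_succ', map_mul, barK]

lemma barK_tail {p q : ℕ} (g : Fin (p + 1) → G) (κ : Fin q → K) (j : Fin (q + 1)) :
    barK ρ g κ j = ρ (g 0) (barK ρ (Fin.tail g) κ j) := by
  rw [barK, ← Fin.succ_last, Fin.partialProd_succ', map_mul, barK]
  rfl

lemma barK_init {p q : ℕ} (g : Fin (p + 1) → G) (κ : Fin q → K) (j : Fin (q + 1)) :
    barK ρ g κ j = barK ρ (Fin.init g) (fun j => ρ (g (Fin.last p)) (κ j)) j := by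
  rw [barK, ← Fin.succ_last, Fin.partialProd_succ, map_mul, barK, Fin.partialProd_init]
  have := map_partialProd (ρ (g (Fin.last p))).toMonoidHom κ j
  simp only [MulEquiv.toMonoidHom_eq_coe, MonoidHom.coe_coe] at this
  rw [MulAut.mul_apply, this]
  rfl

variable {ρ} {S : Type} [Group S] (θ : S ≃* K ⋊[ρ] G)

lemma dGfun_bicochain {φ : PairChains k G K →ₗ[k] M}
    (hφ : ∀ s l m, φ (cell k (l.map (actG θ s)) (m.map (actK θ s))) = φ (cell k l m)) (p q : ℕ) :
    dGfun G K ρ M (bicochain ρ φ p q) = bicochain ρ (φ ∘ₗ pairBdryLeft k G K) (p + 1) q := by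
  funext ⟨g, κ⟩
  rw [bicochain_pairBdryLeft_apply, Fin.sum_univ_succ, Fin.sum_univ_castSucc, ← add_assoc, dGfun,
    Finset.sum_range]
  congr 1
  · congr 1
    · simp only [Fin.val_zero, pow_zero, one_smul, bicochain, barCell]
      rw [← hφ (θ.symm ⟨1, g 0⟩), List.map_ofFn, List.map_ofFn]
      congr 3
      · funext j
        simp [actG, Fin.partialProd_succ', Fin.tail_def]
      · funext j
        simp [actK, barK_tail ρ g, Fin.tail_def]
    · refine Finset.sum_congr rfl fun i _ => ?_
      simp only [Fin.val_succ, Fin.val_castSucc]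
      congr 1
      have h := Fin.partialProd_contractNth g i.castSucc
      have hm := mergeD_eq_contractNth i.castSucc g
      rw [Fin.val_castSucc] at hm
      simp only [bicochain, barCell, hm, h]
      congr 3
      funext j
      simp only [barK, h, Function.comp_apply]
      rw [Fin.succAbove_ne_last_last]
      simp [Fin.ext_iff, i.isLt.ne]
  · simp only [Fin.val_succ, Fin.val_last, bicochain, barCell]
    congr 4
    · funext j
      rw [Function.comp_apply, Fin.succ_last, Fin.succAbove_last, ← Fin.partialProd_init]
      rfl
    · funext j
      rw [barK_init ρ g]
      rfl

lemma dKfun_bicochain {φ : PairChains k G K →ₗ[k] M}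
    (hφ : ∀ s l m, φ (cell k (l.map (actG θ s)) (m.map (actK θ s))) = φ (cell k l m)) (p q : ℕ) :
    (-1 : ℤ) ^ p • dKfun G K M (bicochain ρ φ p q) =
      bicochain ρ (φ ∘ₗ pairBdryRight k G K) p (q + 1) := by
  funext ⟨g, κ⟩
  rw [bicochain_pairBdryRight_apply, Fin.sum_univ_succ, Fin.sum_univ_castSucc, ← add_assoc,
    Pi.smul_apply, dKfun, Finset.sum_range]
  congr 2
  · congr 1
    · simp only [Fin.val_zero, pow_zero, one_smul, bicochain, barCell]
      rw [← hφ (θ.symm ⟨ρ (Fin.partialProd g (Fin.last p)) (κ 0), 1⟩), List.map_ofFn, List.map_ofFn]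
      congr 3
      · funext j
        simp [actG]
      · funext j
        simp [actK, barK_succ, Fin.tail_def]
    · refine Finset.sum_congr rfl fun i _ => ?_
      simp only [Fin.val_succ, Fin.val_castSucc]
      congr 1
      have h := Fin.partialProd_contractNth κ i.castSucc
      have hm := mergeD_eq_contractNth i.castSucc κ
      rw [Fin.val_castSucc] at hm
      simp only [bicochain, barCell, hm]
      congr 3
      funext j
      simp only [barK, h, Function.comp_apply]
  · simp only [Fin.val_succ, Fin.val_last, bicochain, barCell]
    congr 4
    funext j
    simp only [barK, Function.comp_apply]
    rw [Fin.succ_last, Fin.succAbove_last, ← Fin.partialProd_init]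
    rfl

lemma bicochain_pairBdryLeft_zero {φ : PairChains k G K →ₗ[k] M}
    (hφ : ∀ m, φ (cell k [] m) = 0) (q : ℕ) :
    bicochain ρ (φ ∘ₗ pairBdryLeft k G K) 0 q = 0 := by
  funext x
  rw [bicochain_pairBdryLeft_apply]
  simp [hφ]

lemma bicochain_pairBdryRight_zero {φ : PairChains k G K →ₗ[k] M}
    (hφ : ∀ l, φ (cell k l []) = 0) (p : ℕ) :
    bicochain ρ (φ ∘ₗ pairBdryRight k G K) p 0 = 0 := by
  funext x
  rw [bicochain_pairBdryRight_apply]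
  simp [hφ]

/-- The total cochain of degree `n` underlying a linear map on pairs of tuples. -/
noncomputable def totCochain (ρ : G →* MulAut K) (n : ℕ) (φ : PairChains k G K →ₗ[k] M) :
    TotC G K M n :=
  fun p => bicochain ρ φ p (n - p)

lemma totd_totCochain {φ : PairChains k G K →ₗ[k] M}
    (hφ : ∀ s l m, φ (cell k (l.map (actG θ s)) (m.map (actK θ s))) = φ (cell k l m))
    (hl : ∀ m, φ (cell k [] m) = 0) (hm : ∀ l, φ (cell k l []) = 0) (n : ℕ) :
    totd G K ρ M n (totCochain ρ n φ) = totCochain ρ (n + 1) (φ ∘ₗ pairBdry k G K) := by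
  funext p
  have hadd : bicochain ρ (φ ∘ₗ pairBdry k G K) p (n + 1 - p) =
      bicochain ρ (φ ∘ₗ pairBdryLeft k G K) p (n + 1 - p) +
        bicochain ρ (φ ∘ₗ pairBdryRight k G K) p (n + 1 - p) := by
    funext x
    simp [bicochain, pairBdry]
  change totdFun G K ρ M (totCochain ρ n φ) p = bicochain ρ (φ ∘ₗ pairBdry k G K) p (n + 1 - p)
  rw [hadd, totdFun]
  obtain ⟨p, hp⟩ := p
  congr 1
  · rcases p with _ | p
    · rw [dif_neg (by simp), bicochain_pairBdryLeft_zero hl]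
    · rw [dif_pos (by simp)]
      change castC G K M _ _ (dGfun G K ρ M (bicochain ρ φ p (n - p))) = _
      rw [dGfun_bicochain θ hφ, castC_bicochain]
  · by_cases h : p ≤ n
    · rw [dif_pos (by simpa using h)]
      change _ • castC G K M _ _ (dKfun G K M (bicochain ρ φ p (n - p))) = _
      rw [← castC_bicochain ρ (φ ∘ₗ pairBdryRight k G K) rfl
        (show n - p + 1 = n + 1 - p by omega), ← dKfun_bicochain θ hφ]
      rfl
    · rw [dif_neg (by simpa using h), smul_zero]
      obtain rfl : p = n + 1 := by omega
      rw [← castC_bicochain ρ (φ ∘ₗ pairBdryRight k G K) rfl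
        (show 0 = n + 1 - (n + 1) by omega), bicochain_pairBdryRight_zero hm]
      rfl

lemma totCochain_mem_nrmC {n : ℕ} {φ : PairChains k G K →ₗ[k] M}
    (hφ : ∀ l m, IsBad (n + 2) l m → φ (cell k l m) = 0) :
    totCochain ρ n φ ∈ nrmC G K M n := by
  rintro p - ⟨g, κ⟩ (⟨i, hi⟩ | ⟨i, hi⟩)
  · refine hφ _ _ (.inr (.inr (.inr (.inl fun h => ?_))))
    have := List.isChain_iff_getElem.1 h i (by simp)
    simp only [List.getElem_ofFn] at this
    exact this (partialProd_castSucc_eq_succ hi)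
  · refine hφ _ _ (.inr (.inr (.inr (.inr fun h => ?_))))
    have := List.isChain_iff_getElem.1 h i (by simp)
    simp only [List.getElem_ofFn] at this
    exact this (congrArg (ρ _) (partialProd_castSucc_eq_succ hi))

end BarCells

section Differences

open CategoryTheory

variable {k : Type} [CommRing k] {G K} {M} [Module k M]

lemma exists_eq_ofFn {α : Type} {l : List α} (h : l ≠ []) :
    ∃ (p : ℕ) (x : Fin (p + 1) → α), l = List.ofFn x := by
  obtain ⟨a, t, rfl⟩ := List.exists_cons_of_ne_nil h
  exact ⟨t.length, (a :: t).get, (List.ofFn_get _).symm⟩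

/-- The pair of tuples of group elements attached to the vertices of a pair of simplices. -/
def differences {p q : ℕ} (x : Fin (p + 1) → G) (y : Fin (q + 1) → K) :
    (Fin p → G) × (Fin q → K) :=
  (fun i => (x i.castSucc)⁻¹ * x i.succ,
    fun j => (ρ (x (Fin.last p)))⁻¹ ((y j.castSucc)⁻¹ * y j.succ))

lemma differences_partialProd {p q : ℕ} (g : Fin p → G) (κ : Fin q → K) :
    differences ρ (Fin.partialProd g) (barK ρ g κ) = (g, κ) := by
  refine Prod.ext (funext fun i => ?_) (funext fun j => ?_)
  · exact Fin.partialProd_right_inv g i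
  · simp only [differences, barK, ← map_inv, ← map_mul]
    rw [Fin.partialProd_right_inv]
    simp

variable {ρ} {S : Type} [Group S] (θ : S ≃* K ⋊[ρ] G)

lemma differences_act {p q : ℕ} (s : S) (x : Fin (p + 1) → G) (y : Fin (q + 1) → K) :
    differences ρ (actG θ s ∘ x) (actK θ s ∘ y) = differences ρ x y := by
  simp only [differences, actG, actK, Function.comp_apply]
  refine Prod.ext (funext fun i => ?_) (funext fun j => ?_)
  · simp [mul_assoc]
  · have h : ∀ a : K, (ρ ((θ s).right * x (Fin.last p)))⁻¹ (ρ (θ s).right a) =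
        (ρ (x (Fin.last p)))⁻¹ a := fun a => by
      rw [map_mul, mul_inv_rev, MulAut.mul_apply, MulAut.inv_apply_self]
    refine Eq.trans ?_ (h _)
    simp [mul_assoc]

lemma ofFn_differences_fst {p q : ℕ} (x : Fin (p + 1) → G) (y : Fin (q + 1) → K) :
    (List.ofFn (Fin.partialProd (differences ρ x y).1)).map (actG θ (θ.symm ⟨y 0, x 0⟩)) =
      List.ofFn x := by
  rw [List.map_ofFn]
  congr 1
  simpa [differences, actG, Function.comp_def, funext_iff] using
    congrFun (Fin.partialProd_left_inv x)

lemma ofFn_differences_snd {p q : ℕ} (x : Fin (p + 1) → G) (y : Fin (q + 1) → K) :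
    (List.ofFn (barK ρ (differences ρ x y).1 (differences ρ x y).2)).map
      (actK θ (θ.symm ⟨y 0, x 0⟩)) = List.ofFn y := by
  rw [List.map_ofFn]
  congr 1
  funext j
  have hx := congrFun (Fin.partialProd_left_inv x) (Fin.last p)
  have hy := congrFun (Fin.partialProd_left_inv y) j
  have hm := map_partialProd (ρ (x (Fin.last p))).toMonoidHom (differences ρ x y).2 j
  simp only [Pi.smul_apply, smul_eq_mul] at hx hy
  simp only [Function.comp_apply, actK, MulEquiv.apply_symm_apply, barK]
  rw [← MulAut.mul_apply, ← map_mul, show x 0 * Fin.partialProd (differences ρ x y).1 (Fin.last p) =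
    x (Fin.last p) from hx]
  refine Eq.trans ?_ hy
  congr 1
  refine hm.trans ?_
  congr 1
  funext i
  simp [differences]

lemma eq_zero_of_totCochain_eq_zero {n : ℕ} {φ : PairChains k G K →ₗ[k] M}
    (hφ : ∀ s l m, φ (cell k (l.map (actG θ s)) (m.map (actK θ s))) = φ (cell k l m))
    (hbad : ∀ l m, IsBad (n + 2) l m → φ (cell k l m) = 0) (h0 : totCochain ρ n φ = 0)
    (l : List G) (m : List K) : φ (cell k l m) = 0 := by
  by_cases h : IsBad (n + 2) l m
  · exact hbad l m h
  simp only [IsBad, not_or, not_not] at h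
  obtain ⟨hl, hm, hlen, -⟩ := h
  obtain ⟨p, x, rfl⟩ := exists_eq_ofFn hl
  obtain ⟨q, y, rfl⟩ := exists_eq_ofFn hm
  simp only [List.length_ofFn] at hlen
  rw [← ofFn_differences_fst θ x y, ← ofFn_differences_snd θ x y, hφ]
  have hp : bicochain ρ φ p (n - p) = 0 := congrFun h0 ⟨p, by omega⟩
  have := castC_bicochain ρ φ (rfl : p = p) (show n - p = q by omega)
  rw [hp] at this
  exact (congrFun this (differences ρ x y)).symm

/-- Evaluation of a component of a total cochain on the beginnings of two sequences. -/
def evalSeq {n : ℕ} (F : TotC G K M n) (p : ℕ) (a : ℕ → G) (b : ℕ → K) : M :=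
  if h : p < n + 1 then F ⟨p, h⟩ (fun i => a i, fun j => b j) else 0

/-- The homogeneous function on pairs of tuples attached to a total cochain. -/
def homogenize (ρ : G →* MulAut K) {n : ℕ} (F : TotC G K M n) (l : List G) (m : List K) : M :=
  if l.length + m.length = n + 2 ∧ l ≠ [] ∧ m ≠ [] then
    evalSeq F (l.length - 1) (fun i => (l.getD i 1)⁻¹ * l.getD (i + 1) 1)
      (fun j => (ρ (l.getD (l.length - 1) 1))⁻¹ ((m.getD j 1)⁻¹ * m.getD (j + 1) 1))
  else 0

lemma homogenize_ofFn {n p q : ℕ} (F : TotC G K M n) (x : Fin (p + 1) → G) (y : Fin (q + 1) → K)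
    (h : p + q = n) : homogenize ρ F (List.ofFn x) (List.ofFn y) =
      castC G K M rfl (by simp; omega) (F ⟨p, by omega⟩) (differences ρ x y) := by
  rw [homogenize, if_pos ⟨by simp; omega, by simp, by simp⟩]
  simp only [List.length_ofFn, Nat.add_sub_cancel]
  rw [evalSeq, dif_pos (by omega)]
  refine congrArg (F ⟨p, by omega⟩) (Prod.ext (funext fun i => ?_) (funext fun j => ?_))
  · have hi : (i : ℕ) < p := i.isLt
    simp only [differences]
    rw [List.getD_eq_getElem _ _ (by rw [List.length_ofFn]; omega),
      List.getD_eq_getElem _ _ (by rw [List.length_ofFn]; omega)]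
    simp only [List.getElem_ofFn]
    rfl
  · have hj : (j : ℕ) < n - p := j.isLt
    simp only [differences]
    rw [List.getD_eq_getElem _ _ (by simp), List.getD_eq_getElem _ _ (by simp; omega),
      List.getD_eq_getElem _ _ (by simp; omega)]
    simp only [List.getElem_ofFn]
    rfl

lemma homogenize_of_isBad {n : ℕ} {F : TotC G K M n} (hF : F ∈ nrmC G K M n) {l : List G}
    {m : List K} (h : IsBad (n + 2) l m) : homogenize ρ F l m = 0 := by
  by_cases hc : l.length + m.length = n + 2 ∧ l ≠ [] ∧ m ≠ []
  swap
  · rw [homogenize, if_neg hc]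
  obtain ⟨hlen, hl, hm⟩ := hc
  simp only [IsBad, hl, hm, hlen, not_true, ne_eq, false_or] at h
  obtain ⟨p, x, rfl⟩ := exists_eq_ofFn hl
  obtain ⟨q, y, rfl⟩ := exists_eq_ofFn hm
  simp only [List.length_ofFn] at hlen
  rw [homogenize_ofFn F x y (by omega)]
  refine hF ⟨p, by omega⟩ trivial _ (h.imp (fun h => ?_) (fun h => ?_))
  · rw [List.isChain_iff_getElem] at h
    push Not at h
    obtain ⟨i, hi, h⟩ := h
    simp only [List.length_ofFn] at hi
    simp only [List.getElem_ofFn] at h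
    exact ⟨⟨i, by simp; omega⟩, inv_mul_eq_one.2 h⟩
  · rw [List.isChain_iff_getElem] at h
    push Not at h
    obtain ⟨i, hi, h⟩ := h
    simp only [List.length_ofFn] at hi
    simp only [List.getElem_ofFn] at h
    exact ⟨⟨i, by simp; omega⟩, (congrArg ((ρ (x (Fin.last p)))⁻¹ : MulAut K)
      (inv_mul_eq_one.2 h)).trans (map_one _)⟩

lemma homogenize_map {n : ℕ} (F : TotC G K M n) (s : S) (l : List G) (m : List K) :
    homogenize ρ F (l.map (actG θ s)) (m.map (actK θ s)) = homogenize ρ F l m := by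
  by_cases hc : l.length + m.length = n + 2 ∧ l ≠ [] ∧ m ≠ []
  swap
  · rw [homogenize, homogenize, if_neg hc, if_neg (by simpa using hc)]
  obtain ⟨hlen, hl, hm⟩ := hc
  obtain ⟨p, x, rfl⟩ := exists_eq_ofFn hl
  obtain ⟨q, y, rfl⟩ := exists_eq_ofFn hm
  simp only [List.length_ofFn] at hlen
  rw [List.map_ofFn, List.map_ofFn, homogenize_ofFn F _ _ (by omega),
    homogenize_ofFn F _ _ (by omega), differences_act]

lemma totCochain_homogenize {n : ℕ} (F : TotC G K M n) :
    totCochain ρ n (pairLift (k := k) (homogenize ρ F)) = F := by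
  funext p ⟨g, κ⟩
  rw [totCochain, bicochain, barCell, pairLift_cell, homogenize_ofFn F _ _ (by omega),
    differences_partialProd]
  rfl

/-- The total cochain attached to a morphism from the normalized double complex of tuples. -/
noncomputable def homToTot (n : ℕ) : (quotRep k θ n ⟶ Rep.trivial k S M) →+ TotC G K M n where
  toFun Φ := totCochain ρ n (Φ.hom.toLinearMap ∘ₗ (badSpan k G K (n + 2)).mkQ)
  map_zero' := rfl
  map_add' _ _ := rfl

lemma hom_invariant {n : ℕ} (Φ : quotRep k θ n ⟶ Rep.trivial k S M) (s : S) (l : List G)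
    (m : List K) :
    (Φ.hom.toLinearMap ∘ₗ (badSpan k G K (n + 2)).mkQ)
        (cell k (l.map (actG θ s)) (m.map (actK θ s))) =
      (Φ.hom.toLinearMap ∘ₗ (badSpan k G K (n + 2)).mkQ) (cell k l m) := by
  rw [← pairRep_cell]
  exact Rep.hom_comm_apply Φ s (Submodule.Quotient.mk (cell k l m))

lemma homToTot_injective (n : ℕ) : Function.Injective (homToTot (k := k) (M := M) θ n) :=
  (injective_iff_map_eq_zero _).2 fun Φ h => quotRep_hom_ext fun l m =>
    eq_zero_of_totCochain_eq_zero θ (hom_invariant θ Φ) (fun _ _ hb => hom_bad Φ hb) h l m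

lemma range_homToTot (n : ℕ) : (homToTot (k := k) (M := M) θ n).range = nrmC G K M n := by
  refine le_antisymm ?_ fun F hF => ?_
  · rintro _ ⟨Φ, rfl⟩
    exact totCochain_mem_nrmC (φ := Φ.hom.toLinearMap ∘ₗ (badSpan k G K (n + 2)).mkQ)
      fun _ _ hb => hom_bad Φ hb
  · exact ⟨quotHom θ (A := Rep.trivial k S M) (pairLift (homogenize ρ F))
      (fun l m h => by rw [pairLift_cell, homogenize_of_isBad hF h])
      (fun s l m => by rw [pairLift_cell, pairLift_cell, homogenize_map]; rfl),
      totCochain_homogenize F⟩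

lemma homToTot_quotD_comp {n : ℕ} (Φ : quotRep k θ n ⟶ Rep.trivial k S M) :
    homToTot θ (n + 1) (quotD k θ n ≫ Φ) = totd G K ρ M n (homToTot θ n Φ) :=
  (totd_totCochain θ (hom_invariant θ Φ) (fun _ => hom_bad Φ (.inl rfl))
    (fun _ => hom_bad Φ (.inr (.inl rfl))) n).symm

end Differences

section HomologyComparison

open CategoryTheory

variable {k : Type} [CommRing k]

/-- The homology of a short complex of modules, computed inside an ambient abelian group. -/
noncomputable def homologyEquivOfInjective (T : ShortComplex (ModuleCat.{0} k)) {A : Type}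
    [AddCommGroup A] (e : T.X₂ →+ A) (he : Function.Injective e) (Z B : AddSubgroup A)
    (hZ : ∀ a, a ∈ Z ↔ ∃ x, T.g x = 0 ∧ e x = a) (hB : ∀ a, a ∈ B ↔ ∃ x, e (T.f x) = a) :
    T.homology ≃+ Z ⧸ B.addSubgroupOf Z :=
  let e' : LinearMap.ker T.g.hom ≃+ Z := AddEquiv.ofBijective
    ((e.comp (LinearMap.ker T.g.hom).subtype.toAddMonoidHom).codRestrict Z
      fun x => (hZ _).2 ⟨x, x.2, rfl⟩)
    ⟨fun x y h => Subtype.ext (he (congrArg Subtype.val h)), fun z => by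
      obtain ⟨x, hx, hxz⟩ := (hZ _).1 z.2
      exact ⟨⟨x, hx⟩, Subtype.ext hxz⟩⟩
  T.moduleCatHomologyIso.toLinearEquiv.toAddEquiv.trans <|
    QuotientAddGroup.congr (LinearMap.range T.moduleCatToCycles).toAddSubgroup
      (B.addSubgroupOf Z) e' (by
      ext z
      simp only [AddSubgroup.mem_map, AddSubgroup.mem_addSubgroupOf, hB]
      constructor
      · rintro ⟨_, ⟨x, rfl⟩, rfl⟩
        exact ⟨x, rfl⟩
      · rintro ⟨x, hx⟩
        exact ⟨_, ⟨x, rfl⟩, Subtype.ext hx⟩)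

/-- The homology of a cochain complex of modules, computed inside an ambient abelian group. -/
noncomputable def cochainHomologyEquiv (C : CochainComplex (ModuleCat.{0} k) ℕ) {A : Type}
    [AddCommGroup A] (n : ℕ) (e : C.X n →+ A) (he : Function.Injective e) (Z B : AddSubgroup A)
    (hZ : ∀ a, a ∈ Z ↔ ∃ x, C.d n (n + 1) x = 0 ∧ e x = a)
    (hB : ∀ a, a ∈ B ↔ ∃ j x, e (C.d j n x) = a) :
    C.homology n ≃+ Z ⧸ B.addSubgroupOf Z :=
  homologyEquivOfInjective (C.sc n) e he Z B
    (fun a => (hZ a).trans (by rw [← CochainComplex.next ℕ n]; rfl))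
    (fun a => (hB a).trans ⟨fun ⟨j, x, hx⟩ => by
      by_cases hj : (ComplexShape.up ℕ).Rel j n
      · obtain rfl := (ComplexShape.up ℕ).prev_eq' hj
        exact ⟨x, hx⟩
      · rw [C.shape _ _ hj] at hx
        exact ⟨0, (congrArg e (map_zero (C.sc n).f.hom)).trans hx⟩,
      fun ⟨x, hx⟩ => ⟨_, x, hx⟩⟩)

end HomologyComparison

section Comparison

open CategoryTheory

variable {k : Type} [CommRing k] {G K ρ} [Module k M] {S : Type} [Group S] (θ : S ≃* K ⋊[ρ] G)

variable {M} in
lemma linearYonedaObj_d_apply {n : ℕ} (Φ : quotRep k θ n ⟶ Rep.trivial k S M) :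
    ((quotResolution k θ).complex.linearYonedaObj k (Rep.trivial k S M)).d n (n + 1) Φ =
      quotD k θ n ≫ Φ :=
  congrArg (· ≫ Φ) (quotComplex_d θ n)

lemma mem_ZC_iff {n : ℕ} (F : TotC G K M n) : F ∈ ZC G K ρ M n ↔
    ∃ Φ : quotRep k θ n ⟶ Rep.trivial k S M, quotD k θ n ≫ Φ = 0 ∧ homToTot θ n Φ = F := by
  constructor
  · rintro ⟨hF, hZ⟩
    rw [SetLike.mem_coe, ← range_homToTot (k := k) θ] at hF
    obtain ⟨Φ, rfl⟩ := hF
    refine ⟨Φ, homToTot_injective θ _ ?_, rfl⟩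
    rw [homToTot_quotD_comp, map_zero]
    exact hZ
  · rintro ⟨Φ, hΦ, rfl⟩
    refine ⟨?_, ?_⟩
    · rw [SetLike.mem_coe, ← range_homToTot (k := k) θ]
      exact ⟨Φ, rfl⟩
    · exact (homToTot_quotD_comp θ Φ).symm.trans (by rw [hΦ, map_zero])

lemma mem_BC_succ_iff {n : ℕ} (F : TotC G K M (n + 1)) : F ∈ BC G K ρ M (n + 1) ↔
    ∃ Φ : quotRep k θ n ⟶ Rep.trivial k S M, homToTot θ (n + 1) (quotD k θ n ≫ Φ) = F := by
  rw [BC, ← range_homToTot (k := k) θ]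
  simp only [AddSubgroup.mem_map, AddMonoidHom.mem_range, exists_exists_eq_and,
    homToTot_quotD_comp]

/-- The cohomology of a group isomorphic to a semidirect product is computed by the total complex
of the double bar complex. -/
noncomputable def groupCohomologyEquivHC (n : ℕ) :
    groupCohomology (Rep.trivial k S M) n ≃+ HC G K ρ M n :=
  (groupCohomologyIso (Rep.trivial k S M) n (quotResolution k θ)).toLinearEquiv.toAddEquiv.trans <|
    cochainHomologyEquiv _ n (homToTot (k := k) (M := M) θ n) (homToTot_injective θ n) _ _
      (fun F => (mem_ZC_iff (k := k) M θ F).trans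
        (exists_congr fun Φ => by rw [linearYonedaObj_d_apply]; rfl))
      (fun F => by
        have hshape : ∀ j, j + 1 ≠ n → ∀ x, homToTot (k := k) (M := M) θ n
            (((quotResolution k θ).complex.linearYonedaObj k (Rep.trivial k S M)).d j n x) = 0 := by
          intro j hj x
          rw [HomologicalComplex.shape _ _ _ hj]
          exact map_zero (homToTot (k := k) (M := M) θ n)
        constructor
        · intro hF
          rcases n with _ | n
          · exact ⟨0, 0, (hshape 0 (by simp) 0).trans hF.symm⟩
          · obtain ⟨Φ, rfl⟩ := (mem_BC_succ_iff (k := k) M θ F).1 hF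
            exact ⟨n, Φ, congrArg _ (linearYonedaObj_d_apply θ Φ)⟩
        · rintro ⟨j, x, rfl⟩
          by_cases hj : j + 1 = n
          · subst hj
            exact (mem_BC_succ_iff (k := k) M θ _).2
              ⟨x, congrArg _ (linearYonedaObj_d_apply θ x).symm⟩
          · exact (hshape j hj x).symm ▸ zero_mem _)

end Comparison

section Subquotients

/-- Subquotients of isomorphic abelian groups are isomorphic. -/
noncomputable def subquotientCongr {A A' : Type} [AddCommGroup A] [AddCommGroup A'] (e : A ≃+ A')
    {Z B : AddSubgroup A} {Z' B' : AddSubgroup A'} (hZ : ∀ a, e a ∈ Z' ↔ a ∈ Z)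
    (hB : ∀ a, e a ∈ B' ↔ a ∈ B) :
    Z ⧸ B.addSubgroupOf Z ≃+ Z' ⧸ B'.addSubgroupOf Z' :=
  have hZ' : Z.map e.toAddMonoidHom = Z' := by
    ext a
    obtain ⟨a, rfl⟩ := e.surjective a
    simp [hZ]
  QuotientAddGroup.congr _ _ ((e.addSubgroupMap Z).trans (AddEquiv.addSubgroupCongr hZ')) (by
    ext z
    simp only [AddSubgroup.mem_map, AddSubgroup.mem_addSubgroupOf]
    constructor
    · rintro ⟨a, ha, rfl⟩
      exact (hB _).2 ha
    · intro hz
      obtain ⟨a, ha⟩ := e.surjective z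
      exact ⟨⟨a, (hZ a).1 (ha ▸ z.2)⟩, (hB a).1 (ha ▸ hz), Subtype.ext ha⟩)

/-- The subquotient of a product by a product is the product of the subquotients. -/
noncomputable def subquotientProd {A A' : Type} [AddCommGroup A] [AddCommGroup A']
    (Z B : AddSubgroup A) (Z' B' : AddSubgroup A') :
    (Z.prod Z') ⧸ (B.prod B').addSubgroupOf (Z.prod Z') ≃+
      (Z ⧸ B.addSubgroupOf Z) × (Z' ⧸ B'.addSubgroupOf Z') :=
  let ψ : Z.prod Z' →+ (Z ⧸ B.addSubgroupOf Z) × (Z' ⧸ B'.addSubgroupOf Z') :=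
    ((QuotientAddGroup.mk' _).prodMap (QuotientAddGroup.mk' _)).comp
      (AddSubgroup.prodEquiv Z Z').toAddMonoidHom
  have hψ : ψ.ker = (B.prod B').addSubgroupOf (Z.prod Z') := by
    ext z
    rw [AddMonoidHom.mem_ker, Prod.ext_iff]
    exact and_congr (QuotientAddGroup.eq_zero_iff _) (QuotientAddGroup.eq_zero_iff _)
  (QuotientAddGroup.quotientAddEquivOfEq hψ.symm).trans <|
    QuotientAddGroup.quotientKerEquivOfSurjective ψ <|
      ((QuotientAddGroup.mk'_surjective _).prodMap (QuotientAddGroup.mk'_surjective _)).comp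
        (AddSubgroup.prodEquiv Z Z').surjective

end Subquotients

section Splitting

lemma dKfun_of_eq_zero {p q : ℕ} (hq : q = 0) (F : Cpq G K M p q) : dKfun G K M F = 0 := by
  subst hq
  funext x
  simp only [dKfun, Finset.range_zero, Finset.sum_empty, add_zero, zero_add, pow_one, neg_smul,
    one_smul, Pi.zero_apply]
  rw [← sub_eq_add_neg, sub_eq_zero]
  congr 2
  exact Subsingleton.elim _ _

lemma castC_dGfun {p q p' q' : ℕ} (h1 : p = p') (h2 : q = q') (h1' : p + 1 = p' + 1)
    (F : Cpq G K M p q) :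
    dGfun G K ρ M (castC G K M h1 h2 F) = castC G K M h1' h2 (dGfun G K ρ M F) := by
  subst h1 h2
  rfl

lemma splitMap_of_lt {n : ℕ} (ac : TotA G K M n × Cpq G K M n 0) {p : ℕ} (hp : p < n + 1)
    (h : p < n) : splitMap G K M n ac ⟨p, hp⟩ = ac.1 ⟨p, h⟩ := dif_pos h

lemma splitMap_last {n : ℕ} (ac : TotA G K M n × Cpq G K M n 0) (hp : n < n + 1) :
    splitMap G K M n ac ⟨n, hp⟩ = castC G K M rfl (by simp) ac.2 := dif_neg (lt_irrefl n)

lemma splitMap_add (n : ℕ) (x y : TotA G K M n × Cpq G K M n 0) :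
    splitMap G K M n (x + y) = splitMap G K M n x + splitMap G K M n y := by
  funext ⟨p, hp⟩
  rcases Nat.lt_succ_iff_lt_or_eq.1 hp with h | rfl
  · simp only [Pi.add_apply, splitMap_of_lt G K M _ hp h, Prod.fst_add]
  · simp only [Pi.add_apply, splitMap_last, Prod.snd_add, castC_add]

lemma splitMap_bijective (n : ℕ) : Function.Bijective (splitMap G K M n) := by
  constructor
  · intro x y h
    refine Prod.ext (funext fun p => ?_) ?_
    · have := congrFun h ⟨p, p.isLt.trans (Nat.lt_succ_self n)⟩
      rwa [splitMap_of_lt G K M _ _ p.isLt, splitMap_of_lt G K M _ _ p.isLt] at this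
    · have := congrFun h ⟨n, Nat.lt_succ_self n⟩
      rw [splitMap_last, splitMap_last] at this
      have := congrArg (castC G K M rfl (Nat.sub_self n)) this
      exact this
  · intro F
    refine ⟨(fun p => F ⟨p, p.isLt.trans (Nat.lt_succ_self n)⟩,
      castC G K M rfl (Nat.sub_self n) (F ⟨n, Nat.lt_succ_self n⟩)), funext fun ⟨p, hp⟩ => ?_⟩
    rcases Nat.lt_succ_iff_lt_or_eq.1 hp with h | rfl
    · rw [splitMap_of_lt G K M _ hp h]
    · rw [splitMap_last]
      rfl

lemma splitMap_totdAFun_dGfun (n : ℕ) (a : TotA G K M n) (c : Cpq G K M n 0) :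
    splitMap G K M (n + 1) (totdAFun G K ρ M a, dGfun G K ρ M c) =
      totdFun G K ρ M (splitMap G K M n (a, c)) := by
  funext ⟨p, hp⟩
  rcases Nat.lt_succ_iff_lt_or_eq.1 hp with h | rfl
  · rw [splitMap_of_lt G K M _ hp h]
    simp only [totdAFun, totdFun]
    congr 1
    · rcases p with _ | p
      · rw [dif_neg (by simp), dif_neg (by simp)]
      · rw [dif_pos (by simp), dif_pos (by simp)]
        congr 2
        exact (splitMap_of_lt G K M (a, c) _ (by simpa using h)).symm
    · congr 1
      rw [dif_pos (show p ≤ n by omega)]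
      by_cases hpn : p < n
      · rw [dif_pos hpn]
        congr 2
        exact (splitMap_of_lt G K M (a, c) _ hpn).symm
      · rw [dif_neg hpn]
        obtain rfl : p = n := by omega
        change 0 = castC G K M _ _ (dKfun G K M _)
        rw [dKfun_of_eq_zero G K M (Nat.sub_self p)]
        rfl
  · rw [splitMap_last, totdFun, dif_pos (by simp), dif_neg (by simp), smul_zero, add_zero]
    change _ = castC G K M _ _ (dGfun G K ρ M (splitMap G K M n (a, c) ⟨n, _⟩))
    rw [splitMap_last, castC_dGfun G K ρ M _ _ rfl]
    rfl

lemma castC_mem_nrm_iff {p q p' q' : ℕ} (h1 : p = p') (h2 : q = q') (F : Cpq G K M p q) :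
    castC G K M h1 h2 F ∈ nrm G K M p' q' ↔ F ∈ nrm G K M p q := by
  subst h1 h2
  rfl

lemma splitMap_mem_nrmC_iff (n : ℕ) (a : TotA G K M n) (c : Cpq G K M n 0) :
    splitMap G K M n (a, c) ∈ nrmC G K M n ↔ (a ∈ nrmA G K M n ∧ c ∈ nrm G K M n 0) := by
  constructor
  · refine fun h => ⟨fun p _ => ?_, ?_⟩
    · have := h ⟨p, p.isLt.trans (Nat.lt_succ_self n)⟩ trivial
      rwa [splitMap_of_lt G K M _ _ p.isLt] at this
    · have := h ⟨n, Nat.lt_succ_self n⟩ trivial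
      rw [splitMap_last] at this
      exact (castC_mem_nrm_iff G K M _ _ c).1 this
  · rintro ⟨ha, hc⟩ ⟨p, hp⟩ -
    rcases Nat.lt_succ_iff_lt_or_eq.1 hp with h | rfl
    · rw [splitMap_of_lt G K M _ hp h]
      exact ha ⟨p, h⟩ trivial
    · rw [splitMap_last]
      exact (castC_mem_nrm_iff G K M _ _ c).2 hc

/-- Normalized cocycles of the zeroth row. -/
def ZRow (n : ℕ) : AddSubgroup (Cpq G K M n 0) := nrm G K M n 0 ⊓ (dGhom G K ρ M n 0).ker

/-- Normalized coboundaries of the zeroth row. -/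
def BRow : ∀ n : ℕ, AddSubgroup (Cpq G K M n 0)
  | 0 => ⊥
  | n + 1 => AddSubgroup.map (dGhom G K ρ M n 0) (nrm G K M n 0)

/-- The cohomology of the zeroth row. -/
abbrev HRow (n : ℕ) :=
  ZRow G K ρ M n ⧸ (BRow G K ρ M n).addSubgroupOf (ZRow G K ρ M n)

/-- The splitting map as an additive equivalence. -/
noncomputable def splitEquiv (n : ℕ) : TotA G K M n × Cpq G K M n 0 ≃+ TotC G K M n :=
  AddEquiv.ofBijective (AddMonoidHom.mk' (splitMap G K M n) (splitMap_add G K M n))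
    (splitMap_bijective G K M n)

lemma splitEquiv_mem_ZC_iff (n : ℕ) (x : TotA G K M n × Cpq G K M n 0) :
    splitEquiv G K M n x ∈ ZC G K ρ M n ↔ x ∈ (ZA G K ρ M n).prod (ZRow G K ρ M n) := by
  obtain ⟨a, c⟩ := x
  have hd : totdFun G K ρ M (splitMap G K M n (a, c)) = 0 ↔
      totdAFun G K ρ M a = 0 ∧ dGfun G K ρ M c = 0 := by
    rw [← splitMap_totdAFun_dGfun]
    exact (splitEquiv G K M (n + 1)).map_eq_zero_iff.trans Prod.mk_eq_zero
  exact (and_congr (splitMap_mem_nrmC_iff G K M n a c) hd).trans and_and_and_comm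

lemma splitEquiv_mem_BC_iff (n : ℕ) (x : TotA G K M n × Cpq G K M n 0) :
    splitEquiv G K M n x ∈ BC G K ρ M n ↔ x ∈ (BA G K ρ M n).prod (BRow G K ρ M n) := by
  rcases n with _ | n
  · exact ((splitEquiv G K M 0).map_eq_zero_iff (x := x)).trans Prod.ext_iff
  · obtain ⟨a, c⟩ := x
    constructor
    · rintro ⟨F, hF, h⟩
      obtain ⟨⟨b, d⟩, rfl⟩ := (splitMap_bijective G K M n).surjective F
      obtain ⟨hb, hd⟩ := (splitMap_mem_nrmC_iff G K M n b d).1 hF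
      have h' := (splitMap_bijective G K M (n + 1)).injective
        ((splitMap_totdAFun_dGfun G K ρ M n b d).trans h)
      exact ⟨⟨b, hb, congrArg Prod.fst h'⟩, ⟨d, hd, congrArg Prod.snd h'⟩⟩
    · rintro ⟨⟨b, hb, hab⟩, ⟨d, hd, hcd⟩⟩
      exact ⟨splitMap G K M n (b, d), (splitMap_mem_nrmC_iff G K M n b d).2 ⟨hb, hd⟩,
        (splitMap_totdAFun_dGfun G K ρ M n b d).symm.trans
          (congrArg (splitMap G K M (n + 1)) (Prod.ext hab hcd))⟩

/-- The splitting of the total cohomology. -/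
noncomputable def HCEquiv (n : ℕ) : HC G K ρ M n ≃+ HA G K ρ M n × HRow G K ρ M n :=
  (subquotientCongr (splitEquiv G K M n) (splitEquiv_mem_ZC_iff G K ρ M n)
    (splitEquiv_mem_BC_iff G K ρ M n)).symm.trans (subquotientProd _ _ _ _)

end Splitting

section ZerothRow

lemma subsingleton_HA_unit (ρ' : G →* MulAut Unit) (n : ℕ) : Subsingleton (HA G Unit ρ' M n) := by
  have hz : ∀ z : ZA G Unit ρ' M n, z = 0 := fun z => Subtype.ext <| funext fun p => funext fun x =>
    z.2.1 p trivial x (.inr ⟨⟨0, Nat.sub_pos_of_lt p.isLt⟩, rfl⟩)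
  have : Subsingleton (ZA G Unit ρ' M n) := ⟨fun a b => (hz a).trans (hz b).symm⟩
  exact (QuotientAddGroup.mk_surjective (s := (BA G Unit ρ' M n).addSubgroupOf _)).subsingleton

variable {G K} in
/-- The zeroth row does not depend on the normal factor. -/
def rowEquiv (n : ℕ) : Cpq G Unit M n 0 ≃+ Cpq G K M n 0 where
  toFun F x := F (x.1, Fin.elim0)
  invFun F x := F (x.1, Fin.elim0)
  left_inv F := funext fun _ => congrArg F (Prod.ext rfl (Subsingleton.elim _ _))
  right_inv F := funext fun _ => congrArg F (Prod.ext rfl (Subsingleton.elim _ _))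
  map_add' _ _ := rfl

lemma rowEquiv_dGfun (ρ' : G →* MulAut Unit) {n : ℕ} (F : Cpq G Unit M n 0) :
    rowEquiv (K := K) M (n + 1) (dGfun G Unit ρ' M F) = dGfun G K ρ M (rowEquiv M n F) := by
  funext x
  simp only [rowEquiv, AddEquiv.coe_mk, Equiv.coe_fn_mk, dGfun]

lemma rowEquiv_mem_nrm_iff {n : ℕ} (F : Cpq G Unit M n 0) :
    rowEquiv (K := K) M n F ∈ nrm G K M n 0 ↔ F ∈ nrm G Unit M n 0 := by
  constructor
  · rintro h x (hx | ⟨i, -⟩)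
    · have := h (x.1, Fin.elim0) (.inl hx)
      refine Eq.trans (congrArg F (Prod.ext rfl (Subsingleton.elim _ _))) this
    · exact i.elim0
  · rintro h x (hx | ⟨i, -⟩)
    · exact h _ (.inl hx)
    · exact i.elim0

lemma rowEquiv_mem_ZRow_iff (ρ' : G →* MulAut Unit) {n : ℕ} (F : Cpq G Unit M n 0) :
    rowEquiv M n F ∈ ZRow G K ρ M n ↔ F ∈ ZRow G Unit ρ' M n := by
  refine and_congr (rowEquiv_mem_nrm_iff G K M F) ?_
  change dGfun G K ρ M _ = 0 ↔ dGfun G Unit ρ' M F = 0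
  rw [← rowEquiv_dGfun G K ρ M ρ', AddEquiv.map_eq_zero_iff]

lemma rowEquiv_mem_BRow_iff (ρ' : G →* MulAut Unit) {n : ℕ} (F : Cpq G Unit M n 0) :
    rowEquiv M n F ∈ BRow G K ρ M n ↔ F ∈ BRow G Unit ρ' M n := by
  rcases n with _ | n
  · exact (rowEquiv (K := K) M 0).map_eq_zero_iff
  · constructor
    · rintro ⟨E, hE, h⟩
      obtain ⟨E, rfl⟩ := (rowEquiv (G := G) (K := K) M n).surjective E
      exact ⟨E, (rowEquiv_mem_nrm_iff G K M E).1 hE, (rowEquiv (K := K) M (n + 1)).injective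
        ((rowEquiv_dGfun G K ρ M ρ' E).trans h)⟩
    · rintro ⟨E, hE, rfl⟩
      exact ⟨rowEquiv M n E, (rowEquiv_mem_nrm_iff G K M E).2 hE,
        (rowEquiv_dGfun G K ρ M ρ' E).symm⟩

variable {k : Type} [CommRing k] [Module k M]

variable (k) in
/-- The cohomology of the zeroth row is the cohomology of the group. -/
noncomputable def groupCohomologyEquivHRow (n : ℕ) :
    groupCohomology (Rep.trivial k G M) n ≃+ HRow G K ρ M n :=
  have := subsingleton_HA_unit G M 1 n
  let _ : Unique (HA G Unit 1 M n) := Unique.mk' _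
  let θ : G ≃* Unit ⋊[(1 : G →* MulAut Unit)] G :=
    { toFun := fun g => ⟨(), g⟩
      invFun := fun x => x.right
      left_inv := fun _ => rfl
      right_inv := fun _ => rfl
      map_mul' := fun _ _ => rfl }
  (groupCohomologyEquivHC M θ n).trans <| (HCEquiv G Unit 1 M n).trans <|
    AddEquiv.uniqueProd.trans <| subquotientCongr (rowEquiv M n)
      (rowEquiv_mem_ZRow_iff G K ρ M 1) (rowEquiv_mem_BRow_iff G K ρ M 1)

variable (k) in
/-- The cohomology of a semidirect product splits off the cohomology of the quotient. -/
noncomputable def groupCohomologySplitting (n : ℕ) :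
    groupCohomology (Rep.trivial k (K ⋊[ρ] G) M) n ≃+
      HA G K ρ M n × groupCohomology (Rep.trivial k G M) n :=
  (groupCohomologyEquivHC M (MulEquiv.refl _) n).trans <| (HCEquiv G K ρ M n).trans <|
    (AddEquiv.refl _).prodCongr (groupCohomologyEquivHRow G K ρ M k n).symm

end ZerothRow

end Helpers

/-- There is a canonical direct-sum decomposition of double complexes
`C^{*,*}(K ⋊ G, M) ≅ A^{*,*}(K ⋊ G, M) ⊕ C^*(G, M)` (the splitting map is additive and
bijective, compatible with normalization and with the differentials), inducing a
canonical isomorphism `H^*(K ⋊ G, M) ≅ H^*(Tot^*(A^{*,*}(K ⋊ G, M))) ⊕ H^*(G, M)`,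
both for `M = ℤ` and for `M = 𝕋` (the circle group `ℝ/ℤ`). -/
theorem stmt_6 :
    (∀ n : ℕ, Function.Bijective (splitMap G K ℤ n)) ∧
    (∀ (n : ℕ) (a a' : TotA G K ℤ n) (c c' : Cpq G K ℤ n 0),
      splitMap G K ℤ n (a + a', c + c') = splitMap G K ℤ n (a, c) + splitMap G K ℤ n (a', c')) ∧
    (∀ (n : ℕ) (a : TotA G K ℤ n) (c : Cpq G K ℤ n 0),
      splitMap G K ℤ (n + 1) (totdAFun G K ρ ℤ a, dGfun G K ρ ℤ c) =
        totdFun G K ρ ℤ (splitMap G K ℤ n (a, c))) ∧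
    (∀ (n : ℕ) (a : TotA G K ℤ n) (c : Cpq G K ℤ n 0),
      splitMap G K ℤ n (a, c) ∈ nrmC G K ℤ n ↔
        (a ∈ nrmA G K ℤ n ∧ c ∈ nrm G K ℤ n 0)) ∧
    (∀ n : ℕ, Nonempty
      ((groupCohomology (Rep.trivial ℤ (K ⋊[ρ] G) ℤ) n) ≃+
        (HA G K ρ ℤ n × (groupCohomology (Rep.trivial ℤ G ℤ) n)))) ∧
    (∀ n : ℕ, Nonempty
      ((groupCohomology (Rep.trivial ℤ (K ⋊[ρ] G) (AddCircle (1 : ℝ))) n) ≃+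
        (HA G K ρ (AddCircle (1 : ℝ)) n ×
          (groupCohomology (Rep.trivial ℤ G (AddCircle (1 : ℝ))) n)))) := by
  refine ⟨splitMap_bijective G K ℤ, fun n a a' c c' => splitMap_add G K ℤ n (a, c) (a', c'),
    splitMap_totdAFun_dGfun G K ρ ℤ, splitMap_mem_nrmC_iff G K ℤ, fun n => ?_, fun n => ?_⟩
  · exact ⟨groupCohomologySplitting G K ρ ℤ ℤ n⟩
  · exact ⟨groupCohomologySplitting G K ρ (AddCircle (1 : ℝ)) ℤ n⟩

end Stmt6
end
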